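/- Let (A, φ) be a C*-probability space with faithful tracial φ and let (X_i)_{i∈ℕ} be free, identically distributed, self-adjoint elements of A (i.e. φ(X_1^k) = φ(X_i^k) for all i, k) with φ(X_1) = 0 and φ(X_1²) = 1. Set S_n := ∑_{i=1}^n X_i and V_n² := ∑_{i=1}^n X_i². Then: (a) for every n > 16‖X_1‖⁴ the element V_n² is invertible in A and U_n := V_n^{−1/2} S_n V_n^{−1/2} is well-defined; (b) there is an absolute constant C > 0 such that for all n > 16‖X_1‖⁴ the analytic distribution μ_n of U_n satisfies Δ(μ_n, ω) ≤ C‖X_1‖³·(log n)/√n; (c) μ_n converges weakly to ω and ∫ x^k μ_n(dx) → ∫ x^k ω(dx) for all k ∈ ℕ; (d) for n > 64‖X_1‖⁴, supp μ_n ⊂ ( −2 − 58‖X_1‖²/√n , 2 + 58‖X_1‖²/√n ). -/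

import Mathlib

open MeasureTheory Filter Topology

noncomputable section

/-- Wigner's semicircle law: density `(2π)⁻¹ √(4 - t²)` on `[-2, 2]`. -/
def semicircleLaw : Measure ℝ :=
  volume.withDensity fun t =>
    ENNReal.ofReal (Set.indicator (Set.Icc (-2 : ℝ) 2)
      (fun t => (2 * Real.pi)⁻¹ * Real.sqrt (4 - t ^ 2)) t)

/-- Distribution function of a measure on `ℝ`. -/
def cdf (μ : Measure ℝ) (x : ℝ) : ℝ := (μ (Set.Iic x)).toReal

/-- Kolmogorov distance. -/
def kolDist (μ ν : Measure ℝ) : ℝ := ⨆ x : ℝ, |cdf μ x - cdf ν x|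

/-- Cauchy transform. -/
def cauchyG (μ : Measure ℝ) (z : ℂ) : ℂ := ∫ t, (z - (t : ℂ))⁻¹ ∂μ

/-- Support of a measure on `ℝ`. -/
def msupport (μ : Measure ℝ) : Set ℝ :=
  {x : ℝ | ∀ U : Set ℝ, IsOpen U → x ∈ U → 0 < μ U}

variable {A : Type*}

/-- `φ` is a state: unital and positive. -/
def IsState [Ring A] [StarRing A] [Algebra ℂ A] (φ : A →ₗ[ℂ] ℂ) : Prop :=
  φ 1 = 1 ∧ ∀ x : A, 0 ≤ (φ (star x * x)).re ∧ (φ (star x * x)).im = 0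

/-- `φ` is tracial. -/
def IsTracial [Ring A] [Algebra ℂ A] (φ : A →ₗ[ℂ] ℂ) : Prop :=
  ∀ x y : A, φ (x * y) = φ (y * x)

/-- `φ` is faithful. -/
def IsFaithful [Ring A] [StarRing A] [Algebra ℂ A] (φ : A →ₗ[ℂ] ℂ) : Prop :=
  ∀ x : A, φ (star x * x) = 0 → x = 0

/-- Freeness of a family of unital subalgebras w.r.t. `φ`. -/
def IsFreeFamily [Ring A] [Algebra ℂ A] (φ : A →ₗ[ℂ] ℂ)
    {I : Type*} (S : I → Subalgebra ℂ A) : Prop :=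
  ∀ (k : ℕ) (idx : Fin (k + 1) → I),
    (∀ j : Fin k, idx j.castSucc ≠ idx j.succ) →
    ∀ x : Fin (k + 1) → A, (∀ j, x j ∈ S (idx j)) → (∀ j, φ (x j) = 0) →
      φ (List.ofFn x).prod = 0

/-- Freeness of a family of elements: the generated unital subalgebras are free. -/
def AreFree [Ring A] [Algebra ℂ A] (φ : A →ₗ[ℂ] ℂ) {I : Type*} (X : I → A) : Prop :=
  IsFreeFamily φ fun i => Algebra.adjoin ℂ {X i}

/-- `μ` is the analytic distribution of `x`: a probability measure whose moments are the
`φ`-moments of `x`. -/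
def IsDistribution [Ring A] [Algebra ℂ A] (φ : A →ₗ[ℂ] ℂ) (x : A) (μ : Measure ℝ) : Prop :=
  IsProbabilityMeasure μ ∧ ∀ k : ℕ, φ (x ^ k) = ((∫ t, t ^ k ∂μ : ℝ) : ℂ)

/-- The Lyapunov-type fraction `L_{S,kn} = (∑_{i<n} ‖X i‖ ^ k) / B_n ^ k`. -/
def Lsn [Norm A] (X : ℕ → A) (σ : ℕ → ℝ) (k n : ℕ) : ℝ :=
  (∑ i ∈ Finset.range n, ‖X i‖ ^ k) /
    Real.sqrt (∑ i ∈ Finset.range n, σ i ^ 2) ^ k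

/-- `s` is a standard semicircular element. -/
def IsStdSemicircular [Ring A] [StarRing A] [Algebra ℂ A] (φ : A →ₗ[ℂ] ℂ) (s : A) : Prop :=
  IsSelfAdjoint s ∧ ∀ k : ℕ, φ (s ^ k) = ((∫ t, t ^ k ∂semicircleLaw : ℝ) : ℂ)

end

set_option linter.unusedSectionVars false

namespace FreeCLT

section GNS

open scoped ComplexOrder InnerProductSpace

variable {A : Type*} [CStarAlgebra A] [PartialOrder A] [StarOrderedRing A] (f : A →ₚ[ℂ] ℂ)

/-- The seminorm `x ↦ φ(x* x)^{1/2}` of a positive functional. -/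
noncomputable def l2 (x : A) : ℝ := ‖f.toPreGNS x‖

lemma l2_nonneg (x : A) : 0 ≤ l2 f x := norm_nonneg _

lemma l2_sq (x : A) : l2 f x ^ 2 = (f (star x * x)).re := by
  have h := f.preGNS_norm_sq (f.toPreGNS x)
  rw [f.ofPreGNS_toPreGNS] at h
  rw [l2, ← h]
  norm_cast

lemma ofReal_l2_sq (x : A) : ((l2 f x ^ 2 : ℝ) : ℂ) = f (star x * x) := by
  have h := f.preGNS_norm_sq (f.toPreGNS x)
  rw [f.ofPreGNS_toPreGNS] at h
  rw [l2, ← h]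
  norm_cast

lemma l2_add_le (x y : A) : l2 f (x + y) ≤ l2 f x + l2 f y := by
  simp only [l2, map_add]; exact norm_add_le _ _

lemma l2_sub_le (x y : A) : l2 f (x - y) ≤ l2 f x + l2 f y := by
  simp only [l2, map_sub]; exact norm_sub_le _ _

lemma l2_smul (c : ℂ) (x : A) : l2 f (c • x) = ‖c‖ * l2 f x := by
  simp only [l2, map_smul]; exact norm_smul _ _

lemma l2_sum_le {ι : Type*} (s : Finset ι) (x : ι → A) :
    l2 f (∑ i ∈ s, x i) ≤ ∑ i ∈ s, l2 f (x i) := by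
  simp only [l2, map_sum]; exact norm_sum_le _ _

lemma norm_inner_le_l2 (x y : A) : ‖f (star x * y)‖ ≤ l2 f x * l2 f y := by
  have h := norm_inner_le_norm (𝕜 := ℂ) (f.toPreGNS x) (f.toPreGNS y)
  rwa [f.preGNS_inner_def] at h

lemma l2_mul_le (a x : A) : l2 f (a * x) ≤ ‖a‖ * l2 f x := by
  have h := (f.leftMulMapPreGNS a).le_opNorm (f.toPreGNS x)
  have h2 : ‖f.leftMulMapPreGNS a‖ ≤ ‖a‖ := LinearMap.mkContinuous_norm_le _ (norm_nonneg _) _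
  exact h.trans (mul_le_mul_of_nonneg_right h2 (norm_nonneg _))

lemma map_star_eq (x : A) : f (star x) = star (f x) := map_star f x

variable {f}

lemma l2_one (h1 : f 1 = 1) : l2 f 1 = 1 := by
  have := l2_sq f 1
  rw [star_one, one_mul, h1] at this
  nlinarith [l2_nonneg f (1 : A), this, Complex.one_re]

lemma l2_le_norm (h1 : f 1 = 1) (x : A) : l2 f x ≤ ‖x‖ := by
  have := l2_mul_le f x 1
  rwa [mul_one, l2_one h1, mul_one] at this

lemma norm_apply_le_l2 (h1 : f 1 = 1) (x : A) : ‖f x‖ ≤ l2 f x := by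
  have := norm_inner_le_l2 f 1 x
  rwa [star_one, one_mul, l2_one h1, one_mul] at this

lemma norm_apply_le (h1 : f 1 = 1) (x : A) : ‖f x‖ ≤ ‖x‖ :=
  (norm_apply_le_l2 h1 x).trans (l2_le_norm h1 x)

lemma continuous_apply (h1 : f 1 = 1) : Continuous fun x : A => f x :=
  AddMonoidHomClass.continuous_of_bound f 1 fun x => by
    simpa using norm_apply_le h1 x

lemma apply_algebraMap (h1 : f 1 = 1) (c : ℂ) : f (algebraMap ℂ A c) = c := by
  rw [Algebra.algebraMap_eq_smul_one, map_smul, h1, smul_eq_mul, mul_one]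

lemma im_apply_eq_zero {x : A} (hx : IsSelfAdjoint x) : (f x).im = 0 := by
  have h := map_star_eq f x
  rw [hx.star_eq] at h
  exact Complex.conj_eq_iff_im.1 h.symm

end GNS

section Words

open scoped ComplexOrder

variable {A : Type*} [CStarAlgebra A] [PartialOrder A] [StarOrderedRing A] {f : A →ₚ[ℂ] ℂ}
variable {I : Type*}

lemma isFreeFamily_mono {S T : I → Subalgebra ℂ A} (hST : ∀ i, S i ≤ T i)
    (h : IsFreeFamily f.toLinearMap T) : IsFreeFamily f.toLinearMap S :=
  fun k idx hidx x hx h0 => h k idx hidx x (fun j => hST _ (hx j)) h0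

lemma isFreeFamily_comp {J : Type*} {S : I → Subalgebra ℂ A} {g : J → I}
    (hg : Function.Injective g) (h : IsFreeFamily f.toLinearMap S) :
    IsFreeFamily f.toLinearMap fun j => S (g j) :=
  fun k idx hidx x hx h0 => h k (g ∘ idx) (fun j => hg.ne (hidx j)) x hx h0

lemma isFreeFamily_topologicalClosure (h1 : f 1 = 1) {S : I → Subalgebra ℂ A}
    (h : IsFreeFamily f.toLinearMap S) :
    IsFreeFamily f.toLinearMap fun i => (S i).topologicalClosure := by
  intro k idx hidx x hx h0
  have hcl : ∀ j, x j ∈ closure {y : A | y ∈ S (idx j) ∧ f y = 0} := by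
    intro j
    have hc : Continuous fun y : A => y - algebraMap ℂ A (f y) :=
      continuous_id.sub ((continuous_algebraMap ℂ A).comp (continuous_apply h1))
    have hxj : x j - algebraMap ℂ A (f (x j)) = x j := by
      have : f (x j) = 0 := h0 j
      rw [this, map_zero, sub_zero]
    have := map_mem_closure (t := {y : A | y ∈ S (idx j) ∧ f y = 0}) hc (hx j) ?_
    · rwa [hxj] at this
    intro y hy
    refine ⟨(S (idx j)).sub_mem hy ((S (idx j)).algebraMap_mem _), ?_⟩
    rw [map_sub, apply_algebraMap h1, sub_self]
  have hpi : x ∈ closure (Set.pi Set.univ fun j => {y : A | y ∈ S (idx j) ∧ f y = 0}) := by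
    rw [closure_pi_set]
    exact fun j _ => hcl j
  have hclosed : IsClosed {y : Fin (k + 1) → A | f (List.ofFn y).prod = 0} := by
    refine isClosed_eq ((continuous_apply h1).comp ?_) continuous_const
    have : (fun y : Fin (k + 1) → A => (List.ofFn y).prod) =
        fun y => ((List.finRange (k + 1)).map fun i => y i).prod := by
      funext y; rw [List.ofFn_eq_map]
    rw [this]
    exact continuous_list_prod _ fun i _ => _root_.continuous_apply i
  exact closure_minimal (fun y hy => h k idx hidx y (fun j => (hy j trivial).1)
    fun j => (hy j trivial).2) hclosed hpi

lemma star_mem_topologicalClosure {S : Subalgebra ℂ A} (hS : ∀ x ∈ S, star x ∈ S) :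
    ∀ x ∈ S.topologicalClosure, star x ∈ S.topologicalClosure :=
  fun _ hx => map_mem_closure continuous_star hx hS

lemma star_mem_adjoin {a : A} (ha : IsSelfAdjoint a) :
    ∀ x ∈ Algebra.adjoin ℂ {a}, star x ∈ Algebra.adjoin ℂ {a} := by
  intro x hx
  induction hx using Algebra.adjoin_induction with
  | mem x hx =>
    rw [Set.mem_singleton_iff.1 hx, ha.star_eq]
    exact Algebra.self_mem_adjoin_singleton ℂ a
  | algebraMap r =>
    rw [← algebraMap_star_comm]
    exact Subalgebra.algebraMap_mem _ _
  | add x y _ _ hx hy => rw [star_add]; exact add_mem hx hy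
  | mul x y _ _ hx hy => rw [star_mul]; exact mul_mem hy hx

variable (f) in
/-- Lists of letters, neighbours from different subalgebras, each letter centered. -/
def IsAlternating (S : I → Subalgebra ℂ A) (L : List (I × A)) : Prop :=
  L.IsChain (fun p q => p.1 ≠ q.1) ∧ ∀ p ∈ L, p.2 ∈ S p.1 ∧ f p.2 = 0

lemma IsAlternating.apply_prod {S : I → Subalgebra ℂ A} (h : IsFreeFamily f.toLinearMap S)
    {L : List (I × A)} (hL : IsAlternating f S L) (hne : L ≠ []) :
    f (L.map Prod.snd).prod = 0 := by
  obtain ⟨k, hk⟩ : ∃ k, L.length = k + 1 :=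
    ⟨L.length - 1, by have := List.length_pos_iff.2 hne; omega⟩
  have key := h k (fun j => (L[j.1]'(by omega)).1) ?_ (fun j => (L[j.1]'(by omega)).2) ?_ ?_
  · have : (List.ofFn fun j : Fin (k + 1) => (L[j.1]'(by omega)).2) = L.map Prod.snd := by
      apply List.ext_getElem
      · simp [hk]
      · intro i h1 h2; rw [List.getElem_ofFn, List.getElem_map]
    rw [this] at key
    exact key
  · intro j
    have := List.isChain_iff_getElem.1 hL.1 j.1 (by omega)
    simpa using this
  · intro j
    exact (hL.2 _ (List.getElem_mem _)).1
  · intro j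
    exact (hL.2 _ (List.getElem_mem _)).2

variable (f) in
/-- Span of the alternating centered words starting in the `i`-th subalgebra. -/
noncomputable def wordsFrom (S : I → Subalgebra ℂ A) (i : I) : Submodule ℂ A :=
  Submodule.span ℂ {x | ∃ a L, IsAlternating f S ((i, a) :: L) ∧
    x = (((i, a) :: L).map Prod.snd).prod}

variable (f) in
/-- Span of the alternating centered words, the empty one included, that do not start in the
`i`-th subalgebra. -/
noncomputable def wordsAvoiding (S : I → Subalgebra ℂ A) (i : I) : Submodule ℂ A :=
  Submodule.span ℂ {x | ∃ L, IsAlternating f S L ∧ (∀ p ∈ L.head?, p.1 ≠ i) ∧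
    x = (L.map Prod.snd).prod}

lemma wordsFrom_le_wordsAvoiding (S : I → Subalgebra ℂ A) {i j : I} (hij : j ≠ i) :
    wordsFrom f S j ≤ wordsAvoiding f S i := by
  refine Submodule.span_mono ?_
  rintro x ⟨a, L, hL, rfl⟩
  exact ⟨(j, a) :: L, hL, by simpa using hij, rfl⟩

lemma one_mem_wordsAvoiding (S : I → Subalgebra ℂ A) (i : I) : 1 ∈ wordsAvoiding f S i :=
  Submodule.subset_span ⟨[], ⟨List.isChain_nil, by simp⟩, by simp, by simp⟩

lemma mul_mem_wordsFrom {S : I → Subalgebra ℂ A} {i : I} {r x : A} (hr : r ∈ S i)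
    (hr0 : f r = 0) (hx : x ∈ wordsAvoiding f S i) : r * x ∈ wordsFrom f S i := by
  induction hx using Submodule.span_induction with
  | mem x hx =>
    obtain ⟨L, hL, hhead, rfl⟩ := hx
    refine Submodule.subset_span ⟨r, L, ⟨?_, ?_⟩, by simp⟩
    · rw [List.isChain_cons]
      exact ⟨fun p hp => (hhead p hp).symm, hL.1⟩
    · intro p hp
      rcases List.mem_cons.1 hp with rfl | hp
      · exact ⟨hr, hr0⟩
      · exact hL.2 p hp
  | zero => rw [mul_zero]; exact zero_mem _
  | add x y _ _ hx hy => rw [mul_add]; exact add_mem hx hy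
  | smul c x _ hx => rw [mul_smul_comm]; exact Submodule.smul_mem _ _ hx

lemma apply_star_mul_eq_zero {S : I → Subalgebra ℂ A} (hstar : ∀ i, ∀ x ∈ S i, star x ∈ S i)
    (h : IsFreeFamily f.toLinearMap S) {i : I} {u v : A} (hu : u ∈ wordsFrom f S i)
    (hv : v ∈ wordsAvoiding f S i) : f (star u * v) = 0 := by
  induction hu using Submodule.span_induction with
  | zero => simp
  | add x y _ _ hx hy => rw [star_add, add_mul, map_add, hx, hy, add_zero]
  | smul c x _ hx => rw [star_smul, smul_mul_assoc, map_smul, hx, smul_zero]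
  | mem u hu =>
    induction hv using Submodule.span_induction with
    | zero => simp
    | add x y _ _ hx hy => rw [mul_add, map_add, hx, hy, add_zero]
    | smul c x _ hx => rw [mul_smul_comm, map_smul, hx, smul_zero]
    | mem v hv =>
      obtain ⟨a, L, hL, rfl⟩ := hu
      obtain ⟨L', hL', hhead, rfl⟩ := hv
      set M : List (I × A) := (((i, a) :: L).map fun p => (p.1, star p.2)).reverse with hM
      have hMalt : IsAlternating f S (M ++ L') := by
        constructor
        · rw [List.isChain_append]
          refine ⟨?_, hL'.1, ?_⟩
          · rw [hM, List.isChain_reverse, List.isChain_map]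
            exact hL.1.imp fun p q hpq => hpq.symm
          · intro p hp q hq
            rw [hM, List.getLast?_reverse] at hp
            simp only [List.map_cons, List.head?_cons, Option.mem_some_iff] at hp
            rw [← hp]
            exact (hhead q hq).symm
        · intro p hp
          rcases List.mem_append.1 hp with hp | hp
          · rw [hM, List.mem_reverse, List.mem_map] at hp
            obtain ⟨q, hq, rfl⟩ := hp
            refine ⟨hstar _ _ (hL.2 q hq).1, ?_⟩
            rw [map_star_eq, (hL.2 q hq).2, star_zero]
          · exact hL'.2 p hp
      have hMprod : (M.map Prod.snd).prod = star (((i, a) :: L).map Prod.snd).prod := by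
        rw [hM]
        generalize (i, a) :: L = N
        induction N with
        | nil => simp
        | cons p N ih =>
          simp only [List.map_cons, List.reverse_cons, List.map_append, List.prod_append,
            List.prod_cons, star_mul, ih, List.map_nil, List.prod_nil, mul_one]
      have := hMalt.apply_prod h (by simp [hM])
      rwa [List.map_append, List.prod_append, hMprod] at this

lemma l2_mul_sq (h1 : f 1 = 1) {S : I → Subalgebra ℂ A}
    (hstar : ∀ i, ∀ x ∈ S i, star x ∈ S i)
    (h : IsFreeFamily f.toLinearMap S) {i : I} {r x : A} (hr : r ∈ S i)
    (hx : x ∈ wordsAvoiding f S i) : l2 f (r * x) ^ 2 = l2 f r ^ 2 * l2 f x ^ 2 := by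
  set d : A := star r * r - algebraMap ℂ A (f (star r * r)) with hd
  have hdS : d ∈ S i := sub_mem (mul_mem (hstar _ _ hr) hr) (Subalgebra.algebraMap_mem _ _)
  have hd0 : f d = 0 := by rw [hd, map_sub, apply_algebraMap h1, sub_self]
  have hdx := apply_star_mul_eq_zero hstar h (mul_mem_wordsFrom hdS hd0 hx) hx
  have hdx' : f (star x * (d * x)) = 0 := by
    have : star x * (d * x) = star (star (d * x) * x) := by rw [star_mul, star_star]
    rw [this, map_star_eq, hdx, star_zero]
  have hexp : star (r * x) * (r * x) =
      star x * (d * x) + f (star r * r) • (star x * x) := by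
    rw [hd, star_mul, sub_mul, mul_sub, Algebra.algebraMap_eq_smul_one, smul_mul_assoc, one_mul,
      mul_smul_comm]
    simp only [mul_assoc, sub_add_cancel]
  have : ((l2 f (r * x) ^ 2 : ℝ) : ℂ) = ((l2 f r ^ 2 * l2 f x ^ 2 : ℝ) : ℂ) := by
    rw [Complex.ofReal_mul, ofReal_l2_sq, ofReal_l2_sq, ofReal_l2_sq, hexp, map_add, hdx',
      map_smul, zero_add, smul_eq_mul]
  exact_mod_cast this

lemma l2_sum_sq {S : I → Subalgebra ℂ A} (hstar : ∀ i, ∀ x ∈ S i, star x ∈ S i)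
    (h : IsFreeFamily f.toLinearMap S) (s : Finset I) {w : I → A}
    (hw : ∀ i, w i ∈ wordsFrom f S i) :
    l2 f (∑ i ∈ s, w i) ^ 2 = ∑ i ∈ s, l2 f (w i) ^ 2 := by
  classical
  have : ((l2 f (∑ i ∈ s, w i) ^ 2 : ℝ) : ℂ) = ((∑ i ∈ s, l2 f (w i) ^ 2 : ℝ) : ℂ) := by
    rw [ofReal_l2_sq, Complex.ofReal_sum]
    simp_rw [ofReal_l2_sq]
    rw [star_sum, Finset.sum_mul_sum, map_sum]
    refine Finset.sum_congr rfl fun i hi => ?_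
    rw [map_sum, Finset.sum_eq_single i]
    · intro j _ hji
      exact apply_star_mul_eq_zero hstar h (hw i) (wordsFrom_le_wordsAvoiding S hji (hw j))
    · exact fun hni => absurd hi hni
  exact_mod_cast this

end Words

section Resolvent

open scoped ComplexOrder

variable {A : Type*} [CStarAlgebra A] [PartialOrder A] [StarOrderedRing A] {f : A →ₚ[ℂ] ℂ}

lemma isUnit_of_norm_lt [NormOneClass A] {a : A} {z : ℂ} (h : ‖a‖ < ‖z‖) :
    IsUnit (algebraMap ℂ A z - a) :=
  spectrum.mem_resolventSet_of_norm_lt h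

lemma mul_resolvent {a : A} {z : ℂ} (h : IsUnit (algebraMap ℂ A z - a)) :
    (algebraMap ℂ A z - a) * resolvent a z = 1 :=
  Ring.mul_inverse_cancel _ h

lemma resolvent_mul {a : A} {z : ℂ} (h : IsUnit (algebraMap ℂ A z - a)) :
    resolvent a z * (algebraMap ℂ A z - a) = 1 :=
  Ring.inverse_mul_cancel _ h

lemma resolvent_mem_topologicalClosure [NormOneClass A] {a : A} {z : ℂ} (h : ‖a‖ < ‖z‖) :
    resolvent a z ∈ (Algebra.adjoin ℂ {a}).topologicalClosure := by
  set B := (Algebra.adjoin ℂ {a}).topologicalClosure with hB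
  have : CompleteSpace B :=
    ((Algebra.adjoin ℂ {a}).isClosed_topologicalClosure).completeSpace_coe
  let b : B := ⟨a, (Algebra.adjoin ℂ {a}).le_topologicalClosure
    (Algebra.self_mem_adjoin_singleton ℂ a)⟩
  have hu : IsUnit (algebraMap ℂ B z - b) := by
    refine spectrum.mem_resolventSet_of_norm_lt_mul ?_
    have : ‖(1 : B)‖ = 1 := (norm_one : ‖(1 : A)‖ = 1)
    rw [this, mul_one]
    exact h
  obtain ⟨u, hu⟩ := hu
  have h1 : (algebraMap ℂ A z - a) * ((↑u⁻¹ : B) : A) = 1 := by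
    have : ((algebraMap ℂ B z - b) * (↑u⁻¹ : B) : B) = 1 := by rw [← hu, Units.mul_inv]
    exact congrArg Subtype.val this
  have h2 : resolvent a z = ((↑u⁻¹ : B) : A) := by
    have h3 := resolvent_mul (isUnit_of_norm_lt h)
    calc resolvent a z = resolvent a z * ((algebraMap ℂ A z - a) * ((↑u⁻¹ : B) : A)) := by
          rw [h1, mul_one]
      _ = _ := by rw [← mul_assoc, h3, one_mul]
  rw [h2]
  exact (↑u⁻¹ : B).2

lemma eq_zero_of_l2_eq_zero (hf : ∀ x, f (star x * x) = 0 → x = 0) {x : A}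
    (h : l2 f x = 0) : x = 0 := by
  apply hf
  rw [← ofReal_l2_sq, h]; simp

section OneVariable

variable {Y R : A} {Z : ℂ}

lemma norm_mul_l2_sq_le {M : ℝ} (hM : ‖Y‖ ≤ M) (r : A) (v : ℂ)
    (hv : f (star r * ((algebraMap ℂ A Z - Y) * r)) = v) :
    ‖Z‖ * l2 f r ^ 2 ≤ ‖v‖ + M * l2 f r ^ 2 := by
  have h1 : Z * ((l2 f r ^ 2 : ℝ) : ℂ) = v + f (star r * (Y * r)) := by
    rw [ofReal_l2_sq, ← hv, ← map_add, ← mul_add, ← add_mul, sub_add_cancel,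
      Algebra.algebraMap_eq_smul_one, smul_mul_assoc, one_mul, mul_smul_comm, map_smul,
      smul_eq_mul]
  have h2 : ‖f (star r * (Y * r))‖ ≤ M * l2 f r ^ 2 := by
    refine (norm_inner_le_l2 f _ _).trans ?_
    have := (l2_mul_le f Y r).trans (mul_le_mul_of_nonneg_right hM (l2_nonneg f r))
    nlinarith [l2_nonneg f r]
  have h3 := congrArg norm h1
  rw [norm_mul, Complex.norm_real, Real.norm_of_nonneg (sq_nonneg _)] at h3
  rw [h3]
  exact (norm_add_le _ _).trans (by linarith)

lemma apply_resolvent_ne_zero (h1 : f 1 = 1) (hf : ∀ x, f (star x * x) = 0 → x = 0)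
    (hM : ‖Y‖ < ‖Z‖) (hR : (algebraMap ℂ A Z - Y) * R = 1) : f R ≠ 0 := by
  intro h0
  have := norm_mul_l2_sq_le (f := f) (Z := Z) le_rfl R 0 (by
    rw [hR, mul_one, map_star_eq, h0, star_zero])
  rw [norm_zero, zero_add] at this
  have h2 : l2 f R = 0 := by
    have : l2 f R ^ 2 ≤ 0 := by nlinarith [sq_nonneg (l2 f R)]
    exact pow_eq_zero_iff (two_ne_zero) |>.1 (le_antisymm this (sq_nonneg _))
  rw [eq_zero_of_l2_eq_zero hf h2, mul_zero] at hR
  rw [← hR, map_zero] at h1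
  exact zero_ne_one h1

variable (h1 : f 1 = 1) (hY : f Y = 0) (hR : (algebraMap ℂ A Z - Y) * R = 1) (hg : f R ≠ 0)

include h1 hg in
lemma apply_centered : f ((f R)⁻¹ • R - 1) = 0 := by
  rw [map_sub, map_smul, h1, smul_eq_mul, inv_mul_cancel₀ hg, sub_self]

include hR in
lemma sub_mul_centered :
    (algebraMap ℂ A Z - Y) * ((f R)⁻¹ • R - 1) = algebraMap ℂ A ((f R)⁻¹ - Z) + Y := by
  rw [mul_sub, mul_smul_comm, hR, mul_one, map_sub, Algebra.algebraMap_eq_smul_one (f R)⁻¹]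
  abel

include h1 hY hR hg in
lemma apply_mul_centered : f (Y * ((f R)⁻¹ • R - 1)) = Z - (f R)⁻¹ := by
  have h := congrArg f (sub_mul_centered (f := f) hR)
  rw [sub_mul, Algebra.algebraMap_eq_smul_one Z, smul_mul_assoc, one_mul, map_sub, map_smul,
    apply_centered h1 hg, map_add, hY, apply_algebraMap h1, smul_zero] at h
  linear_combination -h

include h1 hY hR hg in
lemma mul_apply_mul_centered : Z * f (Y * ((f R)⁻¹ • R - 1)) =
    f (Y * Y) + f (Y * Y * ((f R)⁻¹ • R - 1)) := by
  have h := congrArg (fun x => f (Y * x)) (sub_mul_centered (f := f) hR)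
  simp only [sub_mul, mul_sub, mul_add, map_sub, map_add, Algebra.algebraMap_eq_smul_one,
    mul_smul_comm, smul_mul_assoc, one_mul, mul_one, map_smul, hY, smul_eq_mul, mul_zero] at h ⊢
  simp only [mul_assoc] at h ⊢
  linear_combination h

include h1 hR hg in
lemma l2_centered_le {M : ℝ} (hM : ‖Y‖ ≤ M) (hMZ : M < ‖Z‖) :
    l2 f ((f R)⁻¹ • R - 1) ≤ l2 f Y / (‖Z‖ - M) := by
  set r := (f R)⁻¹ • R - 1 with hr
  have h0 : f (star r) = 0 := by rw [map_star_eq, apply_centered h1 hg, star_zero]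
  have key := norm_mul_l2_sq_le (f := f) (Z := Z) hM r (f (star r * Y)) (by
    rw [sub_mul_centered hR, mul_add, map_add, Algebra.algebraMap_eq_smul_one, mul_smul_comm,
      mul_one, map_smul, h0, smul_zero, zero_add])
  have h2 := norm_inner_le_l2 f r Y
  rw [le_div_iff₀ (by linarith)]
  rcases (l2_nonneg f r).eq_or_lt with h | h
  · rw [← h]; simpa using l2_nonneg f Y
  · have : l2 f r * (l2 f r * (‖Z‖ - M)) ≤ l2 f r * l2 f Y := by nlinarith
    exact le_of_mul_le_mul_left this h

end OneVariable

section Sum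

variable {ι : Type*} [Fintype ι] [DecidableEq ι]

/-- Row-wise partial sums of the alternating words in the letters `r`: words of length `k` that do
not start with the given index. -/
def words (r : ι → A) : ℕ → ι → A
  | 0, _ => 1
  | k + 1, i => ∑ j ∈ Finset.univ.erase i, r j * words r k j

lemma words_mem {S : ι → Subalgebra ℂ A} {r : ι → A} (hr : ∀ i, r i ∈ S i)
    (hr0 : ∀ i, f (r i) = 0) (k : ℕ) (i : ι) : words r k i ∈ wordsAvoiding f S i := by
  induction k generalizing i with
  | zero => exact one_mem_wordsAvoiding S i
  | succ k ih =>
    refine Submodule.sum_mem _ fun j hj => ?_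
    exact wordsFrom_le_wordsAvoiding S (Finset.ne_of_mem_erase hj)
      (mul_mem_wordsFrom (hr j) (hr0 j) (ih j))

lemma l2_words_sq_le (h1 : f 1 = 1) {S : ι → Subalgebra ℂ A}
    (hstar : ∀ i, ∀ x ∈ S i, star x ∈ S i)
    (h : IsFreeFamily f.toLinearMap S) {r : ι → A} (hr : ∀ i, r i ∈ S i)
    (hr0 : ∀ i, f (r i) = 0) {ρ : ℝ} (hρ : ∀ i, l2 f (r i) ^ 2 ≤ ρ) (k : ℕ) (i : ι) :
    l2 f (words r k i) ^ 2 ≤ ((Fintype.card ι - 1) * ρ) ^ k := by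
  induction k generalizing i with
  | zero => simp [words, l2_one h1]
  | succ k ih =>
    have hw : ∀ j, r j * words r k j ∈ wordsFrom f S j := fun j =>
      mul_mem_wordsFrom (hr j) (hr0 j) (words_mem hr hr0 k j)
    rw [words, l2_sum_sq hstar h _ hw]
    have hb : ∀ j ∈ Finset.univ.erase i, l2 f (r j * words r k j) ^ 2 ≤
        ρ * ((Fintype.card ι - 1) * ρ) ^ k := by
      intro j _
      rw [l2_mul_sq h1 hstar h (hr j) (words_mem hr hr0 k j)]
      exact mul_le_mul (hρ j) (ih j) (sq_nonneg _) ((sq_nonneg _).trans (hρ j))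
    refine (Finset.sum_le_sum hb).trans ?_
    rw [Finset.sum_const, Finset.card_erase_of_mem (Finset.mem_univ i), Finset.card_univ,
      nsmul_eq_mul, Nat.cast_sub (Fintype.card_pos_iff.2 ⟨i⟩), Nat.cast_one, pow_succ]
    apply le_of_eq; ring

lemma sub_sum_mul_words (X r : ι → A) {z Z F : ℂ}
    (hz : z = Fintype.card ι * Z - (Fintype.card ι - 1) * F)
    (hr : ∀ i, (algebraMap ℂ A Z - X i) * (1 + r i) = algebraMap ℂ A F) (K : ℕ) :
    (algebraMap ℂ A z - ∑ i, X i) * (1 + ∑ k ∈ Finset.range K, ∑ i, r i * words r k i) =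
      algebraMap ℂ A F + ∑ i, (algebraMap ℂ A (Z - F) - X i) * words r K i := by
  have hsplit : ∀ K i, 1 + ∑ k ∈ Finset.range K, ∑ j, r j * words r k j =
      ∑ k ∈ Finset.range K, (1 + r i) * words r k i + words r K i := by
    intro K i
    induction K with
    | zero => simp [words]
    | succ K ih =>
      rw [Finset.sum_range_succ, ← add_assoc, ih, Finset.sum_range_succ, add_assoc, add_assoc]
      congr 1
      rw [words, ← Finset.add_sum_erase _ _ (Finset.mem_univ i), add_mul, one_mul, add_assoc]
  have hD : ∀ i, (algebraMap ℂ A (Z - F) - X i) * (1 + r i) = -(F • r i) := by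
    intro i
    have : algebraMap ℂ A (Z - F) - X i = (algebraMap ℂ A Z - X i) - F • 1 := by
      rw [map_sub, Algebra.algebraMap_eq_smul_one F]; abel
    rw [this, sub_mul, hr, smul_mul_assoc, one_mul, smul_add, Algebra.algebraMap_eq_smul_one F]
    abel
  have hzS : algebraMap ℂ A z - ∑ i, X i =
      algebraMap ℂ A F + ∑ i, (algebraMap ℂ A (Z - F) - X i) := by
    rw [Finset.sum_sub_distrib, Finset.sum_const, Finset.card_univ, ← map_nsmul, hz, ← add_sub_assoc,
      ← map_add]
    congr 2
    rw [nsmul_eq_mul]; ring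
  set ξ := 1 + ∑ k ∈ Finset.range K, ∑ i, r i * words r k i with hξ
  have hDξ : ∀ i, (algebraMap ℂ A (Z - F) - X i) * ξ =
      -(F • ∑ k ∈ Finset.range K, r i * words r k i) +
        (algebraMap ℂ A (Z - F) - X i) * words r K i := by
    intro i
    rw [hξ, hsplit K i, mul_add, Finset.mul_sum, Finset.smul_sum, ← Finset.sum_neg_distrib]
    congr 1
    refine Finset.sum_congr rfl fun k _ => ?_
    rw [← mul_assoc, hD, neg_mul, smul_mul_assoc]
  rw [hzS, add_mul, Finset.sum_mul, Finset.sum_congr rfl fun i _ => hDξ i,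
    Finset.sum_add_distrib, ← add_assoc, Finset.sum_neg_distrib, ← Finset.smul_sum,
    Finset.sum_comm, Algebra.algebraMap_eq_smul_one, smul_mul_assoc, one_mul, hξ, smul_add]
  abel

/-- Approximate `L²`-inverse of `z - ∑ X i` through the subordination map
`Z ↦ n Z - (n - 1) / G(Z)` of identically distributed free summands. -/
theorem exists_approx_inverse [Nonempty ι] [NormOneClass A] (h1 : f 1 = 1)
    (hf : ∀ x, f (star x * x) = 0 → x = 0) {X : ι → A} (hsa : ∀ i, IsSelfAdjoint (X i))
    (hfree : IsFreeFamily f.toLinearMap fun i => Algebra.adjoin ℂ {X i})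
    {M s : ℝ} (hM : ∀ i, ‖X i‖ ≤ M) (hs : ∀ i, l2 f (X i) = s)
    {Z g : ℂ} (hMZ : M < ‖Z‖) (hsZ : s * √(Fintype.card ι) ≤ ‖Z‖ - M)
    (hg : ∀ i, f (resolvent (X i) Z) = g) :
    ∃ ξ : ℕ → A, (∀ K, f (ξ K) = g) ∧
      (∀ K, l2 f (ξ K) ≤
        ‖g‖ * (1 + (1 - √((Fintype.card ι - 1 : ℝ) * (Fintype.card ι : ℝ)⁻¹))⁻¹)) ∧
      Tendsto (fun K => l2 f ((algebraMap ℂ A (Fintype.card ι * Z - (Fintype.card ι - 1) * g⁻¹)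
        - ∑ i, X i) * ξ K - 1)) atTop (𝓝 0) := by
  set n : ℝ := (Fintype.card ι : ℝ) with hn
  have hn1 : 1 ≤ n := by
    have : 1 ≤ Fintype.card ι := Fintype.card_pos
    rw [hn]
    exact_mod_cast this
  have hu : ∀ i, IsUnit (algebraMap ℂ A Z - X i) := fun i =>
    isUnit_of_norm_lt ((hM i).trans_lt hMZ)
  have hgne : ∀ i, f (resolvent (X i) Z) ≠ 0 := fun i =>
    apply_resolvent_ne_zero h1 hf ((hM i).trans_lt hMZ) (mul_resolvent (hu i))
  have hg0 : g ≠ 0 := by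
    obtain ⟨i⟩ := ‹Nonempty ι›
    rw [← hg i]; exact hgne i
  set r : ι → A := fun i => g⁻¹ • resolvent (X i) Z - 1 with hr
  set S : ι → Subalgebra ℂ A := fun i => (Algebra.adjoin ℂ {X i}).topologicalClosure with hS
  have hfS : IsFreeFamily f.toLinearMap S := isFreeFamily_topologicalClosure h1 hfree
  have hstar : ∀ i, ∀ x ∈ S i, star x ∈ S i := fun i =>
    star_mem_topologicalClosure (star_mem_adjoin (hsa i))
  have hrS : ∀ i, r i ∈ S i := fun i =>
    sub_mem (Subalgebra.smul_mem _ (resolvent_mem_topologicalClosure ((hM i).trans_lt hMZ)) _)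
      (one_mem _)
  have hr0 : ∀ i, f (r i) = 0 := fun i => by
    have := apply_centered h1 (hgne i)
    rwa [hg i] at this
  have hs0 : 0 ≤ s := by
    obtain ⟨i⟩ := ‹Nonempty ι›
    rw [← hs i]; exact l2_nonneg f _
  have hρ : ∀ i, l2 f (r i) ^ 2 ≤ n⁻¹ := by
    intro i
    have h2 := l2_centered_le h1 (mul_resolvent (hu i)) (hgne i) (hM i) hMZ
    rw [hg i, hs i] at h2
    have h3 : s / (‖Z‖ - M) * √n ≤ 1 := by
      rw [div_mul_eq_mul_div, div_le_one (by linarith)]; exact hsZ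
    have h4 : (l2 f (r i) * √n) ^ 2 ≤ 1 := by
      have h5 : l2 f (r i) * √n ≤ 1 :=
        (mul_le_mul_of_nonneg_right h2 (Real.sqrt_nonneg _)).trans h3
      have : 0 ≤ l2 f (r i) * √n := mul_nonneg (l2_nonneg f _) (Real.sqrt_nonneg _)
      nlinarith
    rw [mul_pow, Real.sq_sqrt (by linarith)] at h4
    rwa [← one_div, le_div_iff₀ (by linarith)]
  have hq0 : 0 ≤ (n - 1) * n⁻¹ := mul_nonneg (by linarith) (by positivity)
  have hq1 : (n - 1) * n⁻¹ < 1 := by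
    rw [← div_eq_mul_inv, div_lt_one (by linarith)]; linarith
  set θ := √((n - 1) * n⁻¹) with hθ
  have hθ0 : 0 ≤ θ := Real.sqrt_nonneg _
  have hθ1 : θ < 1 := by rw [hθ, Real.sqrt_lt' one_pos]; simpa using hq1
  have hθ2 : θ ^ 2 = (n - 1) * n⁻¹ := Real.sq_sqrt hq0
  have hwords : ∀ k i, l2 f (words r k i) ≤ θ ^ k := by
    intro k i
    have := l2_words_sq_le h1 hstar hfS hrS hr0 hρ k i
    rw [← hn, ← hθ2, ← pow_mul, mul_comm, pow_mul] at this
    exact (sq_le_sq₀ (l2_nonneg f _) (by positivity)).1 this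
  have hfrom : ∀ k i, r i * words r k i ∈ wordsFrom f S i := fun k i =>
    mul_mem_wordsFrom (hrS i) (hr0 i) (words_mem hrS hr0 k i)
  have hrow : ∀ k, l2 f (∑ i, r i * words r k i) ≤ θ ^ k := by
    intro k
    refine (sq_le_sq₀ (l2_nonneg f _) (by positivity)).1 ?_
    rw [l2_sum_sq hstar hfS _ (hfrom k)]
    have : ∀ i ∈ Finset.univ, l2 f (r i * words r k i) ^ 2 ≤ n⁻¹ * (θ ^ k) ^ 2 := by
      intro i _
      rw [l2_mul_sq h1 hstar hfS (hrS i) (words_mem hrS hr0 k i)]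
      exact mul_le_mul (hρ i) (pow_le_pow_left₀ (l2_nonneg f _) (hwords k i) 2) (sq_nonneg _)
        (by positivity)
    refine (Finset.sum_le_sum this).trans ?_
    rw [Finset.sum_const, Finset.card_univ, nsmul_eq_mul, ← hn, ← mul_assoc,
      mul_inv_cancel₀ (by linarith), one_mul]
  refine ⟨fun K => g • (1 + ∑ k ∈ Finset.range K, ∑ i, r i * words r k i), ?_, ?_, ?_⟩
  · intro K
    rw [map_smul, map_add, h1, map_sum, Finset.sum_eq_zero, add_zero, smul_eq_mul, mul_one]
    intro k _
    rw [map_sum]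
    refine Finset.sum_eq_zero fun i _ => ?_
    have := apply_star_mul_eq_zero hstar hfS (hfrom k i) (one_mem_wordsAvoiding S i)
    rw [mul_one, map_star_eq] at this
    exact star_eq_zero.1 this
  · intro K
    rw [l2_smul]
    refine mul_le_mul_of_nonneg_left ((l2_add_le f _ _).trans ?_) (norm_nonneg _)
    rw [l2_one h1]
    refine add_le_add le_rfl ((l2_sum_le f _ _).trans ((Finset.sum_le_sum fun k _ => hrow k).trans ?_))
    rw [← tsum_geometric_of_lt_one hθ0 hθ1]
    exact (summable_geometric_of_lt_one hθ0 hθ1).sum_le_tsum _ fun k _ => by positivity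
  · have hrel : ∀ i, (algebraMap ℂ A Z - X i) * (1 + r i) = algebraMap ℂ A g⁻¹ := by
      intro i
      rw [hr]
      simp only [add_sub_cancel]
      rw [mul_smul_comm, mul_resolvent (hu i), Algebra.algebraMap_eq_smul_one]
    have hbound : ∀ K, l2 f ((algebraMap ℂ A (Fintype.card ι * Z - (Fintype.card ι - 1) * g⁻¹)
        - ∑ i, X i) * (g • (1 + ∑ k ∈ Finset.range K, ∑ i, r i * words r k i)) - 1) ≤
        (‖g‖ * ∑ i, ‖algebraMap ℂ A (Z - g⁻¹) - X i‖) * θ ^ K := by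
      intro K
      rw [mul_smul_comm, sub_sum_mul_words X r rfl hrel K, smul_add,
        Algebra.algebraMap_eq_smul_one g⁻¹, smul_smul, mul_inv_cancel₀ hg0, one_smul,
        add_sub_cancel_left, l2_smul, mul_assoc, Finset.sum_mul]
      refine mul_le_mul_of_nonneg_left ((l2_sum_le f _ _).trans (Finset.sum_le_sum fun i _ => ?_))
        (norm_nonneg _)
      exact (l2_mul_le f _ _).trans (mul_le_mul_of_nonneg_left (hwords K i) (norm_nonneg _))
    refine squeeze_zero (fun K => l2_nonneg f _) hbound ?_
    simpa using (tendsto_pow_atTop_nhds_zero_of_lt_one hθ0 hθ1).const_mul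
      (‖g‖ * ∑ i, ‖algebraMap ℂ A (Z - g⁻¹) - X i‖)

end Sum

end Resolvent

section Distributions

open scoped ComplexOrder CompactlySupported

variable {A : Type*} [CStarAlgebra A] [PartialOrder A] [StarOrderedRing A] {f : A →ₚ[ℂ] ℂ}

lemma abs_re_apply_le (h1 : f 1 = 1) (x : A) : |(f x).re| ≤ ‖x‖ :=
  (Complex.abs_re_le_norm _).trans (norm_apply_le h1 x)

lemma re_apply_nonneg {x : A} (hx : 0 ≤ x) : 0 ≤ (f x).re :=
  (Complex.nonneg_iff.1 (f.map_nonneg hx)).1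

lemma spectrum_subset_Icc [Nontrivial A] {a : A} {B : ℝ} (hB : ‖a‖ ≤ B) :
    spectrum ℝ a ⊆ Set.Icc (-B) B := fun t ht => by
  have h2 : |t| ≤ ‖a‖ := by simpa using spectrum.norm_le_norm_of_mem ht
  exact abs_le.1 (h2.trans hB)

/-- The functional on `C(σ(a))` induced by `f`. -/
noncomputable def spectralFunctional (f : A →ₚ[ℂ] ℂ) {a : A} (ha : IsSelfAdjoint a) :
    C_c(spectrum ℝ a, ℝ) →ₚ[ℝ] ℝ :=
  PositiveLinearMap.mk₀
    { toFun := fun h => (f (cfcHom (R := ℝ) ha (h : C(spectrum ℝ a, ℝ)))).re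
      map_add' := fun g h => by
        have : ((g + h : C_c(spectrum ℝ a, ℝ)) : C(spectrum ℝ a, ℝ)) =
          (g : C(spectrum ℝ a, ℝ)) + (h : C(spectrum ℝ a, ℝ)) := rfl
        rw [this, map_add, map_add, Complex.add_re]
      map_smul' := fun c h => by
        have : ((c • h : C_c(spectrum ℝ a, ℝ)) : C(spectrum ℝ a, ℝ)) =
          c • (h : C(spectrum ℝ a, ℝ)) := rfl
        rw [this, map_smul, ← Complex.coe_smul, map_smul]
        simp }
    fun h hh => by
      refine re_apply_nonneg ?_
      rw [cfcHom_nonneg_iff]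
      exact hh

lemma exists_measure [Nontrivial A] (h1 : f 1 = 1) {a : A} (ha : IsSelfAdjoint a) :
    ∃ μ : Measure ℝ, IsProbabilityMeasure μ ∧ μ (Set.Icc (-‖a‖) ‖a‖)ᶜ = 0 ∧
      ∀ h : ℝ → ℝ, Continuous h → ∫ t, h t ∂μ = (f (cfc h a)).re := by
  set ν := RealRMK.rieszMeasure (spectralFunctional f ha) with hν
  have hfin : IsFiniteMeasure ν := inferInstance
  have hemb : MeasurableEmbedding (Subtype.val : spectrum ℝ a → ℝ) :=
    MeasurableEmbedding.subtype_coe (spectrum.isClosed a).measurableSet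
  have key : ∀ h : ℝ → ℝ, Continuous h → ∫ t, h t ∂(ν.map Subtype.val) = (f (cfc h a)).re := by
    intro h hh
    rw [hemb.integral_map]
    have := RealRMK.integral_rieszMeasure (spectralFunctional f ha)
      (CompactlySupportedContinuousMap.continuousMapEquiv
        (⟨_, hh.continuousOn.domRestrict⟩ : C(spectrum ℝ a, ℝ)))
    rw [cfc_apply h a ha hh.continuousOn]
    exact this
  refine ⟨ν.map Subtype.val, ⟨?_⟩, ?_, key⟩
  · have h2 := key (fun _ => 1) continuous_const
    rw [cfc_const_one ℝ a, h1] at h2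
    have hfin2 : IsFiniteMeasure (ν.map (Subtype.val : spectrum ℝ a → ℝ)) := inferInstance
    simp only [integral_const, smul_eq_mul, mul_one, Complex.one_re] at h2
    rw [measureReal_def, ENNReal.toReal_eq_one_iff] at h2
    exact h2
  · rw [Measure.map_apply measurable_subtype_coe measurableSet_Icc.compl]
    convert measure_empty (μ := ν)
    ext x
    simpa using! spectrum_subset_Icc le_rfl x.2

lemma abs_apply_cfc_sub_le [Nontrivial A] (h1 : f 1 = 1) {a : A} (ha : IsSelfAdjoint a) {B ε : ℝ}
    (hB : ‖a‖ ≤ B) (hε : 0 ≤ ε) {p h : ℝ → ℝ} (hp : Continuous p) (hh : Continuous h)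
    (hph : ∀ t ∈ Set.Icc (-B) B, |p t - h t| ≤ ε) :
    |(f (cfc p a)).re - (f (cfc h a)).re| ≤ ε := by
  rw [← Complex.sub_re, ← map_sub, ← cfc_sub p h a hp.continuousOn hh.continuousOn]
  refine (abs_re_apply_le h1 _).trans (norm_cfc_le hε fun t ht => ?_)
  exact hph t (spectrum_subset_Icc hB ht)

lemma apply_cfc_polynomial {a : A} (ha : IsSelfAdjoint a) (p : Polynomial ℝ) :
    (f (cfc p.eval a)).re = p.sum fun k c => c * (f (a ^ k)).re := by
  rw [cfc_polynomial p a ha, Polynomial.aeval_eq_sum_range, map_sum, Complex.re_sum,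
    Polynomial.sum_over_range _ (by simp)]
  refine Finset.sum_congr rfl fun k _ => ?_
  rw [← Complex.coe_smul, map_smul, smul_eq_mul, Complex.re_ofReal_mul]

lemma apply_cfc_eq_of_moments [Nontrivial A] (h1 : f 1 = 1) {a b : A} (ha : IsSelfAdjoint a)
    (hb : IsSelfAdjoint b) (hab : ∀ k, f (a ^ k) = f (b ^ k)) {h : ℝ → ℝ} (hh : Continuous h) :
    (f (cfc h a)).re = (f (cfc h b)).re := by
  refine eq_of_abs_sub_le_all fun ε hε => ?_
  obtain ⟨p, hp⟩ := exists_polynomial_near_of_continuousOn (-(‖a‖ + ‖b‖)) (‖a‖ + ‖b‖) h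
    hh.continuousOn (ε / 2) (by positivity)
  have e1 := abs_apply_cfc_sub_le h1 ha (le_add_of_nonneg_right (norm_nonneg b)) (half_pos hε).le
    p.continuous hh fun t ht => (hp t ht).le
  have e2 := abs_apply_cfc_sub_le h1 hb (le_add_of_nonneg_left (norm_nonneg a)) (half_pos hε).le
    p.continuous hh fun t ht => (hp t ht).le
  rw [apply_cfc_polynomial ha] at e1
  rw [apply_cfc_polynomial hb] at e2
  simp only [← hab] at e2
  rw [abs_le] at *
  constructor <;> linarith

lemma eq_zero_on_spectrum (hf : ∀ x, f (star x * x) = 0 → x = 0) {a : A} (ha : IsSelfAdjoint a)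
    {h : ℝ → ℝ} (hc : Continuous h) (h0 : (f (cfc (fun t => h t * h t) a)).re = 0) :
    ∀ t ∈ spectrum ℝ a, h t = 0 := by
  rw [cfc_mul h h a hc.continuousOn hc.continuousOn] at h0
  have hs : IsSelfAdjoint (cfc h a) := cfc_predicate h a
  have h3 : cfc h a = 0 := by
    apply hf
    rw [hs.star_eq]
    refine Complex.ext h0 (im_apply_eq_zero ?_)
    rw [isSelfAdjoint_iff, star_mul, hs.star_eq]
  intro t ht
  have := norm_apply_le_norm_cfc h a ht hc.continuousOn ha
  rw [h3, norm_zero] at this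
  exact norm_le_zero_iff.1 this

lemma norm_le_of_moments [Nontrivial A] (h1 : f 1 = 1) (hf : ∀ x, f (star x * x) = 0 → x = 0)
    {a b : A} (ha : IsSelfAdjoint a)
    (hb : IsSelfAdjoint b) (hab : ∀ k, f (a ^ k) = f (b ^ k)) : ‖a‖ ≤ ‖b‖ := by
  set h : ℝ → ℝ := fun t => max (|t| - ‖b‖) 0 with hh
  have hc : Continuous h := by fun_prop
  have e := apply_cfc_eq_of_moments h1 ha hb hab (h := fun t => h t * h t) (by fun_prop)
  have e2 : cfc (fun t => h t * h t) b = 0 := by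
    rw [cfc_congr (g := fun _ => 0), cfc_const_zero ℝ b]
    intro t ht
    have := abs_le.2 (spectrum_subset_Icc le_rfl ht)
    simp [hh, this]
  rw [e2, map_zero, Complex.zero_re] at e
  have h4 := eq_zero_on_spectrum hf ha hc e
  have h5 : ‖cfc (id : ℝ → ℝ) a‖ ≤ ‖b‖ := norm_cfc_le (norm_nonneg _) fun t ht => by
    have := h4 t ht
    simp only [hh, max_eq_right_iff, sub_nonpos] at this
    simpa using this
  rwa [cfc_id ℝ a] at h5

lemma apply_mul_self_ne_zero (hf : ∀ x, f (star x * x) = 0 → x = 0) {x : A}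
    (hx : IsSelfAdjoint x) (hx0 : x ≠ 0) : f (x * x) ≠ 0 := fun h =>
  hx0 (hf x (by rwa [hx.star_eq]))

lemma distribution_compl_Icc (h1 : f 1 = 1) (hf : ∀ x, f (star x * x) = 0 → x = 0) {x : A}
    (hx : IsSelfAdjoint x) (hx0 : x ≠ 0) {μ : Measure ℝ}
    (hμ : IsDistribution f.toLinearMap x μ) : μ (Set.Icc (-‖x‖) ‖x‖)ᶜ = 0 := by
  obtain ⟨hp, hm⟩ := hμ
  have hxn : 0 < ‖x‖ := norm_pos_iff.2 hx0
  have hpow : ∀ k : ℕ, Integrable (fun t : ℝ => t ^ (2 ^ (k + 1))) μ ∧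
      ∫ t, t ^ (2 ^ (k + 1)) ∂μ ≤ ‖x‖ ^ (2 ^ (k + 1)) := by
    intro k
    have e : x ^ (2 ^ (k + 1)) = x ^ (2 ^ k) * x ^ (2 ^ k) := by rw [← pow_add]; congr 1; ring
    have hne : x ^ (2 ^ k) ≠ 0 := by
      intro h0
      have := hx.nnnorm_pow_two_pow k
      rw [h0, nnnorm_zero] at this
      have := pow_eq_zero_iff (by positivity) |>.1 this.symm
      exact hx0 (nnnorm_eq_zero.1 this)
    have h2 : f (x ^ (2 ^ (k + 1))) ≠ 0 := by
      rw [e]; exact apply_mul_self_ne_zero hf (hx.pow _) hne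
    have h3 := hm (2 ^ (k + 1))
    change f _ = _ at h3
    constructor
    · by_contra hni
      rw [integral_undef hni] at h3
      exact h2 (by simpa using h3)
    · have h4 := abs_re_apply_le h1 (x ^ (2 ^ (k + 1)))
      rw [h3, Complex.ofReal_re] at h4
      exact (le_abs_self _).trans (h4.trans (norm_pow_le' _ (by positivity)))
  have hc : ∀ c : ℝ, ‖x‖ < c → μ {t | c ≤ |t|} = 0 := by
    intro c hc
    have hc0 : 0 < c := hxn.trans hc
    have hk : ∀ k : ℕ, μ.real {t | c ≤ |t|} ≤ (‖x‖ / c) ^ (2 ^ (k + 1)) := by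
      intro k
      have h2 := mul_meas_ge_le_integral_of_nonneg (μ := μ) (f := fun t : ℝ => t ^ (2 ^ (k + 1)))
        (ae_of_all _ fun t => (Even.pow_nonneg ⟨2 ^ k, by ring⟩ t)) (hpow k).1
        (c ^ (2 ^ (k + 1)))
      have h3 : {t : ℝ | c ≤ |t|} ⊆ {t : ℝ | c ^ (2 ^ (k + 1)) ≤ t ^ (2 ^ (k + 1))} := by
        intro t ht
        have : |t| ^ (2 ^ (k + 1)) = t ^ (2 ^ (k + 1)) := Even.pow_abs ⟨2 ^ k, by ring⟩ t
        rw [Set.mem_ofPred_eq, ← this]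
        exact pow_le_pow_left₀ hc0.le ht _
      have h4 := measureReal_mono (μ := μ) h3
      rw [div_pow, le_div_iff₀ (by positivity), mul_comm]
      exact (mul_le_mul_of_nonneg_left h4 (by positivity)).trans (h2.trans (hpow k).2)
    have hlim : Tendsto (fun k : ℕ => (‖x‖ / c) ^ (2 ^ (k + 1))) atTop (𝓝 0) :=
      (tendsto_pow_atTop_nhds_zero_of_lt_one (by positivity) ((div_lt_one hc0).2 hc)).comp
        ((tendsto_pow_atTop_atTop_of_one_lt one_lt_two).comp (tendsto_add_atTop_nat 1))
    have := ge_of_tendsto' hlim hk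
    have h0 : μ.real {t : ℝ | c ≤ |t|} = 0 := le_antisymm this measureReal_nonneg
    rwa [measureReal_eq_zero_iff] at h0
  have hsub : (Set.Icc (-‖x‖) ‖x‖)ᶜ ⊆ ⋃ k : ℕ, {t : ℝ | ‖x‖ + 1 / ((k : ℝ) + 1) ≤ |t|} := by
    intro t ht
    have : ‖x‖ < |t| := by
      by_contra hcon
      exact ht (abs_le.1 (not_lt.1 hcon))
    obtain ⟨k, hk⟩ := exists_nat_one_div_lt (sub_pos.2 this)
    exact Set.mem_iUnion.2 ⟨k, by simp only [Set.mem_ofPred_eq]; linarith⟩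
  exact measure_mono_null hsub (measure_iUnion_null fun k => hc _ (by
    have : (0 : ℝ) < 1 / ((k : ℝ) + 1) := by positivity
    linarith))

lemma ae_mem_of_compl {μ : Measure ℝ} {s : Set ℝ} (h : μ sᶜ = 0) : ∀ᵐ t ∂μ, t ∈ s := by
  rw [ae_iff]; exact h

lemma integrable_of_compl_Icc {μ : Measure ℝ} [IsFiniteMeasure μ] {a b : ℝ}
    (h : μ (Set.Icc a b)ᶜ = 0) {g : ℝ → ℝ} (hg : Continuous g) : Integrable g μ := by
  obtain ⟨C, hC⟩ := isCompact_Icc.exists_bound_of_continuousOn (s := Set.Icc a b) hg.continuousOn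
  exact Integrable.of_bound hg.aestronglyMeasurable C
    ((ae_mem_of_compl h).mono fun t ht => hC t ht)

lemma abs_integral_sub_le {μ : Measure ℝ} [IsProbabilityMeasure μ] {a b ε : ℝ}
    (h : μ (Set.Icc a b)ᶜ = 0) {p g : ℝ → ℝ} (hp : Continuous p) (hg : Continuous g)
    (hpg : ∀ t ∈ Set.Icc a b, |p t - g t| ≤ ε) : |∫ t, p t ∂μ - ∫ t, g t ∂μ| ≤ ε := by
  rw [← integral_sub (integrable_of_compl_Icc h hp) (integrable_of_compl_Icc h hg)]
  have := norm_integral_le_of_norm_le_const (μ := μ) (f := fun t => p t - g t) (C := ε)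
    ((ae_mem_of_compl h).mono fun t ht => hpg t ht)
  simpa using this

lemma integral_eq_of_distribution [Nontrivial A] (h1 : f 1 = 1)
    (hf : ∀ x, f (star x * x) = 0 → x = 0) {x : A}
    (hx : IsSelfAdjoint x) (hx0 : x ≠ 0) {μ : Measure ℝ}
    (hμ : IsDistribution f.toLinearMap x μ) {h : ℝ → ℝ} (hh : Continuous h) :
    ∫ t, h t ∂μ = (f (cfc h x)).re := by
  have hsupp := distribution_compl_Icc h1 hf hx hx0 hμ
  obtain ⟨hp, hm⟩ := hμ
  refine eq_of_abs_sub_le_all fun ε hε => ?_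
  obtain ⟨p, hp⟩ := exists_polynomial_near_of_continuousOn (-‖x‖) ‖x‖ h
    hh.continuousOn (ε / 2) (by positivity)
  have e1 := abs_apply_cfc_sub_le h1 hx le_rfl (half_pos hε).le
    p.continuous hh fun t ht => (hp t ht).le
  have e2 := abs_integral_sub_le hsupp p.continuous hh fun t ht => (hp t ht).le
  have e3 : ∫ t, p.eval t ∂μ = (f (cfc p.eval x)).re := by
    rw [apply_cfc_polynomial hx]
    simp only [Polynomial.eval_eq_sum]
    simp only [Polynomial.sum]
    rw [integral_finsetSum _ fun k _ => integrable_of_compl_Icc hsupp (by fun_prop)]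
    refine Finset.sum_congr rfl fun k _ => ?_
    have h3 := hm k
    change f _ = _ at h3
    rw [h3, Complex.ofReal_re, integral_const_mul]
  rw [e3] at e2
  rw [abs_le] at *
  constructor <;> linarith

end Distributions

section SelfAdjointResolvent

open scoped ComplexOrder

variable {A : Type*} [CStarAlgebra A] [PartialOrder A] [StarOrderedRing A] {f : A →ₚ[ℂ] ℂ}
variable {S : A} (hS : IsSelfAdjoint S) {z : ℂ}

include hS

lemma isUnit_sub_of_im_ne_zero (hz : z.im ≠ 0) : IsUnit (algebraMap ℂ A z - S) := by
  have : z ∉ spectrum ℂ S := fun h => hz (by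
    rw [hS.mem_spectrum_eq_re h]; exact Complex.ofReal_im _)
  simpa [spectrum.mem_iff] using this

lemma im_apply_of_mul_eq_one {R : A} (hR : (algebraMap ℂ A z - S) * R = 1) :
    (f R).im = -z.im * l2 f R ^ 2 := by
  have h1 : f (star R * ((algebraMap ℂ A z - S) * R)) = star (f R) := by
    rw [hR, mul_one, map_star_eq]
  have h2 : (f (star R * (S * R))).im = 0 := im_apply_eq_zero (by
    rw [isSelfAdjoint_iff]
    simp [hS.star_eq, mul_assoc])
  rw [sub_mul, mul_sub, map_sub, Algebra.algebraMap_eq_smul_one, smul_mul_assoc, one_mul,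
    mul_smul_comm, map_smul, smul_eq_mul, ← ofReal_l2_sq] at h1
  have h3 := congrArg Complex.im h1
  rw [Complex.sub_im, h2, Complex.im_mul_ofReal] at h3
  simp at h3
  linarith

lemma star_mul_self_eq_cfc {R : A} (hz : z.im ≠ 0) (hR : (algebraMap ℂ A z - S) * R = 1) :
    star R * R = cfc (fun t : ℝ => ((z.re - t) ^ 2 + z.im ^ 2)⁻¹) S := by
  have hpos : ∀ t : ℝ, 0 < (z.re - t) ^ 2 + z.im ^ 2 := fun t => by positivity
  have hc : Continuous fun t : ℝ => (z.re - t) ^ 2 + z.im ^ 2 := by fun_prop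
  have hci : Continuous fun t : ℝ => ((z.re - t) ^ 2 + z.im ^ 2)⁻¹ :=
    hc.inv₀ fun t => (hpos t).ne'
  have hq : cfc (fun t : ℝ => (z.re - t) ^ 2 + z.im ^ 2) S =
      star (algebraMap ℂ A z - S) * (algebraMap ℂ A z - S) := by
    have e1 : cfc (fun t : ℝ => z.re - t) S = algebraMap ℝ A z.re - S := by
      rw [cfc_sub (fun _ => z.re) (fun t => t) S, cfc_const z.re S, cfc_id' ℝ S]
    rw [cfc_add (R := ℝ) (a := S) (fun t => (z.re - t) ^ 2) (fun _ => z.im ^ 2),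
      cfc_pow (R := ℝ) (fun t => z.re - t) 2 S, e1, cfc_const (z.im ^ 2) S]
    have e2 : algebraMap ℝ A z.re = algebraMap ℂ A (z.re : ℂ) := by
      simp [Algebra.algebraMap_eq_smul_one]
    have e3 : algebraMap ℝ A (z.im ^ 2) = algebraMap ℂ A ((z.im ^ 2 : ℝ) : ℂ) := by
      rw [Algebra.algebraMap_eq_smul_one, Algebra.algebraMap_eq_smul_one, Complex.coe_smul]
    have e4 : star (algebraMap ℂ A z) = algebraMap ℂ A (star z) := by
      rw [algebraMap_star_comm]
    rw [e2, e3, star_sub, hS.star_eq, e4]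
    have e5 : algebraMap ℂ A z = algebraMap ℂ A (z.re : ℂ) + algebraMap ℂ A (z.im * Complex.I) := by
      rw [← map_add, Complex.re_add_im]
    have e6 : algebraMap ℂ A (star z) =
        algebraMap ℂ A (z.re : ℂ) - algebraMap ℂ A (z.im * Complex.I) := by
      rw [← map_sub]; congr 1; apply Complex.ext <;> simp
    have e7 : algebraMap ℂ A ((z.im ^ 2 : ℝ) : ℂ) =
        - (algebraMap ℂ A (z.im * Complex.I) * algebraMap ℂ A (z.im * Complex.I)) := by
      rw [← map_mul, ← map_neg]; congr 1; push_cast; ring_nf; simp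
    rw [e5, e6, e7]
    have c1 := Algebra.commutes (z.im * Complex.I) S
    have c2 := Algebra.commutes (z.im * Complex.I) (algebraMap ℂ A (z.re : ℂ))
    generalize algebraMap ℂ A (z.re : ℂ) = a at *
    generalize algebraMap ℂ A (z.im * Complex.I) = b at *
    rw [sq]
    have : (a - b - S) * (a + b - S) = (a - S) * (a - S) + (a * b - b * a) + (b * S - S * b)
        - b * b := by noncomm_ring
    rw [this, c1, c2]; noncomm_ring
  have h1 : cfc (fun t : ℝ => ((z.re - t) ^ 2 + z.im ^ 2)⁻¹) S *
      cfc (fun t : ℝ => (z.re - t) ^ 2 + z.im ^ 2) S = 1 := by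
    rw [← cfc_mul _ _ S hci.continuousOn hc.continuousOn, ← cfc_const_one ℝ S]
    exact cfc_congr fun t _ => inv_mul_cancel₀ (hpos t).ne'
  have h2 : (star (algebraMap ℂ A z - S) * (algebraMap ℂ A z - S)) * (R * star R) = 1 := by
    rw [mul_assoc, ← mul_assoc _ R, hR, one_mul, ← star_mul]
    have hu := isUnit_sub_of_im_ne_zero hS hz
    have : R * (algebraMap ℂ A z - S) = 1 := by
      obtain ⟨u, hu⟩ := hu
      rw [← hu] at hR ⊢
      rw [Units.mul_eq_one_iff_inv_eq] at hR
      rw [← hR, Units.inv_mul]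
    rw [this, star_one]
  have hcomm : R * star R = star R * R := by
    have hu := isUnit_sub_of_im_ne_zero hS hz
    obtain ⟨u, hu⟩ := hu
    rw [← hu, Units.mul_eq_one_iff_inv_eq] at hR
    have hcu : Commute (u : A) (star (u : A)) := by
      rw [hu, star_sub, hS.star_eq, ← algebraMap_star_comm]
      exact ((Algebra.commute_algebraMap_left _ _).sub_left
        ((Algebra.commute_algebraMap_right _ _).sub_right (Commute.refl _)))
    have h4 : Commute (u⁻¹ : Aˣ) (star (u⁻¹ : Aˣ)) := by
      have : Commute u (star u) := Units.ext hcu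
      rw [star_inv]
      exact this.inv_inv
    have := congrArg Units.val h4.eq
    rw [← hR]
    simpa using this
  rw [← hcomm, ← mul_one (cfc _ S), ← h2, ← hq, ← mul_assoc, h1, one_mul]

lemma norm_le_of_mul_eq_one {R : A} (hz : z.im ≠ 0) (hR : (algebraMap ℂ A z - S) * R = 1) :
    ‖R‖ ≤ |z.im|⁻¹ := by
  have h1 : ‖R‖ * ‖R‖ ≤ |z.im|⁻¹ * |z.im|⁻¹ := by
    rw [← CStarRing.norm_star_mul_self, star_mul_self_eq_cfc hS hz hR]
    refine norm_cfc_le (by positivity) fun t _ => ?_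
    rw [← mul_inv, abs_mul_abs_self, Real.norm_of_nonneg (by positivity)]
    exact inv_anti₀ (mul_self_pos.2 hz) (by nlinarith [sq_nonneg (z.re - t)])
  exact abs_le_of_sq_le_sq' (by nlinarith) (by positivity) |>.2

lemma l2_sq_eq {R : A} (hz : z.im ≠ 0) (hR : (algebraMap ℂ A z - S) * R = 1) :
    l2 f R ^ 2 = (f (cfc (fun t : ℝ => ((z.re - t) ^ 2 + z.im ^ 2)⁻¹) S)).re := by
  rw [l2_sq, star_mul_self_eq_cfc hS hz hR]

/-- Approximate inverses with bounded `l2`-norm bound the resolvent near the real axis. -/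
lemma l2_resolvent_le {x v : ℝ} (hv : 0 < v) {ξ : ℕ → A} {C : ℝ}
    (hξ : ∀ K, l2 f (ξ K) ≤ C)
    (hlim : Tendsto (fun K => l2 f ((algebraMap ℂ A x - S) * ξ K - 1)) atTop (𝓝 0)) {R : A}
    (hR : (algebraMap ℂ A (x + v * Complex.I) - S) * R = 1) : l2 f R ≤ 2 * C := by
  have him : (x + v * Complex.I : ℂ).im = v := by simp
  have hz : (x + v * Complex.I : ℂ).im ≠ 0 := by rw [him]; exact hv.ne'
  have hRn : ‖R‖ ≤ v⁻¹ := by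
    have := norm_le_of_mul_eq_one hS hz hR
    rwa [him, abs_of_pos hv] at this
  have hR' : R * (algebraMap ℂ A (x + v * Complex.I) - S) = 1 := by
    obtain ⟨u, hu⟩ := isUnit_sub_of_im_ne_zero hS hz
    rw [← hu] at hR ⊢
    rw [Units.mul_eq_one_iff_inv_eq] at hR
    rw [← hR, Units.inv_mul]
  have hK : ∀ K, l2 f R ≤ 2 * C + v⁻¹ * l2 f ((algebraMap ℂ A x - S) * ξ K - 1) := by
    intro K
    have e : R = ξ K - (v * Complex.I : ℂ) • (R * ξ K)
        - R * ((algebraMap ℂ A x - S) * ξ K - 1) := by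
      have : R * ((algebraMap ℂ A (x + v * Complex.I) - S) * ξ K) = ξ K := by
        rw [← mul_assoc, hR', one_mul]
      rw [map_add, Algebra.algebraMap_eq_smul_one (v * Complex.I : ℂ)] at this
      rw [add_sub_right_comm, add_mul, smul_mul_assoc, one_mul, mul_add, mul_smul_comm] at this
      rw [mul_sub, mul_one, eq_sub_of_add_eq this]
      abel
    have h2 : l2 f (R * ξ K) ≤ v⁻¹ * C := (l2_mul_le f R _).trans
      (mul_le_mul hRn (hξ K) (l2_nonneg f _) (by positivity))
    have h3 : ‖(v * Complex.I : ℂ)‖ = v := by simp [abs_of_pos hv]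
    calc l2 f R ≤ l2 f (ξ K) + l2 f ((v * Complex.I : ℂ) • (R * ξ K))
          + l2 f (R * ((algebraMap ℂ A x - S) * ξ K - 1)) := by
          conv_lhs => rw [e]
          exact (l2_sub_le f _ _).trans (by gcongr; exact l2_sub_le f _ _)
      _ ≤ C + v * (v⁻¹ * C) + v⁻¹ * l2 f ((algebraMap ℂ A x - S) * ξ K - 1) := by
          rw [l2_smul, h3]
          have h4 := (l2_mul_le f R ((algebraMap ℂ A x - S) * ξ K - 1)).trans
            (mul_le_mul_of_nonneg_right hRn (l2_nonneg f _))
          have h5 := hξ K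
          gcongr
      _ = _ := by field_simp; ring
  have := ge_of_tendsto' ((hlim.const_mul v⁻¹).const_add (2 * C)) hK
  simpa using this

end SelfAdjointResolvent

section RealLine

lemma measureReal_Icc_le {μ : Measure ℝ} [IsProbabilityMeasure μ] {x v C : ℝ} (hv : 0 < v)
    (h : ∫ t, ((x - t) ^ 2 + v ^ 2)⁻¹ ∂μ ≤ C) : μ.real (Set.Icc (x - v) (x + v)) ≤ 2 * C * v ^ 2 := by
  have hc : Continuous fun t : ℝ => ((x - t) ^ 2 + v ^ 2)⁻¹ :=
    Continuous.inv₀ (by fun_prop) fun t => by positivity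
  have hint : Integrable (fun t : ℝ => ((x - t) ^ 2 + v ^ 2)⁻¹) μ :=
    Integrable.of_bound hc.aestronglyMeasurable (v ^ 2)⁻¹ (ae_of_all _ fun t => by
      rw [Real.norm_of_nonneg (by positivity)]
      exact inv_anti₀ (by positivity) (by nlinarith [sq_nonneg (x - t)]))
  have h2 := mul_meas_ge_le_integral_of_nonneg (μ := μ)
    (ae_of_all _ fun t => (by positivity : (0 : ℝ) ≤ ((x - t) ^ 2 + v ^ 2)⁻¹)) hint
    (2 * v ^ 2)⁻¹
  have h3 : Set.Icc (x - v) (x + v) ⊆ {t | (2 * v ^ 2)⁻¹ ≤ ((x - t) ^ 2 + v ^ 2)⁻¹} := by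
    intro t ht
    have : (x - t) ^ 2 ≤ v ^ 2 := sq_le_sq' (by linarith [ht.2]) (by linarith [ht.1])
    have hp : (0 : ℝ) < (x - t) ^ 2 + v ^ 2 := by positivity
    exact inv_anti₀ hp (by linarith)
  have h4 := measureReal_mono (μ := μ) h3
  have h5 : (2 * v ^ 2)⁻¹ * μ.real (Set.Icc (x - v) (x + v)) ≤ C :=
    (mul_le_mul_of_nonneg_left h4 (by positivity)).trans (h2.trans h)
  rw [inv_mul_le_iff₀ (by positivity)] at h5
  linarith

lemma measure_Ioi_eq_zero {μ : Measure ℝ} [IsProbabilityMeasure μ] {B C : ℝ}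
    (h : ∀ x, B < x → ∀ v, 0 < v → ∫ t, ((x - t) ^ 2 + v ^ 2)⁻¹ ∂μ ≤ C) :
    μ (Set.Ioi B) = 0 := by
  set F : ℝ → ℝ := fun x => μ.real (Set.Iic x) with hF
  have hmono : ∀ x y, x ≤ y → F y - F x = μ.real (Set.Ioc x y) := by
    intro x y hxy
    rw [← Set.Iic_sdiff_Iic, measureReal_sdiff (Set.Iic_subset_Iic.2 hxy) measurableSet_Iic]
  have hC : 0 ≤ C := by
    refine le_trans (integral_nonneg fun t => ?_) (h (B + 1) (by linarith) 1 one_pos)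
    positivity
  have hbd : ∀ x, B < x → ∀ y, |F y - F x| ≤ 2 * C * (y - x) ^ 2 := by
    intro x hx y
    rcases lt_trichotomy x y with hxy | hxy | hxy
    · rw [hmono x y hxy.le, abs_of_nonneg measureReal_nonneg]
      refine (measureReal_mono ?_).trans (measureReal_Icc_le (sub_pos.2 hxy)
        (h x hx _ (sub_pos.2 hxy)))
      intro t ht; exact ⟨by linarith [ht.1], by linarith [ht.2]⟩
    · simp [hxy]
    · rw [abs_sub_comm, hmono y x hxy.le, abs_of_nonneg measureReal_nonneg]
      have e : (y - x) ^ 2 = (x - y) ^ 2 := by ring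
      rw [e]
      refine (measureReal_mono ?_).trans (measureReal_Icc_le (sub_pos.2 hxy)
        (h x hx _ (sub_pos.2 hxy)))
      intro t ht; exact ⟨by linarith [ht.1], by linarith [ht.2]⟩
  have hder : ∀ x, B < x → HasDerivAt F 0 x := by
    intro x hx
    rw [hasDerivAt_iff_isLittleO]
    refine Asymptotics.IsBigO.trans_isLittleO (g := fun y => (y - x) ^ 2) ?_ ?_
    · refine Asymptotics.IsBigO.of_bound (2 * C) (Eventually.of_forall fun y => ?_)
      simpa [abs_of_nonneg (sq_nonneg (y - x))] using hbd x hx y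
    · have : Tendsto (fun y : ℝ => y - x) (𝓝 x) (𝓝 0) := by
        have := (continuous_sub_right x).tendsto x
        simpa using this
      have h2 := (Asymptotics.isLittleO_pow_id (𝕜 := ℝ) one_lt_two).comp_tendsto this
      exact h2
  have hconst : ∀ x y, B < x → B < y → F x = F y := by
    intro x y hx hy
    refine (convex_Ioi B).is_const_of_fderivWithin_eq_zero (𝕜 := ℝ) (f := F)
      (fun t ht => (hder t ht).differentiableAt.differentiableWithinAt) (fun t ht => ?_) hx hy
    rw [(hder t ht).hasFDerivAt.hasFDerivWithinAt.fderivWithin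
      (isOpen_Ioi.uniqueDiffWithinAt ht)]
    ext; simp
  have hnull : ∀ x, B < x → ∀ y, x ≤ y → μ (Set.Ioc x y) = 0 := by
    intro x hx y hxy
    have := hmono x y hxy
    rw [hconst x y hx (hx.trans_le hxy), sub_self] at this
    rwa [eq_comm, measureReal_eq_zero_iff] at this
  have hsub : Set.Ioi B ⊆ ⋃ k : ℕ, Set.Ioc (B + 1 / ((k : ℝ) + 1)) (B + 1 + k) := by
    intro t ht
    obtain ⟨k, hk⟩ := exists_nat_one_div_lt (sub_pos.2 (Set.mem_Ioi.1 ht))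
    obtain ⟨l, hl⟩ := exists_nat_ge (t - B)
    refine Set.mem_iUnion.2 ⟨max k l, ?_, ?_⟩
    · have : 1 / (((max k l : ℕ) : ℝ) + 1) ≤ 1 / ((k : ℝ) + 1) := by
        gcongr; exact le_max_left k l
      linarith
    · have : (l : ℝ) ≤ ((max k l : ℕ) : ℝ) := by exact_mod_cast le_max_right k l
      linarith
  refine measure_mono_null hsub (measure_iUnion_null fun k => hnull _ ?_ _ ?_)
  · have : (0 : ℝ) < 1 / ((k : ℝ) + 1) := by positivity
    linarith
  · have : 1 / ((k : ℝ) + 1) ≤ 1 := by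
      rw [div_le_one (by positivity)]
      have : (0 : ℝ) ≤ k := Nat.cast_nonneg k
      linarith
    have : (0 : ℝ) ≤ k := Nat.cast_nonneg k
    linarith

end RealLine

section ResolventFunction

open scoped ComplexOrder

variable {A : Type*} [CStarAlgebra A] [PartialOrder A] [StarOrderedRing A] {f : A →ₚ[ℂ] ℂ}

lemma resolvent_eq_of_mul_eq_one {a R : A} {z : ℂ} (hu : IsUnit (algebraMap ℂ A z - a))
    (hR : (algebraMap ℂ A z - a) * R = 1) : resolvent a z = R := by
  rw [← mul_one (resolvent a z), ← hR, ← mul_assoc, resolvent_mul hu, one_mul]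

lemma hasSum_apply_resolvent [NormOneClass A] (h1 : f 1 = 1) {a : A} {z : ℂ} (h : ‖a‖ < ‖z‖) :
    HasSum (fun k : ℕ => z⁻¹ * ((z⁻¹) ^ k * f (a ^ k))) (f (resolvent a z)) := by
  have hz : z ≠ 0 := norm_pos_iff.1 ((norm_nonneg a).trans_lt h)
  have hlt : ‖z⁻¹ • a‖ < 1 := by
    rw [norm_smul, norm_inv, inv_mul_lt_iff₀ (norm_pos_iff.2 hz), mul_one]; exact h
  have hs : HasSum (fun k : ℕ => (z⁻¹ • a) ^ k) (∑' k : ℕ, (z⁻¹ • a) ^ k) :=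
    (summable_geometric_of_norm_lt_one hlt).hasSum
  have e : resolvent a z = z⁻¹ • ∑' k : ℕ, (z⁻¹ • a) ^ k := by
    refine resolvent_eq_of_mul_eq_one (isUnit_of_norm_lt h) ?_
    have : algebraMap ℂ A z - a = z • (1 - z⁻¹ • a) := by
      rw [smul_sub, smul_smul, mul_inv_cancel₀ hz, one_smul, Algebra.algebraMap_eq_smul_one]
    rw [this, smul_mul_smul_comm, mul_inv_cancel₀ hz, mul_neg_geom_series _ hlt, one_smul]
  rw [e, map_smul, smul_eq_mul]
  refine HasSum.mul_left _ ?_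
  have e2 := hs.map f (continuous_apply h1)
  have e3 : (f ∘ fun k : ℕ => (z⁻¹ • a) ^ k) = fun k : ℕ => z⁻¹ ^ k * f (a ^ k) := by
    funext k
    rw [Function.comp_apply, smul_pow, map_smul, smul_eq_mul]
  rwa [e3] at e2

lemma apply_resolvent_eq_of_moments [NormOneClass A] (h1 : f 1 = 1) {a b : A} {z : ℂ}
    (ha : ‖a‖ < ‖z‖) (hb : ‖b‖ < ‖z‖) (hab : ∀ k, f (a ^ k) = f (b ^ k)) :
    f (resolvent a z) = f (resolvent b z) := by
  have h := hasSum_apply_resolvent h1 ha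
  simp only [hab] at h
  exact h.unique (hasSum_apply_resolvent h1 hb)

lemma hasDerivAt_apply_resolvent (h1 : f 1 = 1) {a : A} {z : ℂ}
    (hu : IsUnit (algebraMap ℂ A z - a)) :
    HasDerivAt (fun z => f (resolvent a z)) (f (-resolvent a z ^ 2)) z := by
  have h2 := spectrum.hasDerivAt_resolvent_const_left (𝕜 := ℂ) (a := a) (k := z)
    (spectrum.mem_resolventSet_iff.2 hu)
  let fL : A →L[ℂ] ℂ := ⟨f.toLinearMap, continuous_apply h1⟩
  exact fL.hasFDerivAt.comp_hasDerivAt z h2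

lemma l2_resolvent_le_inv_sub [NormOneClass A] (h1 : f 1 = 1) {a : A} {z : ℂ} {M : ℝ}
    (hM : ‖a‖ ≤ M) (hMz : M < ‖z‖) : l2 f (resolvent a z) ≤ (‖z‖ - M)⁻¹ := by
  have hR := mul_resolvent (isUnit_of_norm_lt (hM.trans_lt hMz))
  set R := resolvent a z
  have h := norm_mul_l2_sq_le (f := f) (Z := z) hM R _ rfl
  rw [hR] at h
  have h2 := norm_inner_le_l2 f R 1
  rw [l2_one h1, mul_one] at h2
  rw [mul_one] at h
  have hpos : 0 < ‖z‖ - M := sub_pos.2 hMz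
  rcases (l2_nonneg f R).eq_or_lt with h0 | h0
  · rw [← h0]; positivity
  · rw [← one_div, le_div_iff₀ hpos]
    refine le_of_mul_le_mul_right ?_ h0
    nlinarith

/-- The function `Z ↦ n Z - (n - 1) / φ((Z - a)⁻¹)`. -/
noncomputable def subordinator (f : A →ₚ[ℂ] ℂ) (a : A) (n : ℝ) (Z : ℂ) : ℂ :=
  n * Z - (n - 1) * (f (resolvent a Z))⁻¹

lemma subordinator_sub [NormOneClass A] (h1 : f 1 = 1) (hf : ∀ x, f (star x * x) = 0 → x = 0)
    {a : A} (h0 : f a = 0) {n : ℝ} {Z : ℂ} (hZ : ‖a‖ < ‖Z‖) :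
    subordinator f a n Z - Z =
      (n - 1) * f (a * ((f (resolvent a Z))⁻¹ • resolvent a Z - 1)) := by
  have hR := mul_resolvent (isUnit_of_norm_lt hZ)
  rw [apply_mul_centered h1 h0 hR (apply_resolvent_ne_zero h1 hf hZ hR), subordinator]
  ring

lemma norm_subordinator_sub_le [NormOneClass A] (h1 : f 1 = 1)
    (hf : ∀ x, f (star x * x) = 0 → x = 0)
    {a : A} (ha : IsSelfAdjoint a) (h0 : f a = 0) {n M : ℝ} (hn : 1 ≤ n) {Z : ℂ} (hM : ‖a‖ ≤ M)
    (hZ : M < ‖Z‖) : ‖subordinator f a n Z - Z‖ ≤ (n - 1) * l2 f a ^ 2 / (‖Z‖ - M) := by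
  have hZ' := hM.trans_lt hZ
  have hR := mul_resolvent (isUnit_of_norm_lt hZ')
  rw [subordinator_sub h1 hf h0 hZ', norm_mul]
  have e1 : ‖(n : ℂ) - 1‖ = n - 1 := by
    rw [← Complex.ofReal_one, ← Complex.ofReal_sub, Complex.norm_real, Real.norm_of_nonneg]
    linarith
  have e2 := norm_inner_le_l2 f a ((f (resolvent a Z))⁻¹ • resolvent a Z - 1)
  rw [ha.star_eq] at e2
  have e3 := l2_centered_le h1 hR (apply_resolvent_ne_zero h1 hf hZ' hR) hM hZ
  rw [e1, mul_div_assoc]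
  refine mul_le_mul_of_nonneg_left ?_ (by linarith)
  calc _ ≤ _ := e2
    _ ≤ l2 f a * (l2 f a / (‖Z‖ - M)) := mul_le_mul_of_nonneg_left e3 (l2_nonneg f a)
    _ = _ := by ring

lemma continuousAt_subordinator [NormOneClass A] (h1 : f 1 = 1)
    (hf : ∀ x, f (star x * x) = 0 → x = 0)
    {a : A} {n : ℝ} {Z : ℂ} (hZ : ‖a‖ < ‖Z‖) : ContinuousAt (subordinator f a n) Z := by
  have hu := isUnit_of_norm_lt hZ
  have h2 := (hasDerivAt_apply_resolvent h1 hu).continuousAt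
  have h3 := apply_resolvent_ne_zero h1 hf hZ (mul_resolvent hu)
  exact (continuousAt_const.mul continuousAt_id).sub (continuousAt_const.mul (h2.inv₀ h3))

lemma im_subordinator_ofReal [NormOneClass A] {a : A}
    (ha : IsSelfAdjoint a) {n x : ℝ} (hx : ‖a‖ < |x|) : (subordinator f a n x).im = 0 := by
  have hR := mul_resolvent (isUnit_of_norm_lt (a := a) (z := (x : ℂ)) (by simpa using hx))
  have h2 := im_apply_of_mul_eq_one (f := f) ha hR
  simp only [Complex.ofReal_im, neg_zero, zero_mul] at h2
  have h3 : f (resolvent a (x : ℂ)) = ((f (resolvent a (x : ℂ))).re : ℂ) :=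
    Complex.ext rfl (by simpa using h2)
  rw [subordinator, h3, ← Complex.ofReal_inv]
  norm_cast

end ResolventFunction

section NormBound

open scoped ComplexOrder

variable {A : Type*} [CStarAlgebra A] [PartialOrder A] [StarOrderedRing A] {f : A →ₚ[ℂ] ℂ}
  [Nontrivial A] {ι : Type*} [Fintype ι] [Nonempty ι]

lemma spectrum_sum_subset_Iic (h1 : f 1 = 1)
    (hf : ∀ x, f (star x * x) = 0 → x = 0) {X : ι → A} (hsa : ∀ i, IsSelfAdjoint (X i))
    (hfree : IsFreeFamily f.toLinearMap fun i => Algebra.adjoin ℂ {X i})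
    (hid : ∀ i j k, f (X i ^ k) = f (X j ^ k)) (h0 : ∀ i, f (X i) = 0)
    {M s : ℝ} (hM : ∀ i, ‖X i‖ ≤ M) (hs : ∀ i, l2 f (X i) = s) :
    spectrum ℝ (∑ i, X i) ⊆ Set.Iic (M + 2 * s * √(Fintype.card ι)) := by
  classical
  have hS := isSelfAdjoint_sum Finset.univ fun i _ => hsa i
  obtain ⟨i₀⟩ := ‹Nonempty ι›
  have : Nonempty ι := ⟨i₀⟩
  set n : ℝ := (Fintype.card ι : ℝ) with hn
  have hn1 : 1 ≤ n := by
    have : 1 ≤ Fintype.card ι := Fintype.card_pos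
    rw [hn]
    exact_mod_cast this
  have hM0 : 0 ≤ M := (norm_nonneg _).trans (hM i₀)
  have hs0 : 0 ≤ s := hs i₀ ▸ l2_nonneg f _
  set D : ℝ := s * √n with hD
  have hD0 : 0 ≤ D := by positivity
  have hsD : (n - 1) * s ^ 2 ≤ D * D := by
    have := Real.mul_self_sqrt (zero_le_one.trans hn1)
    have : D * D = s ^ 2 * n := by rw [hD]; linear_combination s ^ 2 * this
    nlinarith [sq_nonneg s]
  obtain ⟨μ, hμp, -, hμ⟩ := exists_measure h1 hS
  have hnull : ∀ z₁, M + 2 * D < z₁ → μ (Set.Ioi z₁) = 0 := by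
    intro z₁ hz₁
    set q : ℝ := (1 + (1 - √((n - 1 : ℝ) * n⁻¹))⁻¹) with hq
    have hq0 : 0 ≤ q := by
      have : √((n - 1 : ℝ) * n⁻¹) ≤ 1 := by
        rw [Real.sqrt_le_one, ← div_eq_mul_inv, div_le_one (by linarith)]
        linarith
      have : 0 ≤ (1 - √((n - 1 : ℝ) * n⁻¹))⁻¹ := inv_nonneg.2 (by linarith)
      rw [hq]; linarith
    set C := (z₁ - D - M)⁻¹ * q with hC
    refine measure_Ioi_eq_zero (C := (2 * C) ^ 2) fun x hx v hv => ?_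
    have hbd : ∀ Z : ℝ, M + D ≤ Z → M < Z → ‖subordinator f (X i₀) n Z - Z‖ ≤ D := by
      intro Z hZ hZ2
      have hnZ : ‖(Z : ℂ)‖ = Z := by
        rw [Complex.norm_real, Real.norm_of_nonneg (by linarith)]
      refine (norm_subordinator_sub_le h1 hf (hsa i₀) (h0 i₀) hn1 (hM i₀)
        (by rwa [hnZ])).trans ?_
      rw [hnZ, hs, div_le_iff₀ (by linarith)]
      nlinarith
    have hre : ∀ Z : ℝ, M < Z → subordinator f (X i₀) n Z =
        ((subordinator f (X i₀) n Z).re : ℂ) := by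
      intro Z hZ
      refine Complex.ext rfl ?_
      rw [Complex.ofReal_im, im_subordinator_ofReal (hsa i₀)]
      exact (hM i₀).trans_lt (hZ.trans_le (le_abs_self Z))
    have hbd' : ∀ Z : ℝ, M + D ≤ Z → M < Z → |(subordinator f (X i₀) n Z).re - Z| ≤ D := by
      intro Z hZ hZ2
      have := (Complex.abs_re_le_norm _).trans (hbd Z hZ hZ2)
      simpa using this
    obtain ⟨Z, hZm, hZ⟩ : ∃ Z ∈ Set.Icc (x - D) (x + D), (subordinator f (X i₀) n Z).re = x := by
      refine intermediate_value_Icc (f := fun Z : ℝ => (subordinator f (X i₀) n Z).re)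
        (by linarith) (fun Z hZ => ?_) ⟨?_, ?_⟩
      · have hMZ : M < Z := by linarith [hZ.1]
        have := (continuousAt_subordinator (n := n) h1 hf (a := X i₀) (Z := (Z : ℂ))
          ((hM i₀).trans_lt (by simpa using hMZ.trans_le (le_abs_self Z))))
        have h4 : ContinuousAt (fun Z : ℝ => (subordinator f (X i₀) n Z).re) Z :=
          Complex.continuous_re.continuousAt.comp
            (ContinuousAt.comp (f := fun Z : ℝ => (Z : ℂ)) this
              Complex.continuous_ofReal.continuousAt)
        exact h4.continuousWithinAt
      · have := abs_le.1 (hbd' (x - D) (by linarith) (by linarith))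
        push_cast at this ⊢
        linarith [this.2]
      · have := abs_le.1 (hbd' (x + D) (by linarith) (by linarith))
        push_cast at this ⊢
        linarith [this.1]
    have hMZ : M < Z := by linarith [hZm.1]
    have hnZ : ‖(Z : ℂ)‖ = Z := by
      rw [Complex.norm_real, Real.norm_of_nonneg (by linarith)]
    obtain ⟨ξ, -, hξ, hlim⟩ := exists_approx_inverse h1 hf hsa hfree hM hs (Z := Z)
      (g := f (resolvent (X i₀) (Z : ℂ))) (by rwa [hnZ]) (by rw [hnZ]; linarith [hZm.1]) fun i =>
        apply_resolvent_eq_of_moments h1 ((hM i).trans_lt (by rwa [hnZ]))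
          ((hM i₀).trans_lt (by rwa [hnZ])) (hid i i₀)
    have hz : (Fintype.card ι * (Z : ℂ) - (Fintype.card ι - 1) * (f (resolvent (X i₀) (Z : ℂ)))⁻¹) =
        (x : ℂ) := by
      rw [← hZ, ← hre Z hMZ, subordinator, hn]; simp
    rw [hz] at hlim
    have hg : ‖f (resolvent (X i₀) (Z : ℂ))‖ ≤ (z₁ - D - M)⁻¹ := by
      refine (norm_apply_le_l2 h1 _).trans ((l2_resolvent_le_inv_sub h1 (hM i₀)
        (by rwa [hnZ])).trans ?_)
      rw [hnZ]
      exact inv_anti₀ (by linarith) (by linarith [hZm.1])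
    have hξ' : ∀ K, l2 f (ξ K) ≤ C := fun K =>
      (hξ K).trans (mul_le_mul_of_nonneg_right hg hq0)
    have him : ((x : ℂ) + v * Complex.I).im ≠ 0 := by simpa using hv.ne'
    have hR := mul_resolvent (isUnit_sub_of_im_ne_zero hS him)
    have hl := l2_resolvent_le hS hv hξ' hlim hR
    have hl2 := l2_sq_eq (f := f) hS him hR
    simp only [Complex.add_re, Complex.ofReal_re, Complex.mul_re, Complex.I_re, mul_zero,
      Complex.ofReal_im, Complex.I_im, mul_one, sub_self, add_zero, Complex.add_im,
      Complex.mul_im, zero_add] at hl2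
    have hc : Continuous fun t : ℝ => ((x - t) ^ 2 + v ^ 2)⁻¹ :=
      Continuous.inv₀ (by fun_prop) fun t => by positivity
    rw [hμ _ hc, ← hl2]
    exact pow_le_pow_left₀ (l2_nonneg f _) hl 2
  intro t ht
  rw [Set.mem_Iic]
  refine le_of_forall_gt_imp_ge_of_dense fun z₁ hz₁ => ?_
  have hz₁' : M + 2 * D < z₁ := by rw [hD]; linarith
  have hc : Continuous fun t : ℝ => max (t - z₁) 0 := by fun_prop
  have := eq_zero_on_spectrum hf hS hc (by
    rw [← hμ (fun t => max (t - z₁) 0 * max (t - z₁) 0) (hc.mul hc)]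
    refine integral_eq_zero_of_ae ?_
    have : ∀ᵐ t ∂μ, t ∈ Set.Iic z₁ := ae_mem_of_compl (by
      rw [Set.compl_Iic]; exact hnull z₁ hz₁')
    filter_upwards [this] with t ht
    have : max (t - z₁) 0 = 0 := max_eq_right (by linarith [Set.mem_Iic.1 ht])
    simp [this]) t ht
  have h3 : t - z₁ ≤ 0 := this ▸ le_max_left (t - z₁) 0
  linarith

/-- A Haagerup/Voiculescu type inequality for sums of free identically distributed variables. -/
theorem norm_sum_le (h1 : f 1 = 1)
    (hf : ∀ x, f (star x * x) = 0 → x = 0) {X : ι → A} (hsa : ∀ i, IsSelfAdjoint (X i))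
    (hfree : IsFreeFamily f.toLinearMap fun i => Algebra.adjoin ℂ {X i})
    (hid : ∀ i j k, f (X i ^ k) = f (X j ^ k)) (h0 : ∀ i, f (X i) = 0)
    {M s : ℝ} (hM : ∀ i, ‖X i‖ ≤ M) (hs : ∀ i, l2 f (X i) = s) :
    ‖∑ i, X i‖ ≤ M + 2 * s * √(Fintype.card ι) := by
  classical
  have hS := isSelfAdjoint_sum Finset.univ fun i _ => hsa i
  have hup := spectrum_sum_subset_Iic h1 hf hsa hfree hid h0 hM hs
  have hneg : ∀ i, -X i = (-1 : ℂ) • X i := fun i => by simp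
  have hlow := spectrum_sum_subset_Iic (X := fun i => -X i) (M := M) (s := s) h1 hf (fun i => (hsa i).neg)
    (isFreeFamily_mono (fun i => Algebra.adjoin_le (by
      simp only [Set.singleton_subset_iff, SetLike.mem_coe]
      exact neg_mem (Algebra.self_mem_adjoin_singleton ℂ (X i)))) hfree)
    (fun i j k => by simp only [hneg, smul_pow, map_smul, hid i j k])
    (fun i => by simp [h0]) (by simpa using hM)
    (fun i => by simp only [hneg, l2_smul, hs]; simp)
  have hB : 0 ≤ M + 2 * s * √(Fintype.card ι) := by
    obtain ⟨i₀⟩ := ‹Nonempty ι›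
    have hM0 : 0 ≤ M := (norm_nonneg _).trans (hM i₀)
    have hs0 : 0 ≤ s := hs i₀ ▸ l2_nonneg f _
    positivity
  have h5 : ‖cfc (id : ℝ → ℝ) (∑ i, X i)‖ ≤ M + 2 * s * √(Fintype.card ι) :=
    norm_cfc_le hB fun t ht => by
      have h6 : -t ∈ spectrum ℝ (∑ i, -X i) := by
        rw [Finset.sum_neg_distrib, ← spectrum.neg_eq]; simpa using ht
      exact abs_le.2 ⟨by have := Set.mem_Iic.1 (hlow h6); simp only [id]; linarith, hup ht⟩
  rwa [cfc_id ℝ _] at h5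

end NormBound

section Subordination

open scoped ComplexOrder

variable {A : Type*} [CStarAlgebra A] [PartialOrder A] [StarOrderedRing A] {f : A →ₚ[ℂ] ℂ}
  [Nontrivial A] {ι : Type*} [Fintype ι] [Nonempty ι]

lemma im_apply_resolvent_neg (hf : ∀ x, f (star x * x) = 0 → x = 0) {S : A}
    (hS : IsSelfAdjoint S) {z : ℂ} (hz : 0 < z.im) : (f (resolvent S z)).im < 0 := by
  have hR := mul_resolvent (isUnit_sub_of_im_ne_zero hS hz.ne')
  rw [im_apply_of_mul_eq_one hS hR]
  have : 0 < l2 f (resolvent S z) := by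
    refine (l2_nonneg f _).lt_of_ne' fun h => ?_
    rw [eq_zero_of_l2_eq_zero hf h, mul_zero] at hR
    exact zero_ne_one hR
  have := mul_pos hz (pow_pos this 2)
  linarith

lemma le_im_inv_apply_resolvent (h1 : f 1 = 1) (hf : ∀ x, f (star x * x) = 0 → x = 0) {S : A}
    (hS : IsSelfAdjoint S) {z : ℂ} (hz : 0 < z.im) : z.im ≤ ((f (resolvent S z))⁻¹).im := by
  have hR := mul_resolvent (isUnit_sub_of_im_ne_zero hS hz.ne')
  have h2 := im_apply_resolvent_neg hf hS hz
  have h3 := norm_apply_le_l2 h1 (resolvent S z)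
  rw [Complex.inv_im, le_div_iff₀, Complex.normSq_eq_norm_sq, im_apply_of_mul_eq_one hS hR]
  · nlinarith [norm_nonneg (f (resolvent S z)), mul_le_mul_of_nonneg_left
      (pow_le_pow_left₀ (norm_nonneg (f (resolvent S z))) h3 2) hz.le]
  · exact Complex.normSq_pos.2 fun h => by rw [h] at h2; simp at h2

/-- The subordination function of the sum of `n` free copies. -/
noncomputable def subordination (f : A →ₚ[ℂ] ℂ) (S : A) (n : ℝ) (z : ℂ) : ℂ :=
  (z + (n - 1) * (f (resolvent S z))⁻¹) / n

lemma im_le_im_subordination (h1 : f 1 = 1) (hf : ∀ x, f (star x * x) = 0 → x = 0) {S : A}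
    (hS : IsSelfAdjoint S) {n : ℝ} (hn : 1 ≤ n) {z : ℂ} (hz : 0 < z.im) :
    z.im ≤ (subordination f S n z).im := by
  have h2 := le_im_inv_apply_resolvent h1 hf hS hz
  have hn0 : 0 < n := by linarith
  have e : (subordination f S n z).im = (z.im + (n - 1) * ((f (resolvent S z))⁻¹).im) / n := by
    rw [subordination, Complex.div_ofReal_im, Complex.add_im, ← Complex.ofReal_one,
      ← Complex.ofReal_sub, Complex.im_ofReal_mul]
  rw [e, le_div_iff₀ hn0]
  nlinarith

/-- Subordination: the resolvent function of a sum of free copies is the resolvent function of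
one of them, evaluated at the subordination function. -/
theorem apply_resolvent_subordination (h1 : f 1 = 1)
    (hf : ∀ x, f (star x * x) = 0 → x = 0) {X : ι → A} (hsa : ∀ i, IsSelfAdjoint (X i))
    (hfree : IsFreeFamily f.toLinearMap fun i => Algebra.adjoin ℂ {X i})
    (hid : ∀ i j k, f (X i ^ k) = f (X j ^ k)) (h0 : ∀ i, f (X i) = 0)
    {M s : ℝ} (hM : ∀ i, ‖X i‖ ≤ M) (hs : ∀ i, l2 f (X i) = s) (i₀ : ι) {z : ℂ}
    (hz : 0 < z.im) :
    f (resolvent (X i₀) (subordination f (∑ i, X i) (Fintype.card ι) z)) =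
      f (resolvent (∑ i, X i) z) := by
  classical
  have hS := isSelfAdjoint_sum Finset.univ fun i _ => hsa i
  set S := ∑ i, X i with hSdef
  set n : ℝ := (Fintype.card ι : ℝ) with hn
  have hn1 : 1 ≤ n := by
    have : 1 ≤ Fintype.card ι := Fintype.card_pos
    rw [hn]
    exact_mod_cast this
  have hn0 : (n : ℂ) ≠ 0 := by exact_mod_cast (by linarith : n ≠ 0)
  have hM0 : 0 ≤ M := (norm_nonneg _).trans (hM i₀)
  have hs0 : 0 ≤ s := hs i₀ ▸ l2_nonneg f _
  set D : ℝ := s * √n with hD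
  have hD0 : 0 ≤ D := by positivity
  have hsD : (n - 1) * s ^ 2 ≤ D * D := by
    have := Real.mul_self_sqrt (zero_le_one.trans hn1)
    have : D * D = s ^ 2 * n := by rw [hD]; linear_combination s ^ 2 * this
    nlinarith [sq_nonneg s]
  have key : ∀ Z : ℂ, M + D < ‖Z‖ → 0 < (subordinator f (X i₀) n Z).im →
      f (resolvent S (subordinator f (X i₀) n Z)) = f (resolvent (X i₀) Z) := by
    intro Z hZ him
    have hMZ : M < ‖Z‖ := by linarith
    obtain ⟨ξ, hg, -, hlim⟩ := exists_approx_inverse h1 hf hsa hfree hM hs (Z := Z)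
      (g := f (resolvent (X i₀) Z)) hMZ (by linarith) fun i =>
        apply_resolvent_eq_of_moments h1 ((hM i).trans_lt hMZ)
          ((hM i₀).trans_lt hMZ) (hid i i₀)
    have hz : (Fintype.card ι * Z - (Fintype.card ι - 1) * (f (resolvent (X i₀) Z))⁻¹) =
        subordinator f (X i₀) n Z := by
      rw [subordinator, hn]; simp
    rw [hz] at hlim
    set w := subordinator f (X i₀) n Z
    have hRS := resolvent_mul (isUnit_sub_of_im_ne_zero hS him.ne')
    set R := resolvent S w
    have hb : ∀ K, ‖f (resolvent (X i₀) Z) - f R‖ ≤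
        l2 f (star R) * l2 f ((algebraMap ℂ A w - S) * ξ K - 1) := fun K => by
      have := norm_inner_le_l2 f (star R) ((algebraMap ℂ A w - S) * ξ K - 1)
      rwa [star_star, mul_sub, mul_one, ← mul_assoc, hRS, one_mul, map_sub, hg] at this
    have : ‖f (resolvent (X i₀) Z) - f R‖ ≤ 0 :=
      ge_of_tendsto' (by simpa using hlim.const_mul (l2 f (star R))) hb
    exact (sub_eq_zero.1 (norm_le_zero_iff.1 this)).symm
  have keyinv : ∀ Z : ℂ, M + D < ‖Z‖ → 0 < (subordinator f (X i₀) n Z).im →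
      subordination f S n (subordinator f (X i₀) n Z) = Z := by
    intro Z hZ him
    rw [subordination, key Z hZ him, subordinator, div_eq_iff hn0]
    ring
  set y : ℝ := M + D + D + 1 with hy
  set Z₁ : ℂ := y * Complex.I with hZ₁
  have hZ₁n : ‖Z₁‖ = y := by
    rw [hZ₁, norm_mul, Complex.norm_I, mul_one, Complex.norm_real,
      Real.norm_of_nonneg (by linarith)]
  have him₁ : 0 < (subordinator f (X i₀) n Z₁).im := by
    have h2 := norm_subordinator_sub_le h1 hf (hsa i₀) (h0 i₀) hn1 (hM i₀) (Z := Z₁)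
      (by rw [hZ₁n]; linarith)
    rw [hs, hZ₁n] at h2
    have h3 : (n - 1) * s ^ 2 / (y - M) ≤ D := by
      rw [div_le_iff₀ (by linarith)]
      nlinarith
    have h4 := (Complex.abs_im_le_norm _).trans (h2.trans h3)
    rw [Complex.sub_im] at h4
    have h5 : Z₁.im = y := by simp [hZ₁]
    have := abs_le.1 h4
    linarith [this.1]
  have hcont : ContinuousAt (subordinator f (X i₀) n) Z₁ :=
    continuousAt_subordinator h1 hf ((hM i₀).trans_lt (by rw [hZ₁n]; linarith))
  have hev : ∀ᶠ Z in 𝓝 Z₁, M + D < ‖Z‖ ∧ 0 < (subordinator f (X i₀) n Z).im :=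
    (continuous_norm.continuousAt.eventually (lt_mem_nhds (hZ₁n.symm ▸ by linarith : M + D < ‖Z₁‖))).and
      ((Complex.continuous_im.continuousAt.comp hcont).eventually (lt_mem_nhds him₁))
  have htend : Tendsto (subordinator f (X i₀) n) (𝓝[≠] Z₁)
      (𝓝[≠] (subordinator f (X i₀) n Z₁)) := by
    refine tendsto_nhdsWithin_iff.2 ⟨hcont.tendsto.mono_left nhdsWithin_le_nhds, ?_⟩
    filter_upwards [self_mem_nhdsWithin, mem_nhdsWithin_of_mem_nhds hev] with Z hne hZ heq
    refine hne ?_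
    rw [Set.mem_singleton_iff] at heq ⊢
    rw [← keyinv Z hZ.1 hZ.2, heq, keyinv Z₁ hev.self_of_nhds.1 him₁]
  have hgS : ∀ w : ℂ, 0 < w.im → f (resolvent S w) ≠ 0 := fun w hw h => by
    have := im_apply_resolvent_neg hf hS hw
    rw [h] at this; simp at this
  have hdS : ∀ w : ℂ, 0 < w.im → DifferentiableAt ℂ (fun w => f (resolvent S w)) w :=
    fun w hw => (hasDerivAt_apply_resolvent h1
      (isUnit_sub_of_im_ne_zero hS hw.ne')).differentiableAt
  have hopen : IsOpen {w : ℂ | 0 < w.im} := isOpen_lt continuous_const Complex.continuous_im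
  have hanS : AnalyticOnNhd ℂ (fun w => f (resolvent S w)) {w : ℂ | 0 < w.im} :=
    DifferentiableOn.analyticOnNhd (fun w hw => (hdS w hw).differentiableWithinAt) hopen
  have hanX : AnalyticOnNhd ℂ (fun w => f (resolvent (X i₀) (subordination f S n w)))
      {w : ℂ | 0 < w.im} := by
    refine DifferentiableOn.analyticOnNhd (fun w hw => ?_) hopen
    have h2 : DifferentiableAt ℂ (subordination f S n) w :=
      (differentiableAt_id.add (((hdS w hw).inv (hgS w hw)).const_mul _)).div_const _
    have h3 : 0 < (subordination f S n w).im :=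
      lt_of_lt_of_le hw (im_le_im_subordination h1 hf hS hn1 hw)
    have h4 := (hasDerivAt_apply_resolvent h1
      (isUnit_sub_of_im_ne_zero (hsa i₀) h3.ne')).differentiableAt
    exact (h4.comp w h2).differentiableWithinAt
  refine hanX.eqOn_of_preconnected_of_frequently_eq hanS
    (convex_halfSpace_im_gt 0).isPreconnected him₁ ?_ hz
  refine htend.frequently (Eventually.frequently ?_)
  filter_upwards [mem_nhdsWithin_of_mem_nhds hev] with Z hZ
  simp only [keyinv Z hZ.1 hZ.2, key Z hZ.1 hZ.2]

end Subordination

section Estimates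

open scoped ComplexOrder

variable {A : Type*} [CStarAlgebra A] [PartialOrder A] [StarOrderedRing A] {f : A →ₚ[ℂ] ℂ}
  [Nontrivial A]

lemma l2_centered_sq (h1 : f 1 = 1) {Y R : A} {Z : ℂ} (hY : IsSelfAdjoint Y) (hZ : 0 < Z.im)
    (hR : (algebraMap ℂ A Z - Y) * R = 1) (hg : f R ≠ 0) :
    l2 f ((f R)⁻¹ • R - 1) ^ 2 = ((f R)⁻¹).im / Z.im - 1 := by
  have h2 := im_apply_of_mul_eq_one (f := f) hY hR
  have h3 : f (star ((f R)⁻¹ • R - 1) * ((f R)⁻¹ • R - 1)) =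
      (starRingEnd ℂ ((f R)⁻¹) * (f R)⁻¹) * f (star R * R) - 1 := by
    have e : f (star R) = starRingEnd ℂ (f R) := map_star_eq f R
    have hg' : starRingEnd ℂ (f R) ≠ 0 := by simpa using hg
    simp only [star_sub, star_smul, star_one, sub_mul, mul_sub, one_mul, mul_one, map_sub,
      smul_mul_assoc, mul_smul_comm, map_smul, smul_eq_mul, h1, e, map_inv₀,
      RCLike.star_def]
    field_simp
    ring
  rw [← ofReal_l2_sq, ← ofReal_l2_sq, ← Complex.normSq_eq_conj_mul_self] at h3
  have h4 : l2 f ((f R)⁻¹ • R - 1) ^ 2 = Complex.normSq ((f R)⁻¹) * l2 f R ^ 2 - 1 := by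
    exact_mod_cast h3
  rw [h4, Complex.inv_im, h2, Complex.normSq_inv]
  have := Complex.normSq_pos.2 hg
  field_simp

/-- Estimates for the subordination function `Z` and the reciprocal `F` of the resolvent function,
for summands with variance `1 / n` and norm at most `η`. -/
lemma subordination_estimates (h1 : f 1 = 1) (hf : ∀ x, f (star x * x) = 0 → x = 0)
    {Y : A} (hY : IsSelfAdjoint Y) (h0 : f Y = 0) {n η : ℝ} (hn : 16 ≤ n)
    (hs : l2 f Y ^ 2 = n⁻¹) (hη : ‖Y‖ ≤ η) (hη4 : η ≤ 1 / 4) {z Z F : ℂ} (hz : 0 < z.im)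
    (hZ : 0 < Z.im) (hF : F = (f (resolvent Y Z))⁻¹) (hzZ : z = n * Z - (n - 1) * F) :
    ‖Z - F‖ ≤ η / 2 ∧ 1 / 2 ≤ ‖F‖ ∧ ‖z - Z‖ ≤ 1 ∧ ‖Z * Z - z * Z + 1‖ ≤ 2 * η := by
  have hR := mul_resolvent (isUnit_sub_of_im_ne_zero hY hZ.ne')
  have hg : f (resolvent Y Z) ≠ 0 := fun h => by
    have := im_apply_resolvent_neg hf hY hZ
    rw [h] at this; simp at this
  have hq := l2_centered_sq h1 hY hZ hR hg
  have ha := apply_mul_centered h1 h0 hR hg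
  have hb := mul_apply_mul_centered h1 h0 hR hg
  set R := resolvent Y Z
  rw [← hF] at hq ha hb
  set r := F • R - 1
  have hca : ‖f (Y * r)‖ ≤ l2 f Y * l2 f r := by
    simpa [hY.star_eq] using norm_inner_le_l2 f Y r
  have hp0 := l2_nonneg f Y
  have hq0 := l2_nonneg f r
  have hcb : ‖f (Y * Y * r)‖ ≤ η * (l2 f Y * l2 f r) := by
    have h2 := norm_inner_le_l2 f (Y * Y) r
    rw [star_mul, hY.star_eq] at h2
    calc _ ≤ _ := h2
      _ ≤ (‖Y‖ * l2 f Y) * l2 f r := mul_le_mul_of_nonneg_right (l2_mul_le f Y Y) hq0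
      _ ≤ (η * l2 f Y) * l2 f r := by gcongr
      _ = _ := by ring
  have hYY : f (Y * Y) = ((n⁻¹ : ℝ) : ℂ) := by
    rw [← hs, ofReal_l2_sq, hY.star_eq]
  have hη0 : 0 ≤ η := (norm_nonneg _).trans hη
  have hn0 : 0 < n := by linarith
  have hηn : n⁻¹ ≤ η ^ 2 := by
    rw [← hs]; exact pow_le_pow_left₀ hp0 ((l2_le_norm h1 Y).trans hη) 2
  have hqn : l2 f r ^ 2 * (n - 1) ≤ 1 := by
    have h3 : z.im = n * Z.im - (n - 1) * F.im := by
      rw [hzZ, Complex.sub_im, Complex.im_ofReal_mul, ← Complex.ofReal_one,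
        ← Complex.ofReal_sub, Complex.im_ofReal_mul]
    have h4 : F.im = (l2 f r ^ 2 + 1) * Z.im := by rw [hq]; field_simp; ring
    rw [h4] at h3
    have h5 : 0 < (1 - (n - 1) * l2 f r ^ 2) * Z.im := by linarith
    have := (mul_pos_iff_of_pos_right hZ).1 h5
    linarith
  set c := l2 f Y * l2 f r with hc
  have hc0 : 0 ≤ c := mul_nonneg hp0 hq0
  have hc2 : c ^ 2 * (n * (n - 1)) ≤ 1 := by
    have : c ^ 2 * (n * (n - 1)) = l2 f r ^ 2 * (n - 1) := by
      rw [hc, mul_pow, hs]; field_simp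
    rw [this]; exact hqn
  have hcn : c * (n - 1) ≤ 1 := by
    refine abs_le_of_sq_le_sq' (b := 1) ?_ zero_le_one |>.2
    nlinarith [sq_nonneg c]
  have hbd : n⁻¹ ≤ (‖Z‖ + η) * c := by
    have : ((n⁻¹ : ℝ) : ℂ) = Z * f (Y * r) - f (Y * Y * r) := by rw [hb, hYY]; ring
    have h2 : n⁻¹ = ‖((n⁻¹ : ℝ) : ℂ)‖ := by
      rw [Complex.norm_real, Real.norm_of_nonneg (by positivity)]
    rw [h2, this]
    calc _ ≤ ‖Z * f (Y * r)‖ + ‖f (Y * Y * r)‖ := norm_sub_le _ _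
      _ ≤ ‖Z‖ * c + η * c := by rw [norm_mul]; gcongr
      _ = _ := by ring
  have hZn : 95 / 100 ≤ ‖Z‖ + η := by
    by_contra! hlt
    have h2 : 1 ≤ 95 / 100 * c * n := by
      have : n⁻¹ * n ≤ 95 / 100 * c * n := by
        refine mul_le_mul_of_nonneg_right (hbd.trans ?_) hn0.le
        exact mul_le_mul_of_nonneg_right hlt.le hc0
      rwa [inv_mul_cancel₀ hn0.ne'] at this
    have h3 : 1 ≤ (95 / 100 * c * n) ^ 2 := one_le_pow₀ h2
    nlinarith [sq_nonneg c]
  have hca' : ‖Z - F‖ ≤ c := ha ▸ hca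
  have hc15 : c ≤ 1 / 15 := by nlinarith
  have hn1 : ‖((n : ℂ) - 1)‖ = n - 1 := by
    rw [← Complex.ofReal_one, ← Complex.ofReal_sub, Complex.norm_real,
      Real.norm_of_nonneg (by linarith)]
  have hcη : c ≤ η / 2 := by
    have h2 : c * n ≤ 2 := by nlinarith
    have : c * n * n⁻¹ ≤ 2 * η ^ 2 := mul_le_mul h2 hηn (by positivity) (by norm_num)
    rw [mul_inv_cancel_right₀ hn0.ne'] at this
    nlinarith
  refine ⟨hca'.trans hcη, ?_, ?_, ?_⟩
  · have := norm_sub_norm_le Z F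
    linarith
  · have : z - Z = (n - 1) * (Z - F) := by rw [hzZ]; ring
    rw [this, norm_mul, hn1]
    nlinarith
  · have e : Z * Z - z * Z + 1 = ((n⁻¹ : ℝ) : ℂ) - (n - 1) * f (Y * Y * r) := by
      have h2 : Z * (Z - F) = ((n⁻¹ : ℝ) : ℂ) + f (Y * Y * r) := by rw [← ha, hb, hYY]
      have h3 : (n : ℂ) * ((n⁻¹ : ℝ) : ℂ) = 1 := by
        rw [← Complex.ofReal_mul, mul_inv_cancel₀ hn0.ne', Complex.ofReal_one]
      rw [hzZ]
      linear_combination (1 - (n : ℂ)) * h2 - h3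
    rw [e]
    calc _ ≤ ‖((n⁻¹ : ℝ) : ℂ)‖ + ‖((n : ℂ) - 1) * f (Y * Y * r)‖ := norm_sub_le _ _
      _ ≤ η ^ 2 + η := by
        rw [norm_mul, hn1, Complex.norm_real, Real.norm_of_nonneg (by positivity)]
        refine add_le_add hηn ?_
        nlinarith [mul_le_mul_of_nonneg_left hcb (by linarith : 0 ≤ n - 1)]
      _ ≤ _ := by nlinarith

/-- Comparison with the resolvent function of the semicircle law. -/
lemma im_inv_sub_le {u v η : ℝ} (hu : |u| < 2) (hv : 0 < v) (hv1 : v ≤ 1) {z Z F : ℂ}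
    (hz : z = u + v * Complex.I) (hZ : 0 < Z.im)
    (e1 : ‖Z - F‖ ≤ η / 2) (e2 : 1 / 2 ≤ ‖F‖) (e3 : ‖z - Z‖ ≤ 1)
    (e4 : ‖Z * Z - z * Z + 1‖ ≤ 2 * η) :
    |-(F⁻¹).im - √(4 - u ^ 2) / 2| ≤ 20 * (η + v) / √(4 - u ^ 2) := by
  have hu2 : 0 < 4 - u ^ 2 := by nlinarith [abs_lt.1 hu]
  set d := √(4 - u ^ 2) with hd
  have hd0 : 0 < d := Real.sqrt_pos.2 hu2
  have hdd : d ^ 2 = 4 - u ^ 2 := Real.sq_sqrt hu2.le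
  have hd2 : d ≤ 2 := by nlinarith [sq_nonneg u]
  set w : ℂ := ⟨u / 2, d / 2⟩ with hw
  set w' : ℂ := ⟨u / 2, -(d / 2)⟩ with hw'
  have hww : w * w' = 1 := by
    apply Complex.ext <;> simp [hw, hw'] <;> nlinarith
  have hwa : w + w' = u := by
    apply Complex.ext <;> simp [hw, hw']
  have hwn : ‖w‖ = 1 := by
    have : ‖w‖ ^ 2 = 1 := by
      rw [← Complex.normSq_eq_norm_sq, Complex.normSq_apply, hw]; simp only; nlinarith
    nlinarith [norm_nonneg w]
  have hzn : ‖z‖ ≤ 3 := by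
    rw [hz]
    calc _ ≤ ‖(u : ℂ)‖ + ‖(v : ℂ) * Complex.I‖ := norm_add_le _ _
      _ ≤ _ := by
        rw [norm_mul, Complex.norm_I, mul_one, Complex.norm_real, Complex.norm_real,
          Real.norm_eq_abs, Real.norm_of_nonneg hv.le]
        linarith
  have hZn : ‖Z‖ ≤ 4 := by
    have := norm_sub_norm_le Z z
    rw [norm_sub_rev] at this
    linarith
  have hprod : ‖Z - w‖ * ‖Z - w'‖ ≤ 2 * η + 4 * v := by
    have : (Z - w) * (Z - w') = (Z * Z - z * Z + 1) + v * Complex.I * Z := by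
      rw [hz]; linear_combination hww - Z * hwa
    rw [← norm_mul, this]
    calc _ ≤ ‖Z * Z - z * Z + 1‖ + ‖v * Complex.I * Z‖ := norm_add_le _ _
      _ ≤ _ := by
        rw [norm_mul, norm_mul, Complex.norm_I, mul_one, Complex.norm_real,
          Real.norm_of_nonneg hv.le]
        nlinarith
  have hlow : d / 2 ≤ ‖Z - w'‖ := by
    refine le_trans ?_ (Complex.abs_im_le_norm _)
    rw [Complex.sub_im, hw']
    exact le_trans (by simp only; linarith) (le_abs_self _)
  have hη0 : 0 ≤ η := by linarith [norm_nonneg (Z - F)]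
  have hZw : ‖Z - w‖ * d ≤ 4 * η + 8 * v := by
    nlinarith [mul_le_mul_of_nonneg_left hlow (norm_nonneg (Z - w))]
  have hF0 : F ≠ 0 := norm_pos_iff.1 (by linarith)
  have hFw : F⁻¹ - w' = F⁻¹ * (w - F) * w' := by
    field_simp
    linear_combination -hww
  have hw'n : ‖w'‖ = 1 := by
    have := congrArg norm hww
    rwa [norm_mul, hwn, one_mul, norm_one] at this
  have hinv : ‖F⁻¹‖ ≤ 2 := by
    rw [norm_inv, inv_le_comm₀ (by linarith) (by norm_num)]; linarith
  have hwF : ‖w - F‖ ≤ ‖Z - w‖ + η / 2 := by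
    have : w - F = (Z - F) - (Z - w) := by ring
    rw [this]
    linarith [norm_sub_le (Z - F) (Z - w)]
  have him : |-(F⁻¹).im - d / 2| ≤ ‖F⁻¹ - w'‖ := by
    have := Complex.abs_im_le_norm (F⁻¹ - w')
    rwa [Complex.sub_im, ← abs_neg, show -((F⁻¹).im - w'.im) = -(F⁻¹).im - d / 2 by
      rw [hw']; ring] at this
  rw [le_div_iff₀ hd0]
  have h5 : ‖F⁻¹ - w'‖ ≤ 2 * (‖Z - w‖ + η / 2) := by
    rw [hFw, norm_mul, norm_mul, hw'n, mul_one]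
    exact mul_le_mul hinv hwF (norm_nonneg _) (by norm_num)
  nlinarith [mul_le_mul_of_nonneg_right (him.trans h5) hd0.le]

end Estimates

section Semicircle

/-- The distribution function of the semicircle law on `[-2, 2]`. -/
noncomputable def semicirclePrimitive (x : ℝ) : ℝ :=
  1 / 2 + x * √(4 - x ^ 2) / (4 * Real.pi) + Real.arcsin (x / 2) / Real.pi

lemma continuous_semicirclePrimitive : Continuous semicirclePrimitive := by
  unfold semicirclePrimitive
  have := Real.continuous_arcsin
  fun_prop

lemma semicirclePrimitive_neg_two : semicirclePrimitive (-2) = 0 := by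
  unfold semicirclePrimitive
  norm_num
  field_simp
  norm_num

lemma semicirclePrimitive_two : semicirclePrimitive 2 = 1 := by
  unfold semicirclePrimitive
  norm_num
  field_simp
  norm_num

lemma hasDerivAt_arcsin_half {x : ℝ} (hx : |x| < 2) :
    HasDerivAt (fun x : ℝ => Real.arcsin (x / 2)) (√(4 - x ^ 2))⁻¹ x := by
  have hx' := abs_lt.1 hx
  have h := (Real.hasDerivAt_arcsin (x := x / 2) (by linarith) (by linarith)).comp x
    ((hasDerivAt_id x).div_const 2)
  have e : √(4 - x ^ 2) = 2 * √(1 - (x / 2) ^ 2) := by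
    rw [show 4 - x ^ 2 = 2 ^ 2 * (1 - (x / 2) ^ 2) by ring, Real.sqrt_mul (by norm_num),
      Real.sqrt_sq (by norm_num)]
  refine h.congr_deriv ?_
  rw [e]
  have : 0 < √(1 - (x / 2) ^ 2) := Real.sqrt_pos.2 (by nlinarith)
  field_simp

lemma hasDerivAt_semicirclePrimitive {x : ℝ} (hx : |x| < 2) :
    HasDerivAt semicirclePrimitive ((2 * Real.pi)⁻¹ * √(4 - x ^ 2)) x := by
  have hx2 : 0 < 4 - x ^ 2 := by nlinarith [abs_lt.1 hx]
  have h1 := hasDerivAt_arcsin_half hx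
  have h2 : HasDerivAt (fun x : ℝ => 4 - x ^ 2) (-(2 * x)) x := by
    simpa using (hasDerivAt_pow 2 x).const_sub 4
  have h3 := (((hasDerivAt_id x).mul (h2.sqrt hx2.ne')).div_const (4 * Real.pi)).const_add (1 / 2)
  refine (h3.add (h1.div_const Real.pi)).congr_deriv ?_
  have hd : √(4 - x ^ 2) ≠ 0 := (Real.sqrt_pos.2 hx2).ne'
  have hdd := Real.sq_sqrt hx2.le
  set d := √(4 - x ^ 2)
  simp only [id]
  field_simp
  nlinarith

/-- The density of the semicircle law. -/
noncomputable def semicircleDensity : ℝ → ℝ :=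
  Set.indicator (Set.Icc (-2 : ℝ) 2) fun t => (2 * Real.pi)⁻¹ * Real.sqrt (4 - t ^ 2)

lemma semicircleLaw_eq : semicircleLaw =
    volume.withDensity fun t => ENNReal.ofReal (semicircleDensity t) := rfl

lemma semicircleDensity_nonneg (t : ℝ) : 0 ≤ semicircleDensity t :=
  Set.indicator_nonneg (fun _ _ => by positivity) t

lemma semicircleDensity_le (t : ℝ) : semicircleDensity t ≤ Real.pi⁻¹ := by
  refine Set.indicator_apply_le' (fun _ => ?_) (fun _ => by positivity)
  have : √(4 - t ^ 2) ≤ 2 := by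
    rw [Real.sqrt_le_left (by norm_num)]
    nlinarith [sq_nonneg t]
  rw [mul_inv]
  have := mul_le_mul_of_nonneg_left this (by positivity : 0 ≤ 2⁻¹ * Real.pi⁻¹)
  linarith

lemma integrable_semicircleDensity : Integrable semicircleDensity :=
  (ContinuousOn.integrableOn_Icc (by fun_prop)).integrable_indicator measurableSet_Icc

lemma semicircleLaw_apply_toReal {s : Set ℝ} (hs : MeasurableSet s) :
    (semicircleLaw s).toReal = ∫ t in s, semicircleDensity t := by
  rw [semicircleLaw_eq, withDensity_apply _ hs, integral_eq_lintegral_of_nonneg_ae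
    (ae_of_all _ semicircleDensity_nonneg)
    integrable_semicircleDensity.aestronglyMeasurable.restrict]

lemma integral_semicircleDensity {x : ℝ} (h1 : -2 ≤ x) (h2 : x ≤ 2) :
    ∫ t in Set.Icc (-2) x, (2 * Real.pi)⁻¹ * Real.sqrt (4 - t ^ 2) = semicirclePrimitive x := by
  rw [integral_Icc_eq_integral_Ioc, ← intervalIntegral.integral_of_le h1,
    intervalIntegral.integral_eq_sub_of_hasDerivAt_of_le h1
      continuous_semicirclePrimitive.continuousOn (fun t ht =>
        hasDerivAt_semicirclePrimitive (abs_lt.2 ⟨ht.1, ht.2.trans_le h2⟩))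
      (Continuous.intervalIntegrable (by fun_prop) _ _), semicirclePrimitive_neg_two, sub_zero]

lemma cdf_semicircleLaw {x : ℝ} (hx : -2 ≤ x) :
    cdf semicircleLaw x = semicirclePrimitive (min x 2) := by
  rw [cdf, semicircleLaw_apply_toReal measurableSet_Iic, semicircleDensity,
    setIntegral_indicator measurableSet_Icc, ← integral_semicircleDensity (le_min hx (by norm_num))
      (min_le_right _ _)]
  congr 2
  ext t
  simp only [Set.mem_inter_iff, Set.mem_Iic, Set.mem_Icc, le_min_iff]
  tauto

lemma cdf_semicircleLaw_of_mem {x : ℝ} (hx : x ∈ Set.Icc (-2 : ℝ) 2) :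
    cdf semicircleLaw x = semicirclePrimitive x := by
  rw [cdf_semicircleLaw hx.1, min_eq_left hx.2]

lemma cdf_semicircleLaw_of_two_le {x : ℝ} (hx : 2 ≤ x) : cdf semicircleLaw x = 1 := by
  rw [cdf_semicircleLaw (by linarith), min_eq_right hx, semicirclePrimitive_two]

lemma cdf_semicircleLaw_of_le {x : ℝ} (hx : x ≤ -2) : cdf semicircleLaw x = 0 := by
  rcases hx.eq_or_lt with rfl | hx
  · rw [cdf_semicircleLaw_of_mem (by norm_num), semicirclePrimitive_neg_two]
  rw [cdf, semicircleLaw_apply_toReal measurableSet_Iic, semicircleDensity,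
    setIntegral_indicator measurableSet_Icc]
  have : Set.Iic x ∩ Set.Icc (-2) 2 = ∅ := by
    ext t
    simp only [Set.mem_inter_iff, Set.mem_Iic, Set.mem_Icc, Set.mem_empty_iff_false, iff_false]
    intro h
    linarith [h.1, h.2.1]
  rw [this, setIntegral_empty]

lemma semicircleLaw_compl_Icc : semicircleLaw (Set.Icc (-2) 2)ᶜ = 0 := by
  rw [semicircleLaw_eq, withDensity_apply _ measurableSet_Icc.compl]
  refine (setLIntegral_congr_fun measurableSet_Icc.compl (g := fun _ => 0) fun t ht => ?_).trans
    (by simp)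
  simp [semicircleDensity, Set.indicator_of_notMem ht]

instance : IsProbabilityMeasure semicircleLaw := by
  have h : (semicircleLaw Set.univ).toReal = 1 := by
    rw [semicircleLaw_apply_toReal MeasurableSet.univ, semicircleDensity,
      setIntegral_indicator measurableSet_Icc, Set.univ_inter,
      integral_semicircleDensity (by norm_num) le_rfl, semicirclePrimitive_two]
  exact ⟨by rwa [ENNReal.toReal_eq_one_iff] at h⟩

lemma cdf_semicircleLaw_sub_le {x y : ℝ} (hxy : x ≤ y) :
    cdf semicircleLaw y - cdf semicircleLaw x ≤ (y - x) / Real.pi := by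
  have e : cdf semicircleLaw y - cdf semicircleLaw x = ∫ t in Set.Ioc x y, semicircleDensity t := by
    rw [cdf, cdf, semicircleLaw_apply_toReal measurableSet_Iic,
      semicircleLaw_apply_toReal measurableSet_Iic, ← Set.Iic_union_Ioc_eq_Iic hxy,
      setIntegral_union (Set.Iic_disjoint_Ioc le_rfl) measurableSet_Ioc
        integrable_semicircleDensity.integrableOn integrable_semicircleDensity.integrableOn]
    ring
  rw [e]
  calc _ ≤ ∫ t in Set.Ioc x y, Real.pi⁻¹ :=
        setIntegral_mono integrable_semicircleDensity.integrableOn (by simp)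
          semicircleDensity_le
    _ = _ := by
      rw [setIntegral_const, smul_eq_mul, measureReal_def, Real.volume_Ioc,
        ENNReal.toReal_ofReal (by linarith), div_eq_mul_inv]

end Semicircle

section Smoothing

variable {μ : Measure ℝ} [IsProbabilityMeasure μ]

lemma integrable_poisson (u : ℝ) {v : ℝ} (hv : 0 < v) :
    Integrable (fun t => v / ((u - t) ^ 2 + v ^ 2)) μ := by
  refine Integrable.of_bound (C := v⁻¹) (Continuous.aestronglyMeasurable (by
    refine Continuous.div (by fun_prop) (by fun_prop) fun t => by positivity))
    (ae_of_all _ fun t => ?_)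
  rw [Real.norm_of_nonneg (by positivity), div_le_iff₀ (by positivity)]
  field_simp
  nlinarith [sq_nonneg (u - t)]

lemma hasDerivAt_integral_arctan (x : ℝ) {v : ℝ} (hv : 0 < v) :
    HasDerivAt (fun x => ∫ t, Real.arctan ((x - t) / v) ∂μ)
      (∫ t, v / ((x - t) ^ 2 + v ^ 2) ∂μ) x := by
  refine (hasDerivAt_integral_of_dominated_loc_of_deriv_le (s := Set.univ) (bound := fun _ => v⁻¹)
    (F' := fun x t => v / ((x - t) ^ 2 + v ^ 2))
    univ_mem (Eventually.of_forall fun y => ?_) ?_ ?_ (ae_of_all _ fun t y _ => ?_)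
    (integrable_const _) (ae_of_all _ fun t y _ => ?_)).2
  · exact (Real.continuous_arctan.comp (by fun_prop)).aestronglyMeasurable
  · refine Integrable.of_bound (C := Real.pi / 2)
      (Real.continuous_arctan.comp (by fun_prop)).aestronglyMeasurable (ae_of_all _ fun t => ?_)
    exact abs_le.2 ⟨(Real.neg_pi_div_two_lt_arctan _).le, (Real.arctan_lt_pi_div_two _).le⟩
  · exact (integrable_poisson x hv).aestronglyMeasurable
  · rw [Real.norm_of_nonneg (by positivity), div_le_iff₀ (by positivity)]
    field_simp
    nlinarith [sq_nonneg (y - t)]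
  · have := (((hasDerivAt_id y).sub_const t).div_const v).arctan
    refine this.congr_deriv ?_
    simp only [id]
    field_simp
    ring

end Smoothing

section Smoothing

lemma half_sub_arctan_le {s v : ℝ} (hs : 0 < s) (hv : 0 < v) :
    1 / 2 - Real.arctan (s / v) / Real.pi ≤ v / (2 * s) := by
  have h := Real.arctan_inv_of_pos (div_pos hs hv)
  have h2 : Real.arctan (s / v)⁻¹ ≤ (s / v)⁻¹ := by
    have := Real.le_tan (Real.arctan_nonneg.2 (by positivity : 0 ≤ (s / v)⁻¹))
      (Real.arctan_lt_pi_div_two _)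
    rwa [Real.tan_arctan] at this
  rw [h, inv_div] at h2
  have e : 1 / 2 - Real.arctan (s / v) / Real.pi =
      (Real.pi / 2 - Real.arctan (s / v)) / Real.pi := by field_simp
  rw [e, div_le_iff₀ Real.pi_pos]
  refine h2.trans ?_
  have : v / s = v / (2 * s) * 2 := by field_simp
  rw [this]
  exact mul_le_mul_of_nonneg_left (by linarith [Real.pi_gt_three]) (by positivity)

lemma half_sub_arctan_le_sum_of_le {v : ℝ} (hv : 0 < v) (K : ℕ) {s : ℝ} (hs : |s| ≤ 2 ^ K * v) :
    1 / 2 - Real.arctan (|s| / v) / Real.pi ≤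
      ∑ k ∈ Finset.range (K + 1), 2 * v * ((2 ^ k * v) / (s ^ 2 + (2 ^ k * v) ^ 2)) := by
  induction K with
  | zero =>
    rw [pow_zero, one_mul] at hs
    have h2 : s ^ 2 ≤ v ^ 2 := by rw [← sq_abs s]; exact pow_le_pow_left₀ (abs_nonneg s) hs 2
    have h3 : 0 ≤ Real.arctan (|s| / v) / Real.pi :=
      div_nonneg (Real.arctan_nonneg.2 (by positivity)) Real.pi_pos.le
    simp only [zero_add, Finset.range_one, Finset.sum_singleton, pow_zero, one_mul]
    have : 1 / 2 ≤ 2 * v * (v / (s ^ 2 + v ^ 2)) := by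
      rw [mul_div_assoc', le_div_iff₀ (by positivity)]
      nlinarith
    linarith
  | succ K ih =>
    rw [Finset.sum_range_succ]
    rcases le_or_gt |s| (2 ^ K * v) with h | h
    · exact (ih h).trans (le_add_of_nonneg_right (by positivity))
    · have hy : 0 < 2 ^ K * v := by positivity
      refine le_trans ?_ (le_add_of_nonneg_left (Finset.sum_nonneg fun k _ => by positivity))
      refine (half_sub_arctan_le (hy.trans h) hv).trans ?_
      rw [pow_succ] at hs ⊢
      set y := 2 ^ K * v
      have e : 2 ^ K * 2 * v = 2 * y := by ring
      rw [e] at hs ⊢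
      have h2 : s ^ 2 ≤ (2 * y) ^ 2 := by
        rw [← sq_abs s]; exact pow_le_pow_left₀ (abs_nonneg s) hs 2
      rw [mul_div_assoc', div_le_div_iff₀ (by linarith) (by positivity)]
      have h3 : s ^ 2 + (2 * y) ^ 2 ≤ 8 * y * |s| := by
        have := sq_abs s
        nlinarith
      nlinarith

lemma half_sub_arctan_le_sum {v : ℝ} (hv : 0 < v) (K : ℕ) (s : ℝ) :
    1 / 2 - Real.arctan (|s| / v) / Real.pi ≤
      ∑ k ∈ Finset.range (K + 1), 2 * v * ((2 ^ k * v) / (s ^ 2 + (2 ^ k * v) ^ 2)) +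
        (2 ^ K)⁻¹ := by
  rcases le_or_gt |s| (2 ^ K * v) with h | h
  · exact (half_sub_arctan_le_sum_of_le hv K h).trans (le_add_of_nonneg_right (by positivity))
  · have hy : 0 < 2 ^ K * v := by positivity
    refine le_trans ?_ (le_add_of_nonneg_left (Finset.sum_nonneg fun k _ => by positivity))
    refine (half_sub_arctan_le (hy.trans h) hv).trans ?_
    rw [div_le_iff₀ (by linarith), ← div_eq_inv_mul, le_div_iff₀ (by positivity)]
    linarith

variable {μ : Measure ℝ} [IsProbabilityMeasure μ]

lemma integrable_arctan (x v : ℝ) : Integrable (fun t => Real.arctan ((x - t) / v)) μ := by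
  refine Integrable.of_bound (C := Real.pi / 2)
      (Real.continuous_arctan.comp (by fun_prop)).aestronglyMeasurable (ae_of_all _ fun t => ?_)
  exact abs_le.2 ⟨(Real.neg_pi_div_two_lt_arctan _).le, (Real.arctan_lt_pi_div_two _).le⟩

/-- A smoothed distribution function. -/
noncomputable def smoothedCdf (μ : Measure ℝ) (v x : ℝ) : ℝ :=
  1 / 2 + (∫ t, Real.arctan ((x - t) / v) ∂μ) / Real.pi

lemma abs_cdf_sub_smoothedCdf_le {v : ℝ} (hv : 0 < v) {b : ℝ} (K : ℕ) (hK : 2 ^ K * v ≤ 1)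
    (hb : ∀ u y : ℝ, 0 < y → y ≤ 1 → ∫ t, y / ((u - t) ^ 2 + y ^ 2) ∂μ ≤ b) (x : ℝ) :
    |cdf μ x - smoothedCdf μ v x| ≤ 2 * b * (K + 1) * v + (2 ^ K)⁻¹ := by
  have hind : Integrable (fun t => Set.indicator (Set.Iic x) (fun _ => (1 : ℝ)) t) μ :=
    (integrable_const _).indicator measurableSet_Iic
  have hint : Integrable (fun t => 1 / 2 + Real.arctan ((x - t) / v) / Real.pi) μ :=
    (integrable_const _).add ((integrable_arctan x v).div_const _)
  have e1 : cdf μ x = ∫ t, Set.indicator (Set.Iic x) (fun _ => (1 : ℝ)) t ∂μ := by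
    rw [integral_indicator measurableSet_Iic, setIntegral_const, smul_eq_mul, mul_one, cdf,
      measureReal_def]
  have e2 : smoothedCdf μ v x = ∫ t, (1 / 2 + Real.arctan ((x - t) / v) / Real.pi) ∂μ := by
    rw [integral_add (integrable_const _) ((integrable_arctan x v).div_const _)]
    simp [smoothedCdf, integral_div]
  rw [e1, e2, ← integral_sub hind hint]
  refine (abs_integral_le_integral_abs).trans ?_
  have hpi : ∀ k : ℕ, Integrable
      (fun t => 2 * v * ((2 ^ k * v) / ((x - t) ^ 2 + (2 ^ k * v) ^ 2))) μ := fun k =>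
    (integrable_poisson x (by positivity)).const_mul _
  calc ∫ t, |Set.indicator (Set.Iic x) (fun _ => (1 : ℝ)) t
        - (1 / 2 + Real.arctan ((x - t) / v) / Real.pi)| ∂μ
      ≤ ∫ t, (∑ k ∈ Finset.range (K + 1),
          2 * v * ((2 ^ k * v) / ((x - t) ^ 2 + (2 ^ k * v) ^ 2)) + (2 ^ K)⁻¹) ∂μ := by
        refine integral_mono (hind.sub hint).abs
          ((integrable_finsetSum _ fun k _ => hpi k).add (integrable_const _)) fun t => ?_
        refine le_trans (le_of_eq ?_) (half_sub_arctan_le_sum hv K (x - t))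
        have hb : |Real.arctan ((x - t) / v) / Real.pi| ≤ 1 / 2 := by
          rw [abs_div, abs_of_pos Real.pi_pos, div_le_iff₀ Real.pi_pos, abs_le]
          constructor
          · linarith [Real.neg_pi_div_two_lt_arctan ((x - t) / v)]
          · linarith [Real.arctan_lt_pi_div_two ((x - t) / v)]
        have hb' := abs_le.1 hb
        rcases le_or_gt t x with h | h
        · simp only [Set.indicator_of_mem (Set.mem_Iic.2 h)]
          rw [abs_of_nonneg (sub_nonneg.2 h), abs_of_nonneg (by linarith)]
          ring
        · simp only [Set.indicator_of_notMem (fun h' : t ∈ Set.Iic x => absurd h' (not_le.2 h))]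
          rw [abs_of_neg (sub_neg.2 h), neg_div, Real.arctan_neg, abs_of_nonpos (by linarith)]
          ring
    _ = ∑ k ∈ Finset.range (K + 1), 2 * v * (∫ t, (2 ^ k * v) / ((x - t) ^ 2 + (2 ^ k * v) ^ 2) ∂μ)
          + (2 ^ K)⁻¹ := by
        rw [integral_add (integrable_finsetSum _ fun k _ => hpi k) (integrable_const _),
          integral_finsetSum _ fun k _ => hpi k]
        simp [integral_const_mul]
    _ ≤ ∑ k ∈ Finset.range (K + 1), 2 * v * b + (2 ^ K)⁻¹ := by
        gcongr with k hk
        refine hb x _ (by positivity) (le_trans ?_ hK)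
        gcongr
        · norm_num
        · exact Nat.lt_succ_iff.1 (Finset.mem_range.1 hk)
    _ = _ := by
        rw [Finset.sum_const, Finset.card_range, nsmul_eq_mul]
        push_cast
        ring

lemma cdf_mono (μ : Measure ℝ) [IsProbabilityMeasure μ] {x y : ℝ} (h : x ≤ y) :
    cdf μ x ≤ cdf μ y :=
  ENNReal.toReal_mono (measure_ne_top _ _) (measure_mono (Set.Iic_subset_Iic.2 h))

lemma cdf_nonneg (μ : Measure ℝ) (x : ℝ) : 0 ≤ cdf μ x := ENNReal.toReal_nonneg

lemma cdf_le_one (μ : Measure ℝ) [IsProbabilityMeasure μ] (x : ℝ) : cdf μ x ≤ 1 :=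
  ENNReal.toReal_le_of_le_ofReal zero_le_one (by simpa using prob_le_one)

lemma abs_smoothedCdf_sub_le {v : ℝ} (hv : 0 < v) {c : ℝ}
    (hc : ∀ u : ℝ, |u| < 2 → |∫ t, v / ((u - t) ^ 2 + v ^ 2) ∂μ - √(4 - u ^ 2) / 2| ≤
      c / √(4 - u ^ 2)) {x y : ℝ} (hx : x ∈ Set.Icc (-2 : ℝ) 2) (hy : y ∈ Set.Icc (-2 : ℝ) 2)
    (hxy : x ≤ y) :
    |(smoothedCdf μ v y - smoothedCdf μ v x) - (semicirclePrimitive y - semicirclePrimitive x)|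
      ≤ c := by
  have hc0 : 0 ≤ c := by
    have := (abs_nonneg _).trans (hc 0 (by norm_num))
    by_contra! h
    exact absurd this (not_le.2 (div_neg_of_neg_of_pos h (Real.sqrt_pos.2 (by norm_num))))
  have hd : ∀ u, HasDerivAt (smoothedCdf μ v)
      ((∫ t, v / ((u - t) ^ 2 + v ^ 2) ∂μ) / Real.pi) u := fun u =>
    ((hasDerivAt_integral_arctan u hv).div_const _).const_add _
  have hcs : Continuous (smoothedCdf μ v) :=
    continuous_iff_continuousAt.2 fun u => (hd u).continuousAt
  have hca : Continuous fun u : ℝ => Real.arcsin (u / 2) :=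
    Real.continuous_arcsin.comp (by fun_prop)
  have hD : ∀ u, |u| < 2 → HasDerivAt (fun u => smoothedCdf μ v u - semicirclePrimitive u)
      ((∫ t, v / ((u - t) ^ 2 + v ^ 2) ∂μ - √(4 - u ^ 2) / 2) / Real.pi) u := fun u hu =>
    ((hd u).sub (hasDerivAt_semicirclePrimitive hu)).congr_deriv (by field_simp)
  have hmem : ∀ u ∈ interior (Set.Icc (-2 : ℝ) 2), |u| < 2 := fun u hu => by
    rw [interior_Icc] at hu; exact abs_lt.2 hu
  have hmono : MonotoneOn (fun u => (smoothedCdf μ v u - semicirclePrimitive u) +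
      c / Real.pi * Real.arcsin (u / 2)) (Set.Icc (-2) 2) := by
    refine monotoneOn_of_hasDerivWithinAt_nonneg (convex_Icc _ _)
      ((hcs.sub continuous_semicirclePrimitive).add (hca.const_mul _)).continuousOn
      (fun u hu => ((hD u (hmem u hu)).add
        ((hasDerivAt_arcsin_half (hmem u hu)).const_mul _)).hasDerivWithinAt) fun u hu => ?_
    have := (abs_le.1 (hc u (hmem u hu))).1
    rw [div_mul_eq_mul_div, ← add_div, ← div_eq_mul_inv]
    exact div_nonneg (by linarith) Real.pi_pos.le
  have hanti : AntitoneOn (fun u => (smoothedCdf μ v u - semicirclePrimitive u) -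
      c / Real.pi * Real.arcsin (u / 2)) (Set.Icc (-2) 2) := by
    refine antitoneOn_of_hasDerivWithinAt_nonpos (convex_Icc _ _)
      ((hcs.sub continuous_semicirclePrimitive).sub (hca.const_mul _)).continuousOn
      (fun u hu => ((hD u (hmem u hu)).sub
        ((hasDerivAt_arcsin_half (hmem u hu)).const_mul _)).hasDerivWithinAt) fun u hu => ?_
    have := (abs_le.1 (hc u (hmem u hu))).2
    rw [div_mul_eq_mul_div, ← sub_div, ← div_eq_mul_inv]
    exact div_nonpos_of_nonpos_of_nonneg (by linarith) Real.pi_pos.le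
  have m1 := hmono hx hy hxy
  have m2 := hanti hx hy hxy
  simp only at m1 m2
  have h3 : c / Real.pi * (Real.arcsin (y / 2) - Real.arcsin (x / 2)) ≤ c := by
    have : Real.arcsin (y / 2) - Real.arcsin (x / 2) ≤ Real.pi := by
      linarith [Real.arcsin_le_pi_div_two (y / 2), Real.neg_pi_div_two_le_arcsin (x / 2)]
    calc _ ≤ c / Real.pi * Real.pi := mul_le_mul_of_nonneg_left this (by positivity)
      _ = c := by field_simp
  rw [mul_sub] at h3
  exact abs_le.2 ⟨by linarith, by linarith⟩

/-- A smoothing inequality for the Kolmogorov distance to the semicircle law. -/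
theorem abs_cdf_sub_semicircle_le {v : ℝ} (hv : 0 < v) {b c : ℝ} (K : ℕ) (hK : 2 ^ K * v ≤ 1)
    (hb : ∀ u y : ℝ, 0 < y → y ≤ 1 → ∫ t, y / ((u - t) ^ 2 + y ^ 2) ∂μ ≤ b)
    (hc : ∀ u : ℝ, |u| < 2 → |∫ t, v / ((u - t) ^ 2 + v ^ 2) ∂μ - √(4 - u ^ 2) / 2| ≤
      c / √(4 - u ^ 2)) (x : ℝ) :
    |cdf μ x - cdf semicircleLaw x| ≤ 2 * (c + 2 * (2 * b * (K + 1) * v + (2 ^ K)⁻¹)) := by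
  set E := 2 * b * (K + 1) * v + (2 ^ K)⁻¹
  have key : ∀ {x y : ℝ}, x ∈ Set.Icc (-2 : ℝ) 2 → y ∈ Set.Icc (-2 : ℝ) 2 → x ≤ y →
      |(cdf μ y - cdf μ x) - (semicirclePrimitive y - semicirclePrimitive x)| ≤ c + 2 * E := by
    intro x y hx hy hxy
    have h1 := abs_le.1 (abs_smoothedCdf_sub_le hv hc hx hy hxy)
    have h2 := abs_le.1 (abs_cdf_sub_smoothedCdf_le hv K hK hb x)
    have h3 := abs_le.1 (abs_cdf_sub_smoothedCdf_le hv K hK hb y)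
    exact abs_le.2 ⟨by linarith [h1.1, h2.1, h2.2, h3.1, h3.2],
      by linarith [h1.2, h2.1, h2.2, h3.1, h3.2]⟩
  have m1 : (-2 : ℝ) ∈ Set.Icc (-2 : ℝ) 2 := by norm_num
  have m2 : (2 : ℝ) ∈ Set.Icc (-2 : ℝ) 2 := by norm_num
  have h22 := abs_le.1 (key m1 m2 (by norm_num))
  rw [semicirclePrimitive_neg_two, semicirclePrimitive_two] at h22
  have hl := cdf_nonneg μ (-2)
  have hr := cdf_le_one μ 2
  rcases le_total x (-2) with h | h
  · rw [cdf_semicircleLaw_of_le h, sub_zero, abs_of_nonneg (cdf_nonneg μ x)]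
    linarith [cdf_mono μ h]
  rcases le_total x 2 with h' | h'
  · have h4 := abs_le.1 (key m1 ⟨h, h'⟩ h)
    rw [semicirclePrimitive_neg_two] at h4
    rw [cdf_semicircleLaw_of_mem ⟨h, h'⟩]
    exact abs_le.2 ⟨by linarith, by linarith⟩
  · rw [cdf_semicircleLaw_of_two_le h', abs_sub_comm, abs_of_nonneg (by linarith [cdf_le_one μ x])]
    linarith [cdf_mono μ h']

end Smoothing

section RateForSums

open scoped ComplexOrder

variable {A : Type*} [CStarAlgebra A] [PartialOrder A] [StarOrderedRing A] {f : A →ₚ[ℂ] ℂ}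
  [Nontrivial A] {ι : Type*} [Fintype ι] [Nonempty ι]

lemma integral_poisson_eq {S : A} (hS : IsSelfAdjoint S) {μ : Measure ℝ}
    (hμ : ∀ h : ℝ → ℝ, Continuous h → ∫ t, h t ∂μ = (f (cfc h S)).re) (u : ℝ) {v : ℝ}
    (hv : 0 < v) :
    ∫ t, v / ((u - t) ^ 2 + v ^ 2) ∂μ = -(f (resolvent S (u + v * Complex.I))).im := by
  have him : ((u : ℂ) + v * Complex.I).im = v := by simp
  have hre : ((u : ℂ) + v * Complex.I).re = u := by simp
  have hne : ((u : ℂ) + v * Complex.I).im ≠ 0 := by rw [him]; exact hv.ne'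
  have hR := mul_resolvent (isUnit_sub_of_im_ne_zero hS hne)
  have hl := im_apply_of_mul_eq_one (f := f) hS hR
  have hl2 := l2_sq_eq (f := f) hS hne hR
  rw [him] at hl
  rw [him, hre] at hl2
  have hc : Continuous fun t : ℝ => ((u - t) ^ 2 + v ^ 2)⁻¹ :=
    Continuous.inv₀ (by fun_prop) fun t => by positivity
  rw [hl, hl2, ← hμ _ hc]
  simp only [div_eq_mul_inv, integral_const_mul]
  ring

/-- The distribution function of a sum of `n` free copies with variance `1 / n` and norm at most
`η` is close to that of the semicircle law. -/
theorem abs_cdf_sum_sub_semicircle_le (h1 : f 1 = 1)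
    (hf : ∀ x, f (star x * x) = 0 → x = 0) {Y : ι → A} (hsa : ∀ i, IsSelfAdjoint (Y i))
    (hfree : IsFreeFamily f.toLinearMap fun i => Algebra.adjoin ℂ {Y i})
    (hid : ∀ i j k, f (Y i ^ k) = f (Y j ^ k)) (h0 : ∀ i, f (Y i) = 0)
    {η n : ℝ} (hn : n = Fintype.card ι) (hn16 : 16 ≤ n) (hM : ∀ i, ‖Y i‖ ≤ η) (hη : η ≤ 1 / 4)
    (hs : ∀ i, l2 f (Y i) ^ 2 = n⁻¹) {μ : Measure ℝ} [IsProbabilityMeasure μ]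
    (hμ : ∀ h : ℝ → ℝ, Continuous h → ∫ t, h t ∂μ = (f (cfc h (∑ i, Y i))).re) (x : ℝ) :
    |cdf μ x - cdf semicircleLaw x| ≤ 40 * η + 80 * Real.log n / √n := by
  have hS := isSelfAdjoint_sum Finset.univ fun i _ => hsa i
  obtain ⟨i₀⟩ := ‹Nonempty ι›
  have : Nonempty ι := ⟨i₀⟩
  have hs' : ∀ i, l2 f (Y i) = √(n⁻¹) := fun i => by
    rw [← hs i, Real.sqrt_sq (l2_nonneg f _)]
  have est : ∀ z : ℂ, 0 < z.im → 0 < (subordination f (∑ i, Y i) n z).im ∧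
      ‖subordination f (∑ i, Y i) n z - (f (resolvent (∑ i, Y i) z))⁻¹‖ ≤ η / 2 ∧
      1 / 2 ≤ ‖(f (resolvent (∑ i, Y i) z))⁻¹‖ ∧
      ‖z - subordination f (∑ i, Y i) n z‖ ≤ 1 ∧
      ‖subordination f (∑ i, Y i) n z * subordination f (∑ i, Y i) n z -
        z * subordination f (∑ i, Y i) n z + 1‖ ≤ 2 * η := by
    intro z hz
    have hZ := hz.trans_le (im_le_im_subordination h1 hf hS (by linarith : 1 ≤ n) hz)
    have hG := apply_resolvent_subordination h1 hf hsa hfree hid h0 hM hs' i₀ hz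
    rw [← hn] at hG
    have hn0 : (n : ℂ) ≠ 0 := by exact_mod_cast (by linarith : n ≠ 0)
    refine ⟨hZ, subordination_estimates h1 hf (hsa i₀) (h0 i₀) hn16 (hs i₀) (hM i₀) hη hz hZ
      (by rw [hG]) ?_⟩
    rw [subordination, mul_div_cancel₀ _ hn0]
    ring
  have hb : ∀ u y : ℝ, 0 < y → y ≤ 1 → ∫ t, y / ((u - t) ^ 2 + y ^ 2) ∂μ ≤ 2 := by
    intro u y hy _
    rw [integral_poisson_eq hS hμ u hy]
    have h2 := (est (u + y * Complex.I) (by simpa using hy)).2.2.1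
    rw [norm_inv] at h2
    have h3 : 0 < ‖f (resolvent (∑ i, Y i) (u + y * Complex.I))‖ :=
      inv_pos.1 (by linarith)
    rw [le_inv_comm₀ (by norm_num) h3] at h2
    have h4 := Complex.abs_im_le_norm (f (resolvent (∑ i, Y i) (u + y * Complex.I)))
    linarith [neg_abs_le (f (resolvent (∑ i, Y i) (u + y * Complex.I))).im]
  have hsn : 4 ≤ √n := Real.le_sqrt_of_sq_le (by linarith)
  obtain ⟨K, hK1, hK2⟩ := exists_nat_pow_near (by linarith : 1 ≤ √n) (by norm_num : (1 : ℝ) < 2)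
  set v := (√n)⁻¹ with hv
  have hv0 : 0 < v := inv_pos.2 (by linarith)
  have hv1 : v ≤ 1 := inv_le_one_of_one_le₀ (by linarith)
  have hc : ∀ u : ℝ, |u| < 2 → |∫ t, v / ((u - t) ^ 2 + v ^ 2) ∂μ - √(4 - u ^ 2) / 2| ≤
      (20 * (η + v)) / √(4 - u ^ 2) := by
    intro u hu
    rw [integral_poisson_eq hS hμ u hv0]
    obtain ⟨e0, e1, e2, e3, e4⟩ := est (u + v * Complex.I) (by simpa using hv0)
    have := im_inv_sub_le hu hv0 hv1 rfl e0 e1 e2 e3 e4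
    rwa [inv_inv] at this
  have hKv : 2 ^ K * v ≤ 1 := by
    rw [hv, ← div_eq_mul_inv, div_le_one (by linarith)]; exact hK1
  refine (abs_cdf_sub_semicircle_le hv0 K hKv hb hc x).trans ?_
  have hKinv : ((2 : ℝ) ^ K)⁻¹ ≤ 2 * v := by
    rw [hv, ← div_eq_mul_inv, inv_le_comm₀ (by positivity) (by positivity), inv_div,
      div_le_iff₀ (by norm_num), ← pow_succ]
    exact hK2.le
  have hlog1 : 1 ≤ Real.log n := by
    rw [Real.le_log_iff_exp_le (by linarith)]
    linarith [Real.exp_one_lt_d9]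
  have hKlog : (K : ℝ) ≤ Real.log n := by
    have h2 := Real.log_le_log (by positivity) hK1
    rw [Real.log_pow, Real.log_sqrt (by linarith)] at h2
    have := Real.log_two_gt_d9
    nlinarith [(Nat.cast_nonneg K : (0 : ℝ) ≤ K)]
  have e : 80 * Real.log n / √n = 80 * (v * Real.log n) := by
    rw [hv]; ring
  rw [e]
  have h5 : v ≤ v * Real.log n := le_mul_of_one_le_right hv0.le hlog1
  have h6 : v * K ≤ v * Real.log n := mul_le_mul_of_nonneg_left hKlog hv0.le
  nlinarith

end RateForSums

section TraceMonotonicity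

open scoped ComplexOrder

variable {A : Type*} [CStarAlgebra A] [PartialOrder A] [StarOrderedRing A] {f : A →ₚ[ℂ] ℂ}

lemma exists_hasDerivAt_pow (htr : ∀ x y, f (x * y) = f (y * x)) {x : ℝ → A} {c : A} {t : ℝ}
    (hx : HasDerivAt x c t) (k : ℕ) :
    ∃ D, HasDerivAt (fun s => x s ^ k) D t ∧
      ∀ y, Commute y (x t) → f (y * D) = k * f (y * x t ^ (k - 1) * c) := by
  induction k with
  | zero => exact ⟨0, by simpa using hasDerivAt_const t (1 : A), by simp⟩
  | succ k ih =>
    obtain ⟨D, hD, hDf⟩ := ih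
    refine ⟨D * x t + x t ^ k * c, ?_, fun y hy => ?_⟩
    · have e : (fun s => x s ^ (k + 1)) = (fun s => x s ^ k) * x := by
        funext s
        simp [pow_succ]
      rw [e]
      exact hD.mul hx
    have h2 := hDf (y * x t) (hy.mul_left (Commute.refl _))
    have h3 : f (y * (D * x t)) = f (y * x t * D) := by
      rw [← mul_assoc, htr, ← mul_assoc, ← hy.eq]
    rw [mul_add, map_add, h3, h2, ← mul_assoc, Nat.add_sub_cancel]
    rcases k with _ | k
    · simp
    · rw [Nat.add_sub_cancel, mul_assoc y, ← pow_succ']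
      push_cast
      ring

lemma hasDerivAt_apply_aeval (h1 : f 1 = 1) (htr : ∀ x y, f (x * y) = f (y * x)) {x : ℝ → A} {c : A}
    {t : ℝ} (hx : HasDerivAt x c t) (p : Polynomial ℝ) :
    HasDerivAt (fun s => f (Polynomial.aeval (x s) p))
      (f (Polynomial.aeval (x t) p.derivative * c)) t := by
  induction p using Polynomial.induction_on' with
  | add p q hp hq =>
    simp only [map_add, add_mul]
    exact hp.add hq
  | monomial k r =>
    obtain ⟨D, hD, hDf⟩ := exists_hasDerivAt_pow htr hx k
    let fL : A →L[ℂ] ℂ := ⟨f.toLinearMap, continuous_apply h1⟩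
    have h2 := (((fL.restrictScalars ℝ).hasFDerivAt.comp_hasDerivAt t (hD.const_smul r)))
    have h3 : f D = k * f (x t ^ (k - 1) * c) := by simpa using hDf 1 (Commute.one_left _)
    have hr : ∀ (r : ℝ) (y : A), f (r • y) = r * f y := fun r y => by
      rw [← Complex.coe_smul, map_smul, smul_eq_mul]
    have e1 : (fun s => f (Polynomial.aeval (x s) (Polynomial.monomial k r))) =
        (fL.restrictScalars ℝ) ∘ (r • fun s => x s ^ k) := by
      funext s
      simp only [Polynomial.aeval_monomial, Function.comp_apply, Pi.smul_apply,
        Algebra.algebraMap_eq_smul_one, smul_mul_assoc, one_mul]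
      rfl
    rw [e1]
    refine h2.congr_deriv ?_
    have e2 : (fL.restrictScalars ℝ) (r • D) = f (r • D) := rfl
    rw [e2, Polynomial.derivative_monomial, Polynomial.aeval_monomial, hr, h3,
      Algebra.algebraMap_eq_smul_one, smul_mul_assoc, smul_mul_assoc, one_mul, hr]
    push_cast
    ring

lemma re_apply_mul_nonneg (htr : ∀ x y, f (x * y) = f (y * x)) {y c : A} (hy : 0 ≤ y)
    (hc : 0 ≤ c) : 0 ≤ (f (y * c)).re := by
  obtain ⟨s, rfl⟩ := CStarAlgebra.nonneg_iff_eq_star_mul_self.1 hy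
  rw [mul_assoc, htr]
  exact re_apply_nonneg (star_right_conjugate_nonneg hc s)

variable [Nontrivial A]

lemma re_apply_aeval_le (h1 : f 1 = 1) (htr : ∀ x y, f (x * y) = f (y * x)) {a b : A}
    (ha : IsSelfAdjoint a) (hb : IsSelfAdjoint b) (hab : a ≤ b) {B : ℝ} (haB : ‖a‖ ≤ B)
    (hbB : ‖b‖ ≤ B) {p : Polynomial ℝ}
    (hp : ∀ t ∈ Set.Icc (-B) B, 0 ≤ p.derivative.eval t) :
    (f (Polynomial.aeval a p)).re ≤ (f (Polynomial.aeval b p)).re := by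
  have hx : ∀ t : ℝ, HasDerivAt (fun s : ℝ => a + s • (b - a)) (b - a) t := fun t => by
    simpa using ((hasDerivAt_id t).smul_const (b - a)).const_add a
  have hd : ∀ t : ℝ, HasDerivAt (fun s : ℝ => (f (Polynomial.aeval (a + s • (b - a)) p)).re)
      (f (Polynomial.aeval (a + t • (b - a)) p.derivative * (b - a))).re t := fun t =>
    Complex.reCLM.hasFDerivAt.comp_hasDerivAt t (hasDerivAt_apply_aeval h1 htr (hx t) p)
  have hmono : MonotoneOn (fun s : ℝ => (f (Polynomial.aeval (a + s • (b - a)) p)).re)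
      (Set.Icc 0 1) := by
    refine monotoneOn_of_hasDerivWithinAt_nonneg (convex_Icc 0 1)
      (fun t _ => (hd t).continuousAt.continuousWithinAt)
      (fun t _ => (hd t).hasDerivWithinAt) fun t ht => ?_
    rw [interior_Icc] at ht
    have hsa : IsSelfAdjoint (a + t • (b - a)) := ha.add ((IsSelfAdjoint.all t).smul (hb.sub ha))
    refine re_apply_mul_nonneg htr ?_ (sub_nonneg.2 hab)
    rw [← cfc_polynomial p.derivative _ hsa]
    refine cfc_nonneg fun u hu => hp u (spectrum_subset_Icc ?_ hu)
    have e : a + t • (b - a) = (1 - t) • a + t • b := by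
      rw [smul_sub, sub_smul, one_smul]; abel
    rw [e]
    calc _ ≤ ‖(1 - t) • a‖ + ‖t • b‖ := norm_add_le _ _
      _ ≤ (1 - t) * B + t * B := by
        rw [norm_smul, norm_smul, Real.norm_of_nonneg (by linarith [ht.2]),
          Real.norm_of_nonneg ht.1.le]
        have := ht.1
        have := ht.2
        gcongr
      _ = B := by ring
  simpa using hmono (Set.left_mem_Icc.2 zero_le_one) (Set.right_mem_Icc.2 zero_le_one) zero_le_one

lemma exists_derivative_eq (q : Polynomial ℝ) (r : ℝ) :
    ∃ p : Polynomial ℝ, p.derivative = q ∧ p.eval 0 = r := by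
  obtain ⟨p, hp⟩ : ∃ p : Polynomial ℝ, p.derivative = q := by
    induction q using Polynomial.induction_on' with
    | add p q hp hq =>
      obtain ⟨p', rfl⟩ := hp
      obtain ⟨q', rfl⟩ := hq
      exact ⟨p' + q', by simp⟩
    | monomial k r =>
      refine ⟨Polynomial.monomial (k + 1) (r / (k + 1)), ?_⟩
      rw [Polynomial.derivative_monomial, Nat.add_sub_cancel]
      push_cast
      rw [div_mul_cancel₀ _ (by positivity)]
  exact ⟨p - Polynomial.C (p.eval 0) + Polynomial.C r, by simp [hp], by simp⟩

/-- Monotonicity of `a ↦ φ(h(a))` for a trace `φ` and increasing `h`. -/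
theorem re_apply_cfc_le (h1 : f 1 = 1) (htr : ∀ x y, f (x * y) = f (y * x)) {a b : A}
    (ha : IsSelfAdjoint a) (hb : IsSelfAdjoint b) (hab : a ≤ b) {h : ℝ → ℝ}
    (hh : ContDiff ℝ 1 h) (hm : Monotone h) : (f (cfc h a)).re ≤ (f (cfc h b)).re := by
  set B := max ‖a‖ ‖b‖ with hB
  have hB0 : 0 ≤ B := (norm_nonneg a).trans (le_max_left _ _)
  refine le_of_forall_pos_le_add fun ε hε => ?_
  set δ := ε / (4 * (B + 1)) with hδ
  have hδ0 : 0 < δ := by positivity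
  obtain ⟨q, hq⟩ := exists_polynomial_near_of_continuousOn (-B) B (deriv h)
    (hh.continuous_deriv le_rfl).continuousOn δ hδ0
  obtain ⟨p, hp, hp0⟩ := exists_derivative_eq (q + Polynomial.C δ) (h 0)
  have hpos : ∀ t ∈ Set.Icc (-B) B, 0 ≤ p.derivative.eval t := fun t ht => by
    have h2 := (abs_lt.1 (hq t ht)).1
    have h3 : 0 ≤ deriv h t := hm.deriv_nonneg
    rw [hp, Polynomial.eval_add, Polynomial.eval_C]
    linarith
  have hclose : ∀ t ∈ Set.Icc (-B) B, |p.eval t - h t| ≤ ε / 2 := fun t ht => by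
    have h2 := (convex_Icc (-B) B).norm_image_sub_le_of_norm_hasDerivWithin_le
      (f := fun t => p.eval t - h t) (f' := fun t => p.derivative.eval t - deriv h t) (C := 2 * δ)
      (fun s _ => ((p.hasDerivAt s).sub
        ((hh.differentiable one_ne_zero) s).hasDerivAt).hasDerivWithinAt)
      (fun s hs => by
        have := abs_lt.1 (hq s hs)
        rw [hp, Polynomial.eval_add, Polynomial.eval_C, Real.norm_eq_abs]
        exact abs_le.2 ⟨by linarith, by linarith⟩)
      (⟨by linarith, hB0⟩ : (0 : ℝ) ∈ Set.Icc (-B) B) ht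
    simp only [hp0, sub_self, sub_zero, Real.norm_eq_abs] at h2
    refine h2.trans ?_
    have h3 : |t| ≤ B := abs_le.2 ht
    calc 2 * δ * |t| ≤ 2 * δ * (B + 1) := by gcongr; linarith
      _ = ε / 2 := by rw [hδ]; field_simp; norm_num
  have e1 := abs_le.1 (abs_apply_cfc_sub_le (f := f) h1 ha (le_max_left ‖a‖ ‖b‖) (by positivity)
    p.continuous hh.continuous hclose)
  have e2 := abs_le.1 (abs_apply_cfc_sub_le (f := f) h1 hb (le_max_right ‖a‖ ‖b‖) (by positivity)
    p.continuous hh.continuous hclose)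
  rw [cfc_polynomial p a ha] at e1
  rw [cfc_polynomial p b hb] at e2
  have := re_apply_aeval_le h1 htr ha hb hab (le_max_left ‖a‖ ‖b‖) (le_max_right ‖a‖ ‖b‖) hpos
  linarith [e1.1, e2.2]

variable {μ ν : Measure ℝ} [IsProbabilityMeasure μ] [IsProbabilityMeasure ν]

lemma cdf_le_cdf_add (h1 : f 1 = 1) (htr : ∀ x y, f (x * y) = f (y * x)) {a b : A}
    (ha : IsSelfAdjoint a) (hb : IsSelfAdjoint b)
    (hμ : ∀ h : ℝ → ℝ, Continuous h → ∫ t, h t ∂μ = (f (cfc h a)).re)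
    (hν : ∀ h : ℝ → ℝ, Continuous h → ∫ t, h t ∂ν = (f (cfc h b)).re)
    {ε : ℝ} (hε : 0 < ε) (hab : ‖a - b‖ ≤ ε) (x : ℝ) : cdf μ x ≤ cdf ν (x + 2 * ε) := by
  set h : ℝ → ℝ := fun t => Real.smoothTransition ((t - x - ε) / ε) with hdef
  have hc : ContDiff ℝ 1 h := Real.smoothTransition.contDiff.comp (by fun_prop)
  have hmono : Monotone h := fun s t hst => Real.smoothTransition.monotone (by gcongr)
  have hle : b ≤ a + algebraMap ℝ A ε := by
    have h2 : b - a ≤ algebraMap ℝ A ‖b - a‖ := (hb.sub ha).le_algebraMap_norm_self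
    rw [norm_sub_rev] at h2
    have h3 : algebraMap ℝ A ‖a - b‖ ≤ algebraMap ℝ A ε := algebraMap_mono A hab
    calc b = a + (b - a) := by abel
      _ ≤ _ := by gcongr; exact h2.trans h3
  have hsa : IsSelfAdjoint (a + algebraMap ℝ A ε) := ha.add (IsSelfAdjoint.algebraMap A (.all ε))
  have key := re_apply_cfc_le h1 htr hb hsa hle hc hmono
  have e : cfc h (a + algebraMap ℝ A ε) = cfc (fun t => h (t + ε)) a := by
    rw [cfc_comp' h (fun t => t + ε) a hc.continuous.continuousOn (by fun_prop) ha,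
      cfc_add_const ε (fun t => t) a (by fun_prop) ha, cfc_id' ℝ a ha]
  rw [e, ← hν h hc.continuous, ← hμ (fun t => h (t + ε)) (hc.continuous.comp (by fun_prop))] at key
  have hbdd : ∀ t, ‖h t‖ ≤ 1 := fun t => by
    rw [Real.norm_of_nonneg (Real.smoothTransition.nonneg _)]
    exact Real.smoothTransition.le_one _
  have hind : ∀ (m : Measure ℝ) [IsProbabilityMeasure m] (y : ℝ),
      cdf m y = 1 - ∫ t, (Set.Ioi y).indicator (fun _ => (1 : ℝ)) t ∂m := fun m _ y => by
    rw [integral_indicator measurableSet_Ioi, setIntegral_const, smul_eq_mul, mul_one, cdf,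
      ← Set.compl_Iic, probReal_compl_eq_one_sub measurableSet_Iic, measureReal_def]
    ring
  rw [hind μ x, hind ν]
  have i1 : ∫ t, (Set.Ioi (x + 2 * ε)).indicator (fun _ => (1 : ℝ)) t ∂ν ≤ ∫ t, h t ∂ν := by
    refine integral_mono ((integrable_const _).indicator measurableSet_Ioi)
      (Integrable.of_bound hc.continuous.aestronglyMeasurable 1 (ae_of_all _ hbdd)) fun t => ?_
    refine Set.indicator_apply_le' (fun ht => ?_) fun _ => Real.smoothTransition.nonneg _
    rw [hdef]
    refine (Real.smoothTransition.one_of_one_le ?_).ge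
    rw [le_div_iff₀ hε]
    linarith [Set.mem_Ioi.1 ht]
  have i2 : ∫ t, h (t + ε) ∂μ ≤ ∫ t, (Set.Ioi x).indicator (fun _ => (1 : ℝ)) t ∂μ := by
    refine integral_mono (Integrable.of_bound
      (hc.continuous.comp (by fun_prop)).aestronglyMeasurable 1 (ae_of_all _ fun t => hbdd _))
      ((integrable_const _).indicator measurableSet_Ioi) fun t => ?_
    by_cases ht : x < t
    · rw [Set.indicator_of_mem (Set.mem_Ioi.2 ht)]
      exact Real.smoothTransition.le_one _
    · rw [Set.indicator_of_notMem (fun h' : t ∈ Set.Ioi x => ht h')]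
      refine (Real.smoothTransition.zero_of_nonpos ?_).le
      exact div_nonpos_of_nonpos_of_nonneg (by linarith) hε.le
  linarith

/-- Stability under small perturbations of the distance to the semicircle law. -/
theorem abs_cdf_sub_semicircle_le_of_norm_sub_le (h1 : f 1 = 1)
    (htr : ∀ x y, f (x * y) = f (y * x)) {a b : A}
    (ha : IsSelfAdjoint a) (hb : IsSelfAdjoint b)
    (hμ : ∀ h : ℝ → ℝ, Continuous h → ∫ t, h t ∂μ = (f (cfc h a)).re)
    (hν : ∀ h : ℝ → ℝ, Continuous h → ∫ t, h t ∂ν = (f (cfc h b)).re)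
    {ε D : ℝ} (hε : 0 < ε) (hab : ‖a - b‖ ≤ ε)
    (hD : ∀ x, |cdf ν x - cdf semicircleLaw x| ≤ D) (x : ℝ) :
    |cdf μ x - cdf semicircleLaw x| ≤ D + ε := by
  have k1 := cdf_le_cdf_add h1 htr ha hb hμ hν hε hab x
  have k2 := cdf_le_cdf_add h1 htr hb ha hν hμ hε (by rwa [norm_sub_rev]) (x - 2 * ε)
  rw [sub_add_cancel] at k2
  have d1 := abs_le.1 (hD (x + 2 * ε))
  have d2 := abs_le.1 (hD (x - 2 * ε))
  have l1 := cdf_semicircleLaw_sub_le (by linarith : x ≤ x + 2 * ε)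
  have l2 := cdf_semicircleLaw_sub_le (by linarith : x - 2 * ε ≤ x)
  have hpi : 2 * ε / Real.pi ≤ ε := by
    rw [div_le_iff₀ Real.pi_pos]
    nlinarith [Real.pi_gt_three]
  rw [add_sub_cancel_left] at l1
  rw [sub_sub_cancel] at l2
  exact abs_le.2 ⟨by linarith [d2.1], by linarith [d1.2]⟩

end TraceMonotonicity

section NormComparison

open scoped ComplexOrder

variable {A : Type*} [CStarAlgebra A] [PartialOrder A] [StarOrderedRing A] {f : A →ₚ[ℂ] ℂ}
  [Nontrivial A]

lemma norm_sq_sub_one_le {x : A} (hx : IsSelfAdjoint x) {L : ℝ} (hL : 1 ≤ L) (hxL : ‖x‖ ≤ L) :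
    ‖x ^ 2 - 1‖ ≤ L ^ 2 := by
  have e : x ^ 2 - 1 = cfc (fun t : ℝ => t ^ 2 - 1) x := by
    rw [cfc_sub (fun t : ℝ => t ^ 2) (fun _ => 1) x, cfc_pow_id x 2, cfc_const_one ℝ x]
  rw [e]
  refine norm_cfc_le (by positivity) fun t ht => ?_
  have h := spectrum_subset_Icc hxL ht
  have h2 : t ^ 2 ≤ L ^ 2 := sq_le_sq' h.1 h.2
  rw [Real.norm_eq_abs, abs_le]
  constructor <;> nlinarith [sq_nonneg t]

lemma apply_aeval_eq_of_moments {x y : A} (h : ∀ k : ℕ, f (x ^ k) = f (y ^ k))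
    (p : Polynomial ℂ) : f (Polynomial.aeval x p) = f (Polynomial.aeval y p) := by
  simp only [Polynomial.aeval_eq_sum_range, map_sum, map_smul, h]

lemma l2_sq_sub_one_sq (h1 : f 1 = 1) {x : A} (hx : IsSelfAdjoint x) (h2 : f (x ^ 2) = 1) :
    l2 f (x ^ 2 - 1) ^ 2 = (f (x ^ 4)).re - 1 := by
  have e : star (x ^ 2 - 1) * (x ^ 2 - 1) = x ^ 4 - x ^ 2 - x ^ 2 + 1 := by
    rw [((hx.pow 2).sub (IsSelfAdjoint.one A)).star_eq]
    noncomm_ring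
  rw [l2_sq, e, map_add, map_sub, map_sub, h1, h2]
  simp

lemma l2_sq_sub_one_le (h1 : f 1 = 1) {x : A} (hx : IsSelfAdjoint x) (h2 : f (x ^ 2) = 1)
    {L : ℝ} (hxL : ‖x‖ ≤ L) : l2 f (x ^ 2 - 1) ≤ L := by
  have hL : 0 ≤ L := (norm_nonneg _).trans hxL
  have l1 : l2 f x = 1 := by
    have : l2 f x ^ 2 = 1 := by rw [l2_sq, hx.star_eq, ← sq, h2, Complex.one_re]
    exact (pow_eq_one_iff_of_nonneg (l2_nonneg f _) two_ne_zero).1 this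
  have l3 : l2 f (x ^ 2) ≤ L := by
    rw [sq]
    refine (l2_mul_le f x x).trans ?_
    rwa [l1, mul_one]
  have l4 : l2 f (x ^ 2) ^ 2 = (f (x ^ 4)).re := by
    rw [l2_sq, (hx.pow 2).star_eq, ← pow_add]
  refine le_of_sq_le_sq ?_ hL
  rw [l2_sq_sub_one_sq h1 hx h2, ← l4]
  have := pow_le_pow_left₀ (l2_nonneg f (x ^ 2)) l3 2
  linarith

variable {ι : Type*} [Fintype ι] [Nonempty ι]

lemma norm_sum_sq_sub_le (h1 : f 1 = 1) (hf : ∀ x, f (star x * x) = 0 → x = 0) {X : ι → A}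
    (hsa : ∀ i, IsSelfAdjoint (X i))
    (hfree : IsFreeFamily f.toLinearMap fun i => Algebra.adjoin ℂ {X i})
    (hid : ∀ i j (k : ℕ), f (X i ^ k) = f (X j ^ k)) (h2 : ∀ i, f (X i ^ 2) = 1)
    {L : ℝ} (hL : 1 ≤ L) (hXL : ∀ i, ‖X i‖ ≤ L) :
    ‖∑ i, X i ^ 2 - algebraMap ℂ A (Fintype.card ι)‖ ≤
      L ^ 2 + 2 * L * √(Fintype.card ι) := by
  let i0 : ι := Classical.arbitrary ι
  have hfree' : IsFreeFamily f.toLinearMap fun i => Algebra.adjoin ℂ {X i ^ 2 - 1} := by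
    refine isFreeFamily_mono (fun i => Algebra.adjoin_le ?_) hfree
    rw [Set.singleton_subset_iff]
    exact sub_mem (pow_mem (Algebra.self_mem_adjoin_singleton ℂ _) 2) (one_mem _)
  have hid' : ∀ i j (k : ℕ), f ((X i ^ 2 - 1) ^ k) = f ((X j ^ 2 - 1) ^ k) := by
    intro i j k
    have e : ∀ i, (X i ^ 2 - 1) ^ k =
        Polynomial.aeval (X i) ((Polynomial.X ^ 2 - 1 : Polynomial ℂ) ^ k) := fun i => by
      rw [map_pow, map_sub, map_pow, Polynomial.aeval_X, map_one]
    rw [e, e]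
    exact apply_aeval_eq_of_moments (hid i j) _
  have key := FreeCLT.norm_sum_le h1 hf (fun i => ((hsa i).pow 2).sub (IsSelfAdjoint.one A)) hfree' hid'
    (fun i => by rw [map_sub, h2, h1, sub_self])
    (fun i => norm_sq_sub_one_le (hsa i) hL (hXL i)) (s := l2 f (X i0 ^ 2 - 1))
    (fun i => by
      refine (pow_left_inj₀ (l2_nonneg f _) (l2_nonneg f _) two_ne_zero).1 ?_
      rw [l2_sq_sub_one_sq h1 (hsa _) (h2 _), l2_sq_sub_one_sq h1 (hsa _) (h2 _), hid i i0])
  have e : ∑ i, X i ^ 2 - algebraMap ℂ A (Fintype.card ι) = ∑ i, (X i ^ 2 - 1) := by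
    simp [Finset.sum_sub_distrib]
  rw [e]
  refine key.trans ?_
  gcongr
  exact l2_sq_sub_one_le h1 (hsa _) (h2 _) (hXL _)

lemma norm_sum_le_of_variance_one (h1 : f 1 = 1) (hf : ∀ x, f (star x * x) = 0 → x = 0)
    {X : ι → A} (hsa : ∀ i, IsSelfAdjoint (X i))
    (hfree : IsFreeFamily f.toLinearMap fun i => Algebra.adjoin ℂ {X i})
    (hid : ∀ i j (k : ℕ), f (X i ^ k) = f (X j ^ k)) (h0 : ∀ i, f (X i) = 0)
    (h2 : ∀ i, f (X i ^ 2) = 1) {L : ℝ} (hXL : ∀ i, ‖X i‖ ≤ L) :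
    ‖∑ i, X i‖ ≤ L + 2 * √(Fintype.card ι) := by
  have := FreeCLT.norm_sum_le h1 hf hsa hfree hid h0 hXL (s := 1) fun i => by
    refine (pow_eq_one_iff_of_nonneg (l2_nonneg f _) two_ne_zero).1 ?_
    rw [l2_sq, (hsa i).star_eq, ← sq, h2, Complex.one_re]
  simpa using this

lemma sum_ne_zero_of_variance_one {X : ι → A}
    (hfree : IsFreeFamily f.toLinearMap fun i => Algebra.adjoin ℂ {X i})
    (h0 : ∀ i, f (X i) = 0) (h2 : ∀ i, f (X i ^ 2) = 1) : ∑ i, X i ≠ 0 := by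
  intro h
  let i : ι := Classical.arbitrary ι
  have h3 : f (X i * ∑ j, X j) = 1 := by
    rw [Finset.mul_sum, map_sum, Finset.sum_eq_single i, ← sq, h2]
    · intro j _ hj
      have := hfree 1 ![i, j] (fun k => by fin_cases k; simpa using hj.symm) ![X i, X j]
        (fun k => by fin_cases k <;> exact Algebra.self_mem_adjoin_singleton ℂ _)
        (fun k => by fin_cases k <;> exact h0 _)
      simpa using this
    · simp
  rw [h] at h3
  simp at h3

end NormComparison

section InverseRoots

variable {A : Type*} [CStarAlgebra A] [PartialOrder A] [StarOrderedRing A] [Nontrivial A]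

lemma norm_le_of_mul_eq_one_of_norm_sub_one_le {r v : A} (hrv : r * v = 1) {δ : ℝ} (hδ : δ < 1)
    (hv : ‖v - 1‖ ≤ δ) : ‖r‖ ≤ (1 - δ)⁻¹ ∧ ‖r - 1‖ ≤ δ * (1 - δ)⁻¹ := by
  have e : r - 1 = -(r * (v - 1)) := by rw [mul_sub, hrv, mul_one, neg_sub]
  have h3 : ‖r - 1‖ ≤ ‖r‖ * δ := by
    rw [e, norm_neg]
    exact (norm_mul_le _ _).trans (by gcongr)
  have h4 : ‖r‖ ≤ ‖r - 1‖ + 1 := by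
    simpa using norm_add_le (r - 1) 1
  have h5 : ‖r‖ ≤ (1 - δ)⁻¹ := by
    rw [inv_eq_one_div, le_div_iff₀ (by linarith)]
    linarith
  refine ⟨h5, h3.trans ?_⟩
  rw [mul_comm δ]
  exact mul_le_mul_of_nonneg_right h5 ((norm_nonneg _).trans hv)

lemma norm_sub_one_le_norm_pow_four_sub_one {w : A} (hw : 0 ≤ w) : ‖w - 1‖ ≤ ‖w ^ 4 - 1‖ := by
  have hsa : IsSelfAdjoint w := hw.isSelfAdjoint
  have e1 : w - 1 = cfc (fun t : ℝ => t - 1) w := by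
    rw [cfc_sub (fun t : ℝ => t) (fun _ => 1) w, cfc_id' ℝ w, cfc_const_one ℝ w]
  have e4 : w ^ 4 - 1 = cfc (fun t : ℝ => t ^ 4 - 1) w := by
    rw [cfc_sub (fun t : ℝ => t ^ 4) (fun _ => 1) w, cfc_pow_id w 4, cfc_const_one ℝ w]
  rw [e1]
  refine norm_cfc_le (norm_nonneg _) fun t ht => ?_
  have ht0 : 0 ≤ t := spectrum_nonneg_of_nonneg hw ht
  refine le_trans ?_ (e4 ▸ norm_apply_le_norm_cfc (fun t : ℝ => t ^ 4 - 1) w ht)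
  have e : t ^ 4 - 1 = (t - 1) * (1 + (t + t ^ 2 + t ^ 3)) := by ring
  rw [e, norm_mul]
  refine le_mul_of_one_le_right (norm_nonneg _) ?_
  have : 0 ≤ t + t ^ 2 + t ^ 3 := by positivity
  rw [Real.norm_of_nonneg (by linarith)]
  linarith

lemma norm_pow_four {w : A} (hw : IsSelfAdjoint w) : ‖w ^ 4‖ = ‖w‖ ^ 4 := by
  have e : w ^ 4 = w * w * (w * w) := by noncomm_ring
  have h2 : ∀ x : A, IsSelfAdjoint x → ‖x * x‖ = ‖x‖ * ‖x‖ := fun x hx => by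
    conv_lhs => rw [← hx.star_eq]
    rw [hx.star_eq]
    simpa [hx.star_eq] using CStarRing.norm_star_mul_self (x := x)
  rw [e, h2 _ (by simpa [sq] using hw.pow 2), h2 _ hw]
  ring

/-- Perturbation of the conjugation by an inverse fourth root of an element close to `1`. -/
lemma norm_conj_sub_le {w v T : A} (hw : 0 ≤ w) (hwv : w ^ 4 * v = 1) {δ τ : ℝ} (hδ : δ < 1)
    (hv : ‖v - 1‖ ≤ δ) (hT : ‖T‖ ≤ τ) :
    ‖w * T * w‖ ≤ τ * (1 - δ)⁻¹ ∧
      ‖w * T * w - T‖ ≤ δ * (1 - δ)⁻¹ * τ * (2 + δ * (1 - δ)⁻¹) := by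
  obtain ⟨h3, h4⟩ := norm_le_of_mul_eq_one_of_norm_sub_one_le hwv hδ hv
  have hδ0 : 0 ≤ δ := (norm_nonneg _).trans hv
  have hτ : 0 ≤ τ := (norm_nonneg _).trans hT
  have hw1 : ‖w - 1‖ ≤ δ * (1 - δ)⁻¹ := (norm_sub_one_le_norm_pow_four_sub_one hw).trans h4
  have h5 : 1 ≤ (1 - δ)⁻¹ := one_le_inv_iff₀.2 ⟨by linarith, by linarith⟩
  rw [norm_pow_four hw.isSelfAdjoint] at h3
  have h6 : ‖w‖ ^ 2 ≤ (1 - δ)⁻¹ := by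
    refine le_of_sq_le_sq ?_ (by linarith)
    nlinarith
  have h7 : ‖w‖ ≤ 1 + δ * (1 - δ)⁻¹ := by
    have : ‖w‖ ≤ ‖w - 1‖ + 1 := by simpa using norm_add_le (w - 1) 1
    linarith
  constructor
  · calc ‖w * T * w‖ ≤ ‖w * T‖ * ‖w‖ := norm_mul_le _ _
      _ ≤ ‖w‖ * ‖T‖ * ‖w‖ := by gcongr; exact norm_mul_le _ _
      _ = ‖T‖ * ‖w‖ ^ 2 := by ring
      _ ≤ τ * (1 - δ)⁻¹ := by gcongr
  · have e : w * T * w - T = (w - 1) * T * w + T * (w - 1) := by noncomm_ring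
    rw [e]
    calc _ ≤ ‖(w - 1) * T * w‖ + ‖T * (w - 1)‖ := norm_add_le _ _
      _ ≤ ‖w - 1‖ * ‖T‖ * ‖w‖ + ‖T‖ * ‖w - 1‖ := by
        gcongr
        · exact (norm_mul_le _ _).trans (by gcongr; exact norm_mul_le _ _)
        · exact norm_mul_le _ _
      _ = ‖w - 1‖ * ‖T‖ * (‖w‖ + 1) := by ring
      _ ≤ δ * (1 - δ)⁻¹ * τ * (2 + δ * (1 - δ)⁻¹) := by
        have : 0 ≤ δ * (1 - δ)⁻¹ := by positivity
        refine mul_le_mul (mul_le_mul hw1 hT (norm_nonneg _) this) (by linarith)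
          (by positivity) (by positivity)

/-- Existence of inverse fourth roots near positive multiples of the identity. -/
lemma exists_inverse_fourth_root {V : A} (hV : 0 ≤ V) (hu : IsUnit V) :
    ∃ W : A, 0 ≤ W ∧ W ^ 4 * V = 1 ∧ V * W ^ 4 = 1 := by
  have hp : IsStrictlyPositive V := hu.isStrictlyPositive hV
  have e : (V ^ (-(1 / 4) : ℝ)) ^ 4 = V ^ (-1 : ℝ) := by
    rw [← CFC.rpow_natCast _ 4 CFC.rpow_nonneg, CFC.rpow_rpow V _ _ (by norm_num) hp]
    norm_num
  refine ⟨V ^ (-(1 / 4) : ℝ), CFC.rpow_nonneg, ?_, ?_⟩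
  · rw [e]
    simpa [CFC.rpow_one V hV] using CFC.rpow_neg_mul_rpow (a := V) 1 hp
  · rw [e]
    simpa [CFC.rpow_one V hV] using CFC.rpow_mul_rpow_neg (a := V) 1 hp

end InverseRoots

section WeakConvergence

lemma measureReal_Ioc_eq (μ : Measure ℝ) [IsFiniteMeasure μ] {a b : ℝ} (hab : a ≤ b) :
    (μ (Set.Ioc a b)).toReal = cdf μ b - cdf μ a := by
  have h := measureReal_sdiff (μ := μ) (Set.Iic_subset_Iic.2 hab) measurableSet_Iic
  rw [Set.Iic_sdiff_Iic] at h
  exact h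

lemma tendsto_probabilityMeasure_of_tendsto_cdf {μ : ℕ → ProbabilityMeasure ℝ}
    {ν : ProbabilityMeasure ℝ}
    (h : ∀ x, Tendsto (fun n => cdf (μ n : Measure ℝ) x) atTop (𝓝 (cdf (ν : Measure ℝ) x))) :
    Tendsto μ atTop (𝓝 ν) := by
  refine IsPiSystem.tendsto_probabilityMeasure_of_tendsto_of_mem
    (S := {s | ∃ a b, a < b ∧ Set.Ioc a b = s}) ?_ ?_ ?_ ?_
  · simpa using isPiSystem_Ioc (id : ℝ → ℝ) id
  · rintro s ⟨a, b, -, rfl⟩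
    exact measurableSet_Ioc
  · intro u hu x hx
    obtain ⟨ε, hε, hb⟩ := Metric.isOpen_iff.1 hu x hx
    refine ⟨Set.Ioc (x - ε / 2) (x + ε / 2), ⟨_, _, by linarith, rfl⟩,
      Ioc_mem_nhds (by linarith) (by linarith), fun y hy => hb ?_⟩
    rw [Metric.mem_ball, Real.dist_eq, abs_lt]
    constructor <;> linarith [hy.1, hy.2]
  · rintro s ⟨a, b, hab, rfl⟩
    rw [← NNReal.tendsto_coe]
    have e : ∀ ρ : ProbabilityMeasure ℝ, ((ρ (Set.Ioc a b) : NNReal) : ℝ) =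
        cdf (ρ : Measure ℝ) b - cdf (ρ : Measure ℝ) a :=
      fun ρ => measureReal_Ioc_eq (ρ : Measure ℝ) hab.le
    simp only [e]
    exact (h b).sub (h a)

lemma tendsto_integral_of_tendsto_cdf {μ : ℕ → Measure ℝ}
    {ν : Measure ℝ} [IsProbabilityMeasure ν] (hμ : ∀ᶠ n in atTop, IsProbabilityMeasure (μ n))
    (h : ∀ x, Tendsto (fun n => cdf (μ n) x) atTop (𝓝 (cdf ν x)))
    (g : BoundedContinuousFunction ℝ ℝ) :
    Tendsto (fun n => ∫ x, g x ∂μ n) atTop (𝓝 (∫ x, g x ∂ν)) := by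
  classical
  let P : ℕ → ProbabilityMeasure ℝ := fun n =>
    if hn : IsProbabilityMeasure (μ n) then ⟨μ n, hn⟩ else ⟨ν, inferInstance⟩
  have hP : ∀ᶠ n in atTop, (P n : Measure ℝ) = μ n := hμ.mono fun n hn => by
    have : P n = ⟨μ n, hn⟩ := dif_pos hn
    rw [this]
    rfl
  have key := tendsto_probabilityMeasure_of_tendsto_cdf (μ := P) (ν := ⟨ν, inferInstance⟩)
    fun x => (h x).congr' (hP.mono fun n hn => by simp only [hn])
  have := ProbabilityMeasure.tendsto_iff_forall_integral_tendsto.1 key g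
  exact this.congr' (hP.mono fun n hn => by simp only [hn])

lemma tendsto_integral_pow_of_tendsto_cdf {μ : ℕ → Measure ℝ}
    {ν : Measure ℝ} [IsProbabilityMeasure ν] (hμ : ∀ᶠ n in atTop, IsProbabilityMeasure (μ n))
    (h : ∀ x, Tendsto (fun n => cdf (μ n) x) atTop (𝓝 (cdf ν x))) {B : ℝ} (hB : 0 ≤ B)
    (hμB : ∀ᶠ n in atTop, μ n (Set.Icc (-B) B)ᶜ = 0) (hνB : ν (Set.Icc (-B) B)ᶜ = 0) (k : ℕ) :
    Tendsto (fun n => ∫ x, x ^ k ∂μ n) atTop (𝓝 (∫ x, x ^ k ∂ν)) := by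
  have hbd : ∀ x : ℝ, ‖(max (-B) (min B x)) ^ k‖ ≤ B ^ k := fun x => by
    rw [norm_pow]
    refine pow_le_pow_left₀ (norm_nonneg _) ?_ k
    rw [Real.norm_eq_abs, abs_le]
    exact ⟨le_max_left _ _, max_le (by linarith) (min_le_left _ _)⟩
  let g : BoundedContinuousFunction ℝ ℝ :=
    BoundedContinuousFunction.ofNormedAddCommGroup (fun x => (max (-B) (min B x)) ^ k)
      (by fun_prop) (B ^ k) hbd
  have e : ∀ {ρ : Measure ℝ}, ρ (Set.Icc (-B) B)ᶜ = 0 → ∫ x, g x ∂ρ = ∫ x, x ^ k ∂ρ := by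
    intro ρ hρ
    refine integral_congr_ae ((ae_mem_of_compl hρ).mono fun x hx => ?_)
    change (max (-B) (min B x)) ^ k = x ^ k
    rw [min_eq_right hx.2, max_eq_right hx.1]
  rw [← e hνB]
  exact (tendsto_integral_of_tendsto_cdf hμ h g).congr' (hμB.mono fun n hn => e hn)

lemma msupport_subset_Icc {μ : Measure ℝ} {B : ℝ} (h : μ (Set.Icc (-B) B)ᶜ = 0) :
    msupport μ ⊆ Set.Icc (-B) B := by
  intro x hx
  by_contra hx'
  exact (hx _ isClosed_Icc.isOpen_compl hx').ne' h

end WeakConvergence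

section SelfNormalized

open scoped ComplexOrder

variable {A : Type*} [CStarAlgebra A] [PartialOrder A] [StarOrderedRing A] {f : A →ₚ[ℂ] ℂ}
  [Nontrivial A]

lemma one_le_of_variance_one (h1 : f 1 = 1) {x : A} (h2 : f (x ^ 2) = 1) {L : ℝ}
    (hx : ‖x‖ ≤ L) : 1 ≤ L := by
  have hL : 0 ≤ L := (norm_nonneg _).trans hx
  have h3 : ‖f (x ^ 2)‖ ≤ L ^ 2 :=
    (norm_apply_le h1 _).trans ((norm_pow_le' x two_pos).trans (by gcongr))
  rw [h2, norm_one] at h3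
  exact one_le_sq_iff₀ hL |>.1 h3

variable {ι : Type*} [Fintype ι] [Nonempty ι]

lemma norm_normalized_sum_sq_sub_one_le (h1 : f 1 = 1)
    (hf : ∀ x, f (star x * x) = 0 → x = 0) {X : ι → A}
    (hsa : ∀ i, IsSelfAdjoint (X i))
    (hfree : IsFreeFamily f.toLinearMap fun i => Algebra.adjoin ℂ {X i})
    (hid : ∀ i j (k : ℕ), f (X i ^ k) = f (X j ^ k)) (h2 : ∀ i, f (X i ^ 2) = 1)
    {L n t : ℝ} (hXL : ∀ i, ‖X i‖ ≤ L) (hn : n = Fintype.card ι) (ht : t = L ^ 2 / √n) :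
    ‖n⁻¹ • ∑ i, X i ^ 2 - 1‖ ≤ t * (2 + t) := by
  have hL : 1 ≤ L := one_le_of_variance_one h1 (h2 (Classical.arbitrary ι)) (hXL _)
  have hn0 : 1 ≤ n := by
    rw [hn]
    exact_mod_cast Fintype.card_pos
  have hs : 1 ≤ √n := Real.one_le_sqrt.2 hn0
  have key := norm_sum_sq_sub_le h1 hf hsa hfree hid h2 hL hXL
  have e : n⁻¹ • ∑ i, X i ^ 2 - 1 =
      n⁻¹ • (∑ i, X i ^ 2 - algebraMap ℂ A (Fintype.card ι)) := by
    have : algebraMap ℂ A (Fintype.card ι) = n • (1 : A) := by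
      rw [Algebra.algebraMap_eq_smul_one, ← Complex.coe_smul, hn]
      norm_cast
    rw [this, smul_sub, smul_smul, inv_mul_cancel₀ (by positivity), one_smul]
  rw [e, norm_smul, Real.norm_of_nonneg (by positivity), inv_mul_le_iff₀ (by positivity)]
  rw [← hn] at key
  refine key.trans ?_
  have hsq : √n ^ 2 = n := Real.sq_sqrt (by linarith)
  have e2 : n * (t * (2 + t)) = 2 * L ^ 2 * √n + L ^ 2 * L ^ 2 := by
    rw [ht]
    field_simp
    rw [hsq]
  rw [e2]
  have : L ≤ L ^ 2 := by nlinarith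
  nlinarith

lemma isUnit_sum_sq (h1 : f 1 = 1) (hf : ∀ x, f (star x * x) = 0 → x = 0) {X : ι → A}
    (hsa : ∀ i, IsSelfAdjoint (X i))
    (hfree : IsFreeFamily f.toLinearMap fun i => Algebra.adjoin ℂ {X i})
    (hid : ∀ i j (k : ℕ), f (X i ^ k) = f (X j ^ k)) (h2 : ∀ i, f (X i ^ 2) = 1)
    {L n t : ℝ} (hXL : ∀ i, ‖X i‖ ≤ L) (hn : n = Fintype.card ι) (ht : t = L ^ 2 / √n)
    (ht4 : t < 1 / 4) : IsUnit (∑ i, X i ^ 2) := by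
  have hn0 : 0 < n := by
    rw [hn]
    exact_mod_cast Fintype.card_pos
  have ht0 : 0 ≤ t := by rw [ht]; positivity
  have key := norm_normalized_sum_sq_sub_one_le h1 hf hsa hfree hid h2 hXL hn ht
  have hu : IsUnit (n⁻¹ • ∑ i, X i ^ 2) := by
    have := isUnit_one_sub_of_norm_lt_one (x := 1 - n⁻¹ • ∑ i, X i ^ 2)
      (by rw [norm_sub_rev]; nlinarith)
    rwa [sub_sub_cancel] at this
  have := hu.smul (Units.mk0 n hn0.ne')
  rwa [Units.smul_def, Units.val_mk0, smul_smul, mul_inv_cancel₀ hn0.ne', one_smul] at this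

lemma conj_sum_bounds (h1 : f 1 = 1) (hf : ∀ x, f (star x * x) = 0 → x = 0) {X : ι → A}
    (hsa : ∀ i, IsSelfAdjoint (X i))
    (hfree : IsFreeFamily f.toLinearMap fun i => Algebra.adjoin ℂ {X i})
    (hid : ∀ i j (k : ℕ), f (X i ^ k) = f (X j ^ k)) (h0 : ∀ i, f (X i) = 0)
    (h2 : ∀ i, f (X i ^ 2) = 1)
    {L n t : ℝ} (hXL : ∀ i, ‖X i‖ ≤ L) (hn : n = Fintype.card ι) (ht : t = L ^ 2 / √n)
    (ht4 : t < 1 / 4) {W : A} (hW : 0 ≤ W) (hWV : W ^ 4 * ∑ i, X i ^ 2 = 1) :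
    ‖W * (∑ i, X i) * W‖ ≤ (2 + t) * (1 - t * (2 + t))⁻¹ ∧
      ‖W * (∑ i, X i) * W - (√n)⁻¹ • ∑ i, X i‖ ≤ 40 * t := by
  have hL : 1 ≤ L := one_le_of_variance_one h1 (h2 (Classical.arbitrary ι)) (hXL _)
  have hn0 : 0 < n := by
    rw [hn]
    exact_mod_cast Fintype.card_pos
  have hs : 0 < √n := Real.sqrt_pos.2 hn0
  have ht0 : 0 ≤ t := by rw [ht]; positivity
  have hv := norm_normalized_sum_sq_sub_one_le h1 hf hsa hfree hid h2 hXL hn ht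
  have hT : ‖(√n)⁻¹ • ∑ i, X i‖ ≤ 2 + t := by
    have := norm_sum_le_of_variance_one h1 hf hsa hfree hid h0 h2 hXL
    rw [← hn] at this
    rw [norm_smul, Real.norm_of_nonneg (by positivity), inv_mul_le_iff₀ hs]
    refine this.trans ?_
    have : √n * (2 + t) = L ^ 2 + 2 * √n := by
      rw [ht]
      field_simp
      ring
    rw [this]
    nlinarith
  have hc2 : √√n ^ 2 = √n := Real.sq_sqrt hs.le
  have hc4 : √√n ^ 4 = n := by
    rw [show √√n ^ 4 = (√√n ^ 2) ^ 2 by ring, hc2, Real.sq_sqrt hn0.le]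
  have hwv : (√√n • W) ^ 4 * n⁻¹ • ∑ i, X i ^ 2 = 1 := by
    rw [smul_pow, hc4, smul_mul_smul_comm, hWV, mul_inv_cancel₀ hn0.ne', one_smul]
  have hU : (√√n • W) * ((√n)⁻¹ • ∑ i, X i) * (√√n • W) = W * (∑ i, X i) * W := by
    rw [smul_mul_smul_comm, smul_mul_smul_comm]
    have : √√n * (√n)⁻¹ * √√n = 1 := by
      rw [mul_right_comm, ← sq, hc2, mul_inv_cancel₀ hs.ne']
    rw [this, one_smul]
  have hδ : t * (2 + t) ≤ 9 / 4 * t := by nlinarith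
  have hδ0 : 0 ≤ t * (2 + t) := by positivity
  have key := norm_conj_sub_le (smul_nonneg (Real.sqrt_nonneg _) hW) hwv (by linarith) hv hT
  rw [hU] at key
  refine ⟨key.1, key.2.trans ?_⟩
  have hi : (1 - t * (2 + t))⁻¹ ≤ 16 / 7 := by
    rw [inv_le_comm₀ (by linarith) (by norm_num)]
    linarith
  have hi0 : 0 ≤ (1 - t * (2 + t))⁻¹ := inv_nonneg.2 (by linarith)
  have hq : t * (2 + t) * (1 - t * (2 + t))⁻¹ ≤ 36 / 7 * t := by
    calc _ ≤ 9 / 4 * t * (16 / 7) := by gcongr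
      _ = _ := by ring
  have hq0 : 0 ≤ t * (2 + t) * (1 - t * (2 + t))⁻¹ := by positivity
  calc _ ≤ 36 / 7 * t * (9 / 4) * (2 + 9 / 7) := by
        gcongr
        · linarith
        · linarith
    _ ≤ _ := by linarith

lemma conj_ne_zero {W V S : A} (hS : S ≠ 0) (hWV : W ^ 4 * V = 1) (hVW : V * W ^ 4 = 1) :
    W * S * W ≠ 0 := by
  intro h
  refine hS ?_
  calc S = (V * W ^ 4) * S * (W ^ 4 * V) := by rw [hWV, hVW, one_mul, mul_one]
    _ = V * W ^ 3 * (W * S * W) * (W ^ 3 * V) := by noncomm_ring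
    _ = 0 := by rw [h]; simp

lemma isSelfAdjoint_conj {W S : A} (hW : 0 ≤ W) (hS : IsSelfAdjoint S) :
    IsSelfAdjoint (W * S * W) := by
  have := hS.conjugate W
  rwa [hW.isSelfAdjoint.star_eq] at this

lemma isSelfAdjoint_sum_fintype {X : ι → A} (hsa : ∀ i, IsSelfAdjoint (X i)) :
    IsSelfAdjoint (∑ i, X i) := by
  rw [IsSelfAdjoint, star_sum]
  exact Finset.sum_congr rfl fun i _ => (hsa i).star_eq

lemma abs_cdf_normalized_sum_le (h1 : f 1 = 1) (hf : ∀ x, f (star x * x) = 0 → x = 0) {X : ι → A}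
    (hsa : ∀ i, IsSelfAdjoint (X i))
    (hfree : IsFreeFamily f.toLinearMap fun i => Algebra.adjoin ℂ {X i})
    (hid : ∀ i j (k : ℕ), f (X i ^ k) = f (X j ^ k)) (h0 : ∀ i, f (X i) = 0)
    (h2 : ∀ i, f (X i ^ 2) = 1)
    {L n : ℝ} (hXL : ∀ i, ‖X i‖ ≤ L) (hn : n = Fintype.card ι) (hn16 : 16 ≤ n)
    (hη : L / √n ≤ 1 / 4) {ν : Measure ℝ} [IsProbabilityMeasure ν]
    (hν : ∀ h : ℝ → ℝ, Continuous h → ∫ t, h t ∂ν = (f (cfc h ((√n)⁻¹ • ∑ i, X i))).re) (x : ℝ) :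
    |cdf ν x - cdf semicircleLaw x| ≤ 40 * (L / √n) + 80 * Real.log n / √n := by
  have hs : 0 < √n := Real.sqrt_pos.2 (by linarith)
  have hsm : ∀ y : A, (√n)⁻¹ • y = (((√n)⁻¹ : ℝ) : ℂ) • y := fun y => (Complex.coe_smul _ _).symm
  rw [Finset.smul_sum] at hν
  refine abs_cdf_sum_sub_semicircle_le h1 hf (Y := fun i => (√n)⁻¹ • X i)
    (fun i => (IsSelfAdjoint.all _).smul (hsa i)) ?_ ?_ ?_ hn hn16 ?_ hη ?_ hν x
  · refine isFreeFamily_mono (fun i => Algebra.adjoin_le ?_) hfree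
    rw [Set.singleton_subset_iff, hsm]
    exact Subalgebra.smul_mem _ (Algebra.self_mem_adjoin_singleton ℂ _) _
  · intro i j k
    simp only [hsm, smul_pow, map_smul, hid i j]
  · intro i
    rw [hsm, map_smul, h0, smul_zero]
  · intro i
    rw [norm_smul, Real.norm_of_nonneg (by positivity), inv_mul_eq_div]
    gcongr
    exact hXL i
  · intro i
    have e : l2 f (X i) ^ 2 = 1 := by rw [l2_sq, (hsa i).star_eq, ← sq, h2, Complex.one_re]
    rw [hsm, l2_smul, mul_pow, e, mul_one, Complex.norm_real, Real.norm_of_nonneg (by positivity),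
      inv_pow, Real.sq_sqrt (by linarith)]

/-- Rate of convergence for the self-normalized sums. -/
theorem abs_cdf_self_normalized_le (h1 : f 1 = 1) (hf : ∀ x, f (star x * x) = 0 → x = 0)
    (htr : ∀ x y, f (x * y) = f (y * x)) {X : ι → A}
    (hsa : ∀ i, IsSelfAdjoint (X i))
    (hfree : IsFreeFamily f.toLinearMap fun i => Algebra.adjoin ℂ {X i})
    (hid : ∀ i j (k : ℕ), f (X i ^ k) = f (X j ^ k)) (h0 : ∀ i, f (X i) = 0)
    (h2 : ∀ i, f (X i ^ 2) = 1)
    {L n : ℝ} (hXL : ∀ i, ‖X i‖ ≤ L) (hn : n = Fintype.card ι) (hnL : 16 * L ^ 4 < n) {W : A}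
    (hW : 0 ≤ W) (hWV : W ^ 4 * ∑ i, X i ^ 2 = 1) (hVW : (∑ i, X i ^ 2) * W ^ 4 = 1)
    {μ : Measure ℝ} (hμ : IsDistribution f.toLinearMap (W * (∑ i, X i) * W) μ) (x : ℝ) :
    |cdf μ x - cdf semicircleLaw x| ≤ 160 * L ^ 3 * Real.log n / √n := by
  have hL : 1 ≤ L := one_le_of_variance_one h1 (h2 (Classical.arbitrary ι)) (hXL _)
  have hL2 : 1 ≤ L ^ 2 := one_le_pow₀ hL
  have hL3 : L ^ 2 ≤ L ^ 3 := pow_le_pow_right₀ hL (by norm_num)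
  have hL4 : 1 ≤ L ^ 4 := one_le_pow₀ hL
  have hs : 0 < √n := Real.sqrt_pos.2 (by linarith)
  have ht4 : L ^ 2 / √n < 1 / 4 := by
    rw [div_lt_iff₀ hs]
    have : 4 * L ^ 2 < √n := Real.lt_sqrt_of_sq_lt (by nlinarith)
    linarith
  have hlog : 1 ≤ Real.log n := by
    rw [Real.le_log_iff_exp_le (by linarith)]
    linarith [Real.exp_one_lt_d9]
  have hη : L / √n ≤ L ^ 2 / √n := by
    gcongr
    nlinarith
  have hU := isSelfAdjoint_conj hW (isSelfAdjoint_sum_fintype hsa)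
  have hU0 := conj_ne_zero (sum_ne_zero_of_variance_one hfree h0 h2) hWV hVW
  have hTsa : IsSelfAdjoint ((√n)⁻¹ • ∑ i, X i) :=
    (IsSelfAdjoint.all _).smul (isSelfAdjoint_sum_fintype hsa)
  obtain ⟨ν, hνp, -, hν⟩ := exists_measure h1 hTsa
  have := hμ.1
  have key := abs_cdf_sub_semicircle_le_of_norm_sub_le h1 htr hU hTsa
    (fun h hh => integral_eq_of_distribution h1 hf hU hU0 hμ hh) hν
    (ε := 40 * (L ^ 2 / √n)) (by positivity)
    (conj_sum_bounds h1 hf hsa hfree hid h0 h2 hXL hn rfl ht4 hW hWV).2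
    (abs_cdf_normalized_sum_le h1 hf hsa hfree hid h0 h2 hXL hn (by linarith)
      (hη.trans ht4.le) hν) x
  refine key.trans ?_
  have e : 160 * L ^ 3 * Real.log n / √n = 160 * (L ^ 3 * Real.log n) / √n := by ring
  have e2 : 40 * (L / √n) + 80 * Real.log n / √n + 40 * (L ^ 2 / √n) =
      (40 * L + 80 * Real.log n + 40 * L ^ 2) / √n := by ring
  rw [e, e2]
  gcongr
  nlinarith [mul_le_mul (hL2.trans hL3) hlog zero_le_one (by positivity),
    mul_le_mul hL3 hlog zero_le_one (by positivity),
    mul_le_mul_of_nonneg_right (hL2.trans hL3) (zero_le_one.trans hlog)]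

/-- Location of the distribution of the self-normalized sums. -/
theorem self_normalized_compl_Icc (h1 : f 1 = 1) (hf : ∀ x, f (star x * x) = 0 → x = 0)
    {X : ι → A} (hsa : ∀ i, IsSelfAdjoint (X i))
    (hfree : IsFreeFamily f.toLinearMap fun i => Algebra.adjoin ℂ {X i})
    (hid : ∀ i j (k : ℕ), f (X i ^ k) = f (X j ^ k)) (h0 : ∀ i, f (X i) = 0)
    (h2 : ∀ i, f (X i ^ 2) = 1)
    {L n t : ℝ} (hXL : ∀ i, ‖X i‖ ≤ L) (hn : n = Fintype.card ι) (ht : t = L ^ 2 / √n)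
    (ht4 : t < 1 / 4) {W : A}
    (hW : 0 ≤ W) (hWV : W ^ 4 * ∑ i, X i ^ 2 = 1) (hVW : (∑ i, X i ^ 2) * W ^ 4 = 1)
    {μ : Measure ℝ} (hμ : IsDistribution f.toLinearMap (W * (∑ i, X i) * W) μ) :
    μ (Set.Icc (-((2 + t) * (1 - t * (2 + t))⁻¹)) ((2 + t) * (1 - t * (2 + t))⁻¹))ᶜ = 0 := by
  have hU := isSelfAdjoint_conj hW (isSelfAdjoint_sum_fintype hsa)
  have hU0 := conj_ne_zero (sum_ne_zero_of_variance_one hfree h0 h2) hWV hVW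
  have hb := (conj_sum_bounds h1 hf hsa hfree hid h0 h2 hXL hn ht ht4 hW hWV).1
  refine measure_mono_null ?_ (distribution_compl_Icc h1 hf hU hU0 hμ)
  exact Set.compl_subset_compl.2 (Set.Icc_subset_Icc (neg_le_neg hb) hb)

end SelfNormalized

section Sequences

open scoped ComplexOrder

variable {A : Type*} [CStarAlgebra A] [PartialOrder A] [StarOrderedRing A]

/-- A state, as a positive linear functional. -/
lemma exists_positiveLinearMap {φ : A →ₗ[ℂ] ℂ} (hφ : IsState φ) :
    ∃ f : A →ₚ[ℂ] ℂ, f.toLinearMap = φ := by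
  refine ⟨PositiveLinearMap.mk₀ φ fun x hx => ?_, rfl⟩
  obtain ⟨s, rfl⟩ := CStarAlgebra.nonneg_iff_eq_star_mul_self.1 hx
  exact Complex.le_def.2 ⟨(hφ.2 s).1, (hφ.2 s).2.symm⟩

variable {f : A →ₚ[ℂ] ℂ} [Nontrivial A]

/-- A free identically distributed standardized sequence with respect to a faithful trace. -/
structure IsFreeStandardized (f : A →ₚ[ℂ] ℂ) (X : ℕ → A) : Prop where
  one : f 1 = 1
  faithful : ∀ x, f (star x * x) = 0 → x = 0
  trace : ∀ x y, f (x * y) = f (y * x)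
  isSelfAdjoint : ∀ i, IsSelfAdjoint (X i)
  free : IsFreeFamily f.toLinearMap fun i => Algebra.adjoin ℂ {X i}
  moments : ∀ i (k : ℕ), f (X i ^ k) = f (X 0 ^ k)
  mean : f (X 0) = 0
  variance : f (X 0 ^ 2) = 1

namespace IsFreeStandardized

variable {X : ℕ → A} (h : IsFreeStandardized f X)
include h

lemma free_fin (n : ℕ) : IsFreeFamily f.toLinearMap fun i : Fin n => Algebra.adjoin ℂ {X i} :=
  isFreeFamily_comp (g := fun i : Fin n => (i : ℕ)) Fin.val_injective h.free

lemma moments_fin (n : ℕ) (i j : Fin n) (k : ℕ) : f (X i ^ k) = f (X j ^ k) := by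
  rw [h.moments i, h.moments j]

lemma mean_eq (i : ℕ) : f (X i) = 0 := by
  simpa [h.mean] using h.moments i 1

lemma variance_eq (i : ℕ) : f (X i ^ 2) = 1 := by
  rw [h.moments, h.variance]

lemma norm_le (i : ℕ) : ‖X i‖ ≤ ‖X 0‖ :=
  norm_le_of_moments h.one h.faithful (h.isSelfAdjoint i) (h.isSelfAdjoint 0) (h.moments i)

lemma one_le_norm : 1 ≤ ‖X 0‖ := one_le_of_variance_one h.one h.variance le_rfl

omit h in
lemma sq_div_sqrt_lt {L : ℝ} {n c : ℝ} (hc : 0 < c) (hn : c ^ 2 * L ^ 4 < n) :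
    L ^ 2 / √n < 1 / c := by
  have hn0 : 0 < n := lt_of_le_of_lt (by positivity) hn
  rw [div_lt_div_iff₀ (Real.sqrt_pos.2 hn0) hc, one_mul]
  refine Real.lt_sqrt_of_sq_lt ?_
  calc _ = c ^ 2 * L ^ 4 := by ring
    _ < n := hn

lemma nonempty_fin {n : ℕ} (hn : 16 * ‖X 0‖ ^ 4 < (n : ℝ)) : Nonempty (Fin n) := by
  refine Fin.pos_iff_nonempty.1 (Nat.pos_of_ne_zero ?_)
  rintro rfl
  have : 0 ≤ 16 * ‖X 0‖ ^ 4 := by positivity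
  simp only [Nat.cast_zero] at hn
  linarith

lemma sq_div_sqrt_lt_quarter {n : ℕ} (hn : 16 * ‖X 0‖ ^ 4 < (n : ℝ)) :
    ‖X 0‖ ^ 2 / √(n : ℝ) < 1 / 4 :=
  sq_div_sqrt_lt (by norm_num) (by norm_num; exact hn)

lemma isUnit_sum_sq {n : ℕ} (hn : 16 * ‖X 0‖ ^ 4 < (n : ℝ)) :
    IsUnit (∑ i ∈ Finset.range n, X i ^ 2) := by
  have := h.nonempty_fin hn
  rw [Finset.sum_range]
  exact FreeCLT.isUnit_sum_sq h.one h.faithful (fun i : Fin n => h.isSelfAdjoint i) (h.free_fin n)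
    (h.moments_fin n) (fun i => h.variance_eq i) (fun i => h.norm_le i) (by simp) rfl
    (h.sq_div_sqrt_lt_quarter hn)

lemma exists_inverse_fourth_root {n : ℕ} (hn : 16 * ‖X 0‖ ^ 4 < (n : ℝ)) :
    ∃ W : A, 0 ≤ W ∧ W ^ 4 * (∑ i ∈ Finset.range n, X i ^ 2) = 1 ∧
      (∑ i ∈ Finset.range n, X i ^ 2) * W ^ 4 = 1 :=
  FreeCLT.exists_inverse_fourth_root
    (Finset.sum_nonneg fun i _ => (h.isSelfAdjoint i).sq_nonneg) (h.isUnit_sum_sq hn)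

lemma abs_cdf_le {n : ℕ} (hn : 16 * ‖X 0‖ ^ 4 < (n : ℝ)) {W : A} (hW : 0 ≤ W)
    (hWV : W ^ 4 * (∑ i ∈ Finset.range n, X i ^ 2) = 1)
    (hVW : (∑ i ∈ Finset.range n, X i ^ 2) * W ^ 4 = 1) {μ : Measure ℝ}
    (hμ : IsDistribution f.toLinearMap (W * (∑ i ∈ Finset.range n, X i) * W) μ) (x : ℝ) :
    |cdf μ x - cdf semicircleLaw x| ≤ 160 * ‖X 0‖ ^ 3 * Real.log n / √n := by
  have := h.nonempty_fin hn
  rw [Finset.sum_range] at hWV hVW hμ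
  exact abs_cdf_self_normalized_le h.one h.faithful h.trace (fun i : Fin n => h.isSelfAdjoint i)
    (h.free_fin n) (h.moments_fin n) (fun i => h.mean_eq i) (fun i => h.variance_eq i)
    (fun i => h.norm_le i) (by simp) hn hW hWV hVW hμ x

lemma compl_Icc {n : ℕ} (hn : 16 * ‖X 0‖ ^ 4 < (n : ℝ)) {t : ℝ} (ht : t = ‖X 0‖ ^ 2 / √(n : ℝ))
    {W : A} (hW : 0 ≤ W)
    (hWV : W ^ 4 * (∑ i ∈ Finset.range n, X i ^ 2) = 1)
    (hVW : (∑ i ∈ Finset.range n, X i ^ 2) * W ^ 4 = 1) {μ : Measure ℝ}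
    (hμ : IsDistribution f.toLinearMap (W * (∑ i ∈ Finset.range n, X i) * W) μ) :
    μ (Set.Icc (-((2 + t) * (1 - t * (2 + t))⁻¹)) ((2 + t) * (1 - t * (2 + t))⁻¹))ᶜ = 0 := by
  have := h.nonempty_fin hn
  rw [Finset.sum_range] at hWV hVW hμ
  exact self_normalized_compl_Icc h.one h.faithful (fun i : Fin n => h.isSelfAdjoint i)
    (h.free_fin n) (h.moments_fin n) (fun i => h.mean_eq i) (fun i => h.variance_eq i)
    (fun i => h.norm_le i) (by simp) ht (ht ▸ h.sq_div_sqrt_lt_quarter hn) hW hWV hVW hμ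

lemma compl_Icc_six {n : ℕ} (hn : 16 * ‖X 0‖ ^ 4 < (n : ℝ)) {W : A} (hW : 0 ≤ W)
    (hWV : W ^ 4 * (∑ i ∈ Finset.range n, X i ^ 2) = 1)
    (hVW : (∑ i ∈ Finset.range n, X i ^ 2) * W ^ 4 = 1) {μ : Measure ℝ}
    (hμ : IsDistribution f.toLinearMap (W * (∑ i ∈ Finset.range n, X i) * W) μ) :
    μ (Set.Icc (-6) 6)ᶜ = 0 := by
  obtain ⟨t, ht⟩ : ∃ t, t = ‖X 0‖ ^ 2 / √(n : ℝ) := ⟨_, rfl⟩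
  have ht4 : t < 1 / 4 := ht ▸ h.sq_div_sqrt_lt_quarter hn
  have ht0 : 0 ≤ t := by rw [ht]; positivity
  have hb : (2 + t) * (1 - t * (2 + t))⁻¹ ≤ 6 := by
    rw [← div_eq_mul_inv, div_le_iff₀ (by nlinarith)]
    nlinarith
  exact measure_mono_null (Set.compl_subset_compl.2 (Set.Icc_subset_Icc (neg_le_neg hb) hb))
    (h.compl_Icc hn ht hW hWV hVW hμ)

lemma msupport_subset {n : ℕ} (hn : 64 * ‖X 0‖ ^ 4 < (n : ℝ)) {W : A} (hW : 0 ≤ W)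
    (hWV : W ^ 4 * (∑ i ∈ Finset.range n, X i ^ 2) = 1)
    (hVW : (∑ i ∈ Finset.range n, X i ^ 2) * W ^ 4 = 1) {μ : Measure ℝ}
    (hμ : IsDistribution f.toLinearMap (W * (∑ i ∈ Finset.range n, X i) * W) μ) :
    msupport μ ⊆ Set.Ioo (-2 - 58 * ‖X 0‖ ^ 2 / √(n : ℝ)) (2 + 58 * ‖X 0‖ ^ 2 / √(n : ℝ)) := by
  have hL := h.one_le_norm
  obtain ⟨t, ht⟩ : ∃ t, t = ‖X 0‖ ^ 2 / √(n : ℝ) := ⟨_, rfl⟩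
  have ht8 : t < 1 / 8 :=
    ht ▸ sq_div_sqrt_lt (by norm_num) (by norm_num; exact hn)
  have hn16 : 16 * ‖X 0‖ ^ 4 < (n : ℝ) := by
    have : 0 ≤ ‖X 0‖ ^ 4 := by positivity
    linarith
  have hn0 : (0 : ℝ) < n := lt_of_le_of_lt (by positivity) hn
  have ht0 : 0 < t := by rw [ht]; positivity
  have hb : (2 + t) * (1 - t * (2 + t))⁻¹ < 2 + 58 * t := by
    rw [← div_eq_mul_inv, div_lt_iff₀ (by nlinarith)]
    nlinarith [mul_pos ht0 ht0, mul_pos ht0 (sub_pos.2 ht8),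
      mul_pos (mul_pos ht0 ht0) (sub_pos.2 ht8)]
  have e : 58 * ‖X 0‖ ^ 2 / √(n : ℝ) = 58 * t := by rw [ht]; ring
  rw [e]
  refine (msupport_subset_Icc (h.compl_Icc hn16 ht hW hWV hVW hμ)).trans fun x hx => ?_
  exact ⟨by linarith [hx.1], by linarith [hx.2]⟩

omit h in
lemma tendsto_log_div_sqrt (c : ℝ) :
    Tendsto (fun n : ℕ => c * Real.log n / √(n : ℝ)) atTop (𝓝 0) := by
  have h1 : Tendsto (fun x : ℝ => Real.log x / √x) atTop (𝓝 0) := by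
    simp only [Real.sqrt_eq_rpow]
    exact (isLittleO_log_rpow_atTop (by norm_num)).tendsto_div_nhds_zero
  have h2 := (h1.comp tendsto_natCast_atTop_atTop).const_mul c
  rw [mul_zero] at h2
  exact h2.congr fun n => by simp only [Function.comp_apply]; ring

lemma tendsto {W : ℕ → A} {μ : ℕ → Measure ℝ}
    (hμ : ∀ n : ℕ, 16 * ‖X 0‖ ^ 4 < (n : ℝ) → 0 ≤ W n ∧
      W n ^ 4 * (∑ i ∈ Finset.range n, X i ^ 2) = 1 ∧
      (∑ i ∈ Finset.range n, X i ^ 2) * W n ^ 4 = 1 ∧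
      IsDistribution f.toLinearMap (W n * (∑ i ∈ Finset.range n, X i) * W n) (μ n)) :
    (∀ g : BoundedContinuousFunction ℝ ℝ,
      Tendsto (fun n => ∫ x, g x ∂μ n) atTop (𝓝 (∫ x, g x ∂semicircleLaw))) ∧
    ∀ k : ℕ, Tendsto (fun n => ∫ x, x ^ k ∂μ n) atTop (𝓝 (∫ x, x ^ k ∂semicircleLaw)) := by
  have hn : ∀ᶠ n : ℕ in atTop, 16 * ‖X 0‖ ^ 4 < (n : ℝ) :=
    tendsto_natCast_atTop_atTop.eventually_gt_atTop _
  have hp : ∀ᶠ n in atTop, IsProbabilityMeasure (μ n) := hn.mono fun n hn => (hμ n hn).2.2.2.1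
  have hc : ∀ x, Tendsto (fun n => cdf (μ n) x) atTop (𝓝 (cdf semicircleLaw x)) := fun x => by
    rw [tendsto_iff_norm_sub_tendsto_zero]
    refine squeeze_zero' (Eventually.of_forall fun n => norm_nonneg _) (hn.mono fun n hn => ?_)
      (tendsto_log_div_sqrt (160 * ‖X 0‖ ^ 3))
    obtain ⟨hW, hWV, hVW, hd⟩ := hμ n hn
    exact h.abs_cdf_le hn hW hWV hVW hd x
  refine ⟨tendsto_integral_of_tendsto_cdf hp hc,
    tendsto_integral_pow_of_tendsto_cdf (B := 6) hp hc (by norm_num) (hn.mono fun n hn => ?_) ?_⟩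
  · obtain ⟨hW, hWV, hVW, hd⟩ := hμ n hn
    exact h.compl_Icc_six hn hW hWV hVW hd
  · refine measure_mono_null (Set.compl_subset_compl.2 (Set.Icc_subset_Icc ?_ ?_))
      semicircleLaw_compl_Icc <;> norm_num

end IsFreeStandardized

end Sequences

end FreeCLT

/-- **Corollary 1.3** (bounded self-normalized sums, identically distributed case).
For free identically distributed self-adjoint `X i` with mean `0` and variance `1`:
(a) for `n > 16‖X 0‖⁴` the sum `V_n² = ∑ X_i²` is invertible and
`U_n = V_n^{-1/2} S_n V_n^{-1/2}` (written `W * S_n * W` with `W ≥ 0` the inverse fourth root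
of `V_n²`) is well-defined and self-adjoint; (b) there is an absolute constant `C > 0` with
`Δ(μ_n, ω) ≤ C‖X 0‖³ (log n)/√n` for those `n`; (c) `μ_n` converges weakly to the semicircle
law together with all moments; (d) for `n > 64‖X 0‖⁴` the support of `μ_n` is contained in
`(-2 - 58‖X 0‖²/√n, 2 + 58‖X 0‖²/√n)`. -/
theorem stmt_3 :
    ∃ C : ℝ, 0 < C ∧
    ∀ (A : Type) [NormedRing A] [StarRing A] [CStarRing A] [NormedAlgebra ℂ A]
      [CompleteSpace A] [StarModule ℂ A] [PartialOrder A] [StarOrderedRing A]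
      (φ : A →ₗ[ℂ] ℂ), IsState φ → IsTracial φ → IsFaithful φ →
    ∀ X : ℕ → A,
      (∀ i, IsSelfAdjoint (X i)) → AreFree φ X →
      (∀ i k, φ (X i ^ k) = φ (X 0 ^ k)) →
      φ (X 0) = 0 → φ (X 0 ^ 2) = 1 →
      -- (a) well-definedness
      (∀ n : ℕ, 16 * ‖X 0‖ ^ 4 < (n : ℝ) →
        IsUnit (∑ i ∈ Finset.range n, X i ^ 2) ∧
        ∃ W : A, 0 ≤ W ∧
          W ^ 4 * (∑ i ∈ Finset.range n, X i ^ 2) = 1 ∧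
          (∑ i ∈ Finset.range n, X i ^ 2) * W ^ 4 = 1) ∧
      -- (b) rate of convergence
      (∀ n : ℕ, 16 * ‖X 0‖ ^ 4 < (n : ℝ) →
        ∀ W : A, 0 ≤ W →
          W ^ 4 * (∑ i ∈ Finset.range n, X i ^ 2) = 1 →
          (∑ i ∈ Finset.range n, X i ^ 2) * W ^ 4 = 1 →
          IsSelfAdjoint (W * (∑ i ∈ Finset.range n, X i) * W) ∧
          ∀ μ : Measure ℝ,
            IsDistribution φ (W * (∑ i ∈ Finset.range n, X i) * W) μ →
            kolDist μ semicircleLaw ≤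
              C * ‖X 0‖ ^ 3 * Real.log n / Real.sqrt n) ∧
      -- (c) weak convergence and convergence of moments
      (∀ (W : ℕ → A) (μ : ℕ → Measure ℝ),
        (∀ n : ℕ, 16 * ‖X 0‖ ^ 4 < (n : ℝ) →
          0 ≤ W n ∧
          (W n) ^ 4 * (∑ i ∈ Finset.range n, X i ^ 2) = 1 ∧
          (∑ i ∈ Finset.range n, X i ^ 2) * (W n) ^ 4 = 1 ∧
          IsDistribution φ (W n * (∑ i ∈ Finset.range n, X i) * W n) (μ n)) →
        (∀ f : BoundedContinuousFunction ℝ ℝ,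
          Tendsto (fun n => ∫ x, f x ∂(μ n)) atTop (nhds (∫ x, f x ∂semicircleLaw))) ∧
        ∀ k : ℕ,
          Tendsto (fun n => ∫ x, x ^ k ∂(μ n)) atTop
            (nhds (∫ x, x ^ k ∂semicircleLaw))) ∧
      -- (d) support
      (∀ n : ℕ, 64 * ‖X 0‖ ^ 4 < (n : ℝ) →
        ∀ W : A, 0 ≤ W →
          W ^ 4 * (∑ i ∈ Finset.range n, X i ^ 2) = 1 →
          (∑ i ∈ Finset.range n, X i ^ 2) * W ^ 4 = 1 →
          ∀ μ : Measure ℝ,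
            IsDistribution φ (W * (∑ i ∈ Finset.range n, X i) * W) μ →
            msupport μ ⊆
              Set.Ioo (-2 - 58 * ‖X 0‖ ^ 2 / Real.sqrt n)
                (2 + 58 * ‖X 0‖ ^ 2 / Real.sqrt n)) := by
  refine ⟨160, by norm_num, ?_⟩
  intro A _ _ _ _ _ _ _ _ φ hφ htr hf X hsa hfree hid h0 h2
  let _ : CStarAlgebra A := {}
  have : Nontrivial A := ⟨⟨0, 1, fun h01 => by
    have h := hφ.1
    rw [← h01, map_zero] at h
    exact zero_ne_one h⟩⟩
  obtain ⟨f, rfl⟩ := FreeCLT.exists_positiveLinearMap hφ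
  have h : FreeCLT.IsFreeStandardized f X := ⟨hφ.1, hf, htr, hsa, hfree, hid, h0, h2⟩
  refine ⟨fun n hn => ⟨h.isUnit_sum_sq hn, h.exists_inverse_fourth_root hn⟩,
    fun n hn W hW hWV hVW => ⟨?_, fun μ hμ => ?_⟩, fun W μ hμ => h.tendsto hμ,
    fun n hn W hW hWV hVW μ hμ => h.msupport_subset hn hW hWV hVW hμ⟩
  · refine FreeCLT.isSelfAdjoint_conj hW ?_
    rw [IsSelfAdjoint, star_sum]
    exact Finset.sum_congr rfl fun i _ => (hsa i).star_eq
  · exact ciSup_le fun x => h.abs_cdf_le hn hW hWV hVW hμ x
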